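/- For every integer D > 0 with D ≡ 0 or 1 (mod 4), one has 4·∑_{(a,b,c)∈ℤ³, b²−4ac=D} ( √D − |a+c|·arcsin( √D / √((a−c)²+b²) ) ) = −80π·L_D(−1) − 8π·∑_{x,w∈ℤ, x≡D (mod 2)} H(D−x²−w²), where the series on the left converges absolutely and the sum on the right has only finitely many nonzero terms. -/

import Mathlib

/-!
STATEMENT 2: For every integer D > 0 with D ≡ 0 or 1 (mod 4),
4·∑_{(a,b,c)∈ℤ³, b²−4ac=D} ( √D − |a+c|·arcsin( √D / √((a−c)²+b²) ) )
  = −80π·L_D(−1) − 8π·∑_{x,w∈ℤ, x≡D (mod 2)} H(D−x²−w²),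
where the series on the left converges absolutely and the sum on the right has only finitely
many nonzero terms.  Here H is the Hurwitz class number and
L_D(−1) = L_{D₀}(−1)·∑_{d∣f} μ(d)χ_{D₀}(d)·d·σ₃(f/d) for the decomposition D = D₀f² with D₀
a fundamental discriminant, χ_{D₀} the Kronecker symbol (D₀/·) as a Dirichlet character
mod |D₀|, and L_{D₀} the analytic continuation of its Dirichlet L-series.
-/

open Complex

/-- Integral binary quadratic forms [a,b,c] are represented as triples (a,b,c) ∈ ℤ³,
with Q(x,y) = ax² + bxy + cy² and discriminant b² − 4ac. -/
def qfAct (g : Matrix.SpecialLinearGroup (Fin 2) ℤ) (Q : ℤ × ℤ × ℤ) : ℤ × ℤ × ℤ :=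
  ((Q.1 * (g.1 0 0) ^ 2 + Q.2.1 * (g.1 0 0) * (g.1 0 1) + Q.2.2 * (g.1 0 1) ^ 2),
   (2 * Q.1 * (g.1 0 0) * (g.1 1 0) + Q.2.1 * ((g.1 0 0) * (g.1 1 1) + (g.1 0 1) * (g.1 1 0)) +
      2 * Q.2.2 * (g.1 0 1) * (g.1 1 1)),
   (Q.1 * (g.1 1 0) ^ 2 + Q.2.1 * (g.1 1 0) * (g.1 1 1) + Q.2.2 * (g.1 1 1) ^ 2))

/-- SL₂(ℤ)-equivalence of integral binary quadratic forms. -/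
def qfRel (Q₁ Q₂ : ℤ × ℤ × ℤ) : Prop := ∃ g : Matrix.SpecialLinearGroup (Fin 2) ℤ, qfAct g Q₁ = Q₂

/-- The set of SL₂(ℤ)-classes of positive definite integral binary quadratic forms of
discriminant −n. -/
def qfClasses (n : ℤ) : Set (Quot qfRel) :=
  {q | ∃ Q : ℤ × ℤ × ℤ, Quot.mk qfRel Q = q ∧ Q.2.1 ^ 2 - 4 * Q.1 * Q.2.2 = -n ∧ 0 < Q.1}

/-- The Hurwitz class number H(n): H(0) = −1/12; for n > 0 with n ≡ 0, 3 (mod 4), H(n) is the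
number of SL₂(ℤ)-classes of positive definite integral binary quadratic forms of discriminant
−n, where the class containing a multiple of x²+y² is counted with weight 1/2 and the class
containing a multiple of x²+xy+y² with weight 1/3; H(n) = 0 otherwise. -/
noncomputable def hurwitzH (n : ℤ) : ℝ :=
  if n = 0 then -(1 / 12)
  else if 0 < n ∧ (n % 4 = 0 ∨ n % 4 = 3) then
    ((qfClasses n).ncard : ℝ)
      - 1 / 2 * (({q ∈ qfClasses n | ∃ k : ℤ, Quot.mk qfRel (k, 0, k) = q}).ncard : ℝ)
      - 2 / 3 * (({q ∈ qfClasses n | ∃ k : ℤ, Quot.mk qfRel (k, k, k) = q}).ncard : ℝ)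
  else 0

/-- The Kronecker symbol (a/n) for a positive natural number n (and (a/0) = 1 iff a = ±1),
defined multiplicatively: the Jacobi symbol on the odd part of n, together with the factor
(a/2)^(v₂(n)), where (a/2) = 0 for even a, 1 for a ≡ ±1 (mod 8), −1 for a ≡ ±3 (mod 8). -/
def kroneckerSym (a : ℤ) (n : ℕ) : ℤ :=
  if n = 0 then (if a.natAbs = 1 then 1 else 0)
  else
    (if a % 2 = 0 then 0 else if a % 8 = 1 ∨ a % 8 = 7 then 1 else -1) ^ (n.factorization 2) *
      jacobiSym a (n / 2 ^ (n.factorization 2))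

/-- A fundamental discriminant: either d ≡ 1 (mod 4) and squarefree (this includes d = 1),
or d = 4m with m squarefree and m ≡ 2, 3 (mod 4). -/
def IsFundamentalDiscriminant (d : ℤ) : Prop :=
  (d % 4 = 1 ∧ Squarefree d) ∨
    (d % 4 = 0 ∧ Squarefree (d / 4) ∧ ((d / 4) % 4 = 2 ∨ (d / 4) % 4 = 3))

namespace ArcsinSum

open Finset

/-! ### Counting quadruples of positive integers with `ac + pq = m` -/

/-- Quadruples `(a, c, p, q)` of positive integers with `ac + pq = m`. -/
noncomputable def quads (m : ℤ) : Finset (ℤ × ℤ × ℤ × ℤ) :=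
  (Icc 1 m ×ˢ Icc 1 m ×ˢ Icc 1 m ×ˢ Icc 1 m).filter
    fun x => x.1 * x.2.1 + x.2.2.1 * x.2.2.2 = m

lemma mem_quads {m a c p q : ℤ} :
    (a, c, p, q) ∈ quads m ↔ 0 < a ∧ 0 < c ∧ 0 < p ∧ 0 < q ∧ a * c + p * q = m := by
  simp only [quads, mem_filter, mem_product, mem_Icc]
  constructor
  · rintro ⟨h, h'⟩
    exact ⟨by omega, by omega, by omega, by omega, h'⟩
  · rintro ⟨ha, hc, hp, hq, h⟩
    refine ⟨⟨⟨by omega, ?_⟩, ⟨by omega, ?_⟩, ⟨by omega, ?_⟩, ⟨by omega, ?_⟩⟩, h⟩ <;>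
      nlinarith [mul_pos ha hc, mul_pos hp hq]

open Classical in
/-- The number of quadruples satisfying `S`. -/
noncomputable def qcount (m : ℤ) (S : ℤ → ℤ → ℤ → ℤ → Prop) : ℤ :=
  ∑ x ∈ quads m, if S x.1 x.2.1 x.2.2.1 x.2.2.2 then 1 else 0

lemma qcount_bij {m : ℤ} {S S' : ℤ → ℤ → ℤ → ℤ → Prop}
    (i j : ℤ × ℤ × ℤ × ℤ → ℤ × ℤ × ℤ × ℤ)
    (hi : ∀ a c p q, (a, c, p, q) ∈ quads m → S a c p q → i (a, c, p, q) ∈ quads m ∧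
      S' (i (a, c, p, q)).1 (i (a, c, p, q)).2.1 (i (a, c, p, q)).2.2.1 (i (a, c, p, q)).2.2.2)
    (hj : ∀ a c p q, (a, c, p, q) ∈ quads m → S' a c p q → j (a, c, p, q) ∈ quads m ∧
      S (j (a, c, p, q)).1 (j (a, c, p, q)).2.1 (j (a, c, p, q)).2.2.1 (j (a, c, p, q)).2.2.2)
    (hij : ∀ x, j (i x) = x) (hji : ∀ x, i (j x) = x) :
    qcount m S = qcount m S' := by
  classical
  rw [qcount, qcount, ← sum_filter, ← sum_filter]
  refine sum_nbij' i j ?_ ?_ (fun x _ => hij x) (fun x _ => hji x) (fun _ _ => rfl)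
  · rintro ⟨a, c, p, q⟩ h
    rw [mem_filter] at h ⊢
    exact hi a c p q h.1 h.2
  · rintro ⟨a, c, p, q⟩ h
    rw [mem_filter] at h ⊢
    exact hj a c p q h.1 h.2

lemma qcount_swap_pq (m : ℤ) (S : ℤ → ℤ → ℤ → ℤ → Prop) :
    qcount m S = qcount m fun a c p q => S a c q p := by
  refine qcount_bij (fun x => (x.1, x.2.1, x.2.2.2, x.2.2.1))
    (fun x => (x.1, x.2.1, x.2.2.2, x.2.2.1)) ?_ ?_ (fun _ => rfl) (fun _ => rfl) <;>
  · intro a c p q h hS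
    simp only [mem_quads] at h ⊢
    refine ⟨⟨by omega, by omega, by omega, by omega, by linarith [mul_comm p q]⟩, hS⟩

lemma qcount_swap_ac (m : ℤ) (S : ℤ → ℤ → ℤ → ℤ → Prop) :
    qcount m S = qcount m fun a c p q => S c a p q := by
  refine qcount_bij (fun x => (x.2.1, x.1, x.2.2.1, x.2.2.2))
    (fun x => (x.2.1, x.1, x.2.2.1, x.2.2.2)) ?_ ?_ (fun _ => rfl) (fun _ => rfl) <;>
  · intro a c p q h hS
    simp only [mem_quads] at h ⊢
    refine ⟨⟨by omega, by omega, by omega, by omega, by linarith [mul_comm a c]⟩, hS⟩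

lemma qcount_swap_pairs (m : ℤ) (S : ℤ → ℤ → ℤ → ℤ → Prop) :
    qcount m S = qcount m fun a c p q => S p q a c := by
  refine qcount_bij (fun x => (x.2.2.1, x.2.2.2, x.1, x.2.1))
    (fun x => (x.2.2.1, x.2.2.2, x.1, x.2.1)) ?_ ?_ (fun _ => rfl) (fun _ => rfl) <;>
  · intro a c p q h hS
    simp only [mem_quads] at h ⊢
    refine ⟨⟨by omega, by omega, by omega, by omega, by linarith⟩, hS⟩

/-- The bijection `(a, c, p, q) ↦ (a, c + q, p - a, q)` from `{p > a}` onto `{c > q}`. -/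
lemma qcount_shift (m : ℤ) (S : ℤ → ℤ → ℤ → ℤ → Prop) :
    (qcount m fun a c p q => a < p ∧ S a c p q) =
      qcount m fun a c p q => q < c ∧ S a (c - q) (p + a) q := by
  refine qcount_bij (fun x => (x.1, x.2.1 + x.2.2.2, x.2.2.1 - x.1, x.2.2.2))
    (fun x => (x.1, x.2.1 - x.2.2.2, x.2.2.1 + x.1, x.2.2.2)) ?_ ?_
    (fun _ => by simp) (fun _ => by simp)
  · intro a c p q h hS
    simp only [mem_quads] at h ⊢
    refine ⟨⟨by omega, by omega, by omega, by omega, by linarith⟩, by omega, ?_⟩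
    simpa using hS.2
  · intro a c p q h hS
    simp only [mem_quads] at h ⊢
    refine ⟨⟨by omega, by omega, by omega, by omega, by linarith⟩, by omega, hS.2⟩

lemma qcount_congr {m : ℤ} {S S' : ℤ → ℤ → ℤ → ℤ → Prop}
    (h : ∀ a c p q, 0 < a → 0 < c → 0 < p → 0 < q → (S a c p q ↔ S' a c p q)) :
    qcount m S = qcount m S' := by
  classical
  refine sum_congr rfl ?_
  rintro ⟨a, c, p, q⟩ hx
  rw [mem_quads] at hx
  simp only [h a c p q hx.1 hx.2.1 hx.2.2.1 hx.2.2.2.1]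

lemma qcount_add {m : ℤ} {S S₁ S₂ : ℤ → ℤ → ℤ → ℤ → Prop}
    (h : ∀ a c p q, 0 < a → 0 < c → 0 < p → 0 < q →
      (S a c p q ↔ S₁ a c p q ∨ S₂ a c p q) ∧ ¬ (S₁ a c p q ∧ S₂ a c p q)) :
    qcount m S = qcount m S₁ + qcount m S₂ := by
  classical
  rw [qcount, qcount, qcount, ← sum_add_distrib]
  refine sum_congr rfl ?_
  rintro ⟨a, c, p, q⟩ hx
  rw [mem_quads] at hx
  have := h a c p q hx.1 hx.2.1 hx.2.2.1 hx.2.2.2.1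
  simp only
  by_cases h₁ : S₁ a c p q <;> by_cases h₂ : S₂ a c p q <;> simp_all

/-! ### Divisor pairs -/

/-- Pairs `(d, e)` of positive integers with `de = m`. -/
noncomputable def dpairs (m : ℤ) : Finset (ℤ × ℤ) :=
  (Icc 1 m ×ˢ Icc 1 m).filter fun x => x.1 * x.2 = m

lemma mem_dpairs {m d e : ℤ} : (d, e) ∈ dpairs m ↔ 0 < d ∧ 0 < e ∧ d * e = m := by
  simp only [dpairs, mem_filter, mem_product, mem_Icc]
  constructor
  · rintro ⟨h, h'⟩
    exact ⟨by omega, by omega, h'⟩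
  · rintro ⟨hd, he, h⟩
    refine ⟨⟨⟨by omega, ?_⟩, ⟨by omega, ?_⟩⟩, h⟩ <;> nlinarith

lemma sum_dpairs_swap (m : ℤ) (g : ℤ → ℤ → ℤ) :
    ∑ x ∈ dpairs m, g x.1 x.2 = ∑ x ∈ dpairs m, g x.2 x.1 := by
  refine sum_nbij' (fun x => (x.2, x.1)) (fun x => (x.2, x.1)) ?_ ?_ (fun _ _ => rfl)
    (fun _ _ => rfl) (fun _ _ => rfl) <;>
  · rintro ⟨d, e⟩ h
    rw [mem_dpairs] at h ⊢
    exact ⟨h.2.1, h.1, by linarith [mul_comm d e]⟩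

/-- Quadruples with `a = p` correspond to divisor pairs `(a, c + q)` with a choice of `c`. -/
lemma qcount_diag (m : ℤ) (S : ℤ → ℤ → ℤ → ℤ → Prop) (g : ℤ → ℤ → ℤ)
    (hg : ∀ d e, 0 < d → 0 < e → 0 ≤ g d e)
    (hS : ∀ d e c, 0 < d → 0 < e → (0 < c ∧ c < e ∧ S d c d (e - c) ↔ 0 < c ∧ c ≤ g d e)) :
    (qcount m fun a c p q => a = p ∧ S a c p q) = ∑ x ∈ dpairs m, g x.1 x.2 := by
  classical
  have h1 : ∀ x ∈ dpairs m, g x.1 x.2 = ∑ c ∈ Icc 1 (g x.1 x.2), 1 := by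
    rintro ⟨d, e⟩ h
    rw [mem_dpairs] at h
    have := hg d e h.1 h.2.1
    simp only [sum_const, Int.card_Icc]
    simp [this]
  rw [sum_congr rfl h1, sum_sigma', qcount]
  refine (@sum_filter _ _ _ _ _ (fun _ => Classical.propDecidable _) _).symm.trans ?_
  refine sum_bij' (fun x _ => ⟨(x.1, x.2.1 + x.2.2.2), x.2.1⟩)
    (fun y _ => (y.1.1, y.2, y.1.1, y.1.2 - y.2)) ?_ ?_ ?_ ?_ (fun _ _ => rfl)
  · rintro ⟨a, c, p, q⟩ h
    simp only [mem_filter, mem_quads] at h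
    obtain ⟨⟨ha, hc, hp, hq, h⟩, rfl, hs⟩ := h
    simp only [mem_sigma, mem_dpairs, mem_Icc]
    refine ⟨⟨ha, by omega, by linarith⟩, ?_⟩
    have := (hS a (c + q) c ha (by omega)).1 ⟨hc, by omega, by simpa using hs⟩
    omega
  · rintro ⟨⟨d, e⟩, c⟩ h
    simp only [mem_sigma, mem_dpairs, mem_Icc] at h
    obtain ⟨⟨hd, he, h⟩, hc⟩ := h
    have := (hS d e c hd he).2 ⟨by omega, hc.2⟩
    simp only [mem_filter, mem_quads]
    exact ⟨⟨hd, by omega, hd, by omega, by linarith⟩, trivial, this.2.2⟩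
  · rintro ⟨a, c, p, q⟩ h
    simp only [mem_filter, mem_quads] at h
    obtain ⟨-, rfl, -⟩ := h
    simp
  · rintro ⟨⟨d, e⟩, c⟩ h
    simp

end ArcsinSum

namespace ArcsinSum

open Finset

lemma qcount_diag_all (m : ℤ) :
    (qcount m fun a _ p _ => a = p) = ∑ x ∈ dpairs m, (x.2 - 1) := by
  rw [← qcount_diag m (fun _ _ _ _ => True) (fun _ e => e - 1) (fun _ _ _ _ => by omega)
    (fun _ _ _ _ _ => by simp only [and_true]; omega)]
  exact qcount_congr fun _ _ _ _ _ _ _ _ => by simp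

lemma qcount_diag_le (m : ℤ) :
    (qcount m fun a c p _ => a = p ∧ c ≤ a) = ∑ x ∈ dpairs m, min x.1 (x.2 - 1) :=
  qcount_diag m (fun a c _ _ => c ≤ a) (fun d e => min d (e - 1)) (fun _ _ _ _ => by omega)
    (fun _ _ _ _ _ => by omega)

lemma qcount_diag_lt (m : ℤ) :
    (qcount m fun a c p _ => a = p ∧ c < a) = ∑ x ∈ dpairs m, (min x.1 x.2 - 1) :=
  qcount_diag m (fun a c _ _ => c < a) (fun d e => min d e - 1) (fun _ _ _ _ => by omega)
    (fun _ _ _ _ _ => by omega)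

lemma qcount_diag_add_le (m : ℤ) :
    (qcount m fun a _ p q => a = p ∧ a ≤ q) = ∑ x ∈ dpairs m, (x.2 - min x.1 x.2) :=
  qcount_diag m (fun a _ _ q => a ≤ q) (fun d e => e - min d e) (fun _ _ _ _ => by omega)
    (fun _ _ _ _ _ => by omega)

/-- Divisor sums entering the class number relation. -/
lemma dpairs_relations (m : ℤ) :
    (∑ x ∈ dpairs m, (x.2 - 1) = ∑ x ∈ dpairs m, x.2 - (dpairs m).card) ∧
    (2 * ∑ x ∈ dpairs m, min x.1 (x.2 - 1) = 2 * ∑ x ∈ dpairs m, min x.1 x.2 -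
      (dpairs m).card - ∑ x ∈ dpairs m, (if x.1 = x.2 then 1 else 0)) ∧
    (∑ x ∈ dpairs m, (min x.1 x.2 - 1) = ∑ x ∈ dpairs m, min x.1 x.2 - (dpairs m).card) ∧
    (∑ x ∈ dpairs m, (x.2 - min x.1 x.2) = ∑ x ∈ dpairs m, x.2 - ∑ x ∈ dpairs m, min x.1 x.2) := by
  have hlt : 2 * ∑ x ∈ dpairs m, (if x.1 < x.2 then (1 : ℤ) else 0) = (dpairs m).card -
      ∑ x ∈ dpairs m, (if x.1 = x.2 then 1 else 0) := by
    have h := sum_dpairs_swap m (fun d e => if d < e then 1 else 0)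
    rw [two_mul]
    nth_rewrite 2 [h]
    rw [card_eq_sum_ones, Nat.cast_sum, ← sum_add_distrib, ← sum_sub_distrib]
    refine sum_congr rfl fun x _ => ?_
    push_cast
    split_ifs <;> omega
  have hmin : ∑ x ∈ dpairs m, min x.1 (x.2 - 1) = ∑ x ∈ dpairs m, min x.1 x.2 -
      (dpairs m).card + ∑ x ∈ dpairs m, (if x.1 < x.2 then (1 : ℤ) else 0) := by
    rw [card_eq_sum_ones, Nat.cast_sum, ← sum_sub_distrib, ← sum_add_distrib]
    refine sum_congr rfl fun x _ => ?_
    push_cast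
    split_ifs <;> omega
  refine ⟨?_, by linarith, ?_, ?_⟩
  · simp [sum_sub_distrib]
  · simp [sum_sub_distrib]
  · simp [sum_sub_distrib]

/-- The counting identity behind the Kronecker-Hurwitz class number relation. -/
lemma qcount_relation (m : ℤ) :
    4 * ∑ x ∈ dpairs m, min x.1 x.2 + 4 * (qcount m fun a c p _ => a ≤ p ∧ c ≤ p ∧ p < a + c) +
      4 * (qcount m fun a c p q => a < p ∧ c < p ∧ p < a + c + q) +
      6 * (qcount m fun a _ p _ => a = p) + 2 * (qcount m fun a c p _ => p = a + c) =
    12 * ∑ x ∈ dpairs m, x.2 - 6 * ∑ x ∈ dpairs m, min x.1 x.2 - 3 * (dpairs m).card +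
      ∑ x ∈ dpairs m, (if x.1 = x.2 then 1 else 0) := by
  obtain ⟨r1, r2, r3, r4⟩ := dpairs_relations m
  rw [← qcount_diag_all] at r1
  rw [← qcount_diag_le] at r2
  rw [← qcount_diag_lt] at r3
  rw [← qcount_diag_add_le] at r4
  -- the evaluation of `#{c > p, c ≥ q} - #{c ≥ p > a}`
  have e1' : (qcount m fun a c p q => c < p ∧ q ≤ c) = qcount m fun a c p q => q < a ∧ q ≤ c := by
    rw [qcount_swap_ac]
    rw [qcount_swap_ac m fun a c p q => q < a ∧ q ≤ c]
    rw [qcount_shift m (fun a c p q => q ≤ a)]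
  have e2 := qcount_add (m := m) (S := fun _ c _ q => q ≤ c)
    (S₁ := fun a c p q => c < p ∧ q ≤ c) (S₂ := fun a c p q => p ≤ c ∧ q ≤ c)
    (fun a c p q _ _ _ _ => by constructor <;> omega)
  have e3 := qcount_add (m := m) (S := fun _ c p q => p ≤ c ∧ q ≤ c)
    (S₁ := fun a c p q => p < c ∧ q ≤ c) (S₂ := fun a c p q => p = c ∧ q ≤ c)
    (fun a c p q _ _ _ _ => by constructor <;> omega)
  have e4 := qcount_add (m := m) (S := fun _ c _ q => q ≤ c)
    (S₁ := fun a c p q => q < a ∧ q ≤ c) (S₂ := fun a c p q => a ≤ q ∧ q ≤ c)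
    (fun a c p q _ _ _ _ => by constructor <;> omega)
  have e5 := qcount_add (m := m) (S := fun a c p q => a ≤ q ∧ q ≤ c)
    (S₁ := fun a c p q => a < q ∧ q ≤ c) (S₂ := fun a c p q => a = q ∧ q ≤ c)
    (fun a c p q _ _ _ _ => by constructor <;> omega)
  have s1 : (qcount m fun a c p q => p = c ∧ q ≤ c) = qcount m fun a c p _ => a = p ∧ c ≤ a := by
    rw [qcount_swap_pairs m fun a c p _ => a = p ∧ c ≤ a]
    rw [qcount_swap_ac]
    exact qcount_congr fun a c p q _ _ _ _ => by omega
  have s2 : (qcount m fun a c p q => a = q ∧ q ≤ c) = qcount m fun a c p q => a = p ∧ a ≤ q := by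
    rw [qcount_swap_pairs, qcount_swap_ac]
    exact qcount_congr fun a c p q _ _ _ _ => by omega
  -- `#{c ≥ p + q + a} = #{c ≥ p > a}`
  have e6 : (qcount m fun a c p q => a + p + q ≤ c) = qcount m fun a c p q => a < q ∧ q ≤ c := by
    rw [qcount_swap_pq m fun a c p q => a < q ∧ q ≤ c]
    rw [qcount_shift m (fun a c p q => p ≤ c)]
    exact qcount_congr fun a c p q _ _ _ _ => by omega
  have e7 := qcount_add (m := m) (S := fun _ c p q => p < c ∧ q ≤ c)
    (S₁ := fun a c p q => p < c ∧ q < c) (S₂ := fun a c p q => p < c ∧ q = c)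
    (fun a c p q _ _ _ _ => by constructor <;> omega)
  have s3 : (qcount m fun a c p q => p < c ∧ q = c) = qcount m fun a c p _ => a = p ∧ c < a := by
    rw [qcount_swap_pairs, qcount_swap_ac, qcount_swap_pq]
    exact qcount_congr fun a c p q _ _ _ _ => by omega
  have e8 := qcount_add (m := m) (S := fun a c p q => p < c ∧ q < c)
    (S₁ := fun a c p q => p < c ∧ q < c ∧ c < a + p + q) (S₂ := fun a c p q => a + p + q ≤ c)
    (fun a c p q _ _ _ _ => by constructor <;> omega)
  have s4 : (qcount m fun a c p q => p < c ∧ q < c ∧ c < a + p + q) =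
      qcount m fun a c p q => a < p ∧ c < p ∧ p < a + c + q := by
    rw [qcount_swap_pairs, qcount_swap_pq]
    exact qcount_congr fun a c p q _ _ _ _ => by omega
  have s5 : (qcount m fun a c p q => p < c ∧ q < c) = qcount m fun a c p q => a < p ∧ c < p := by
    rw [qcount_swap_pairs, qcount_swap_pq]
  have e9 := qcount_add (m := m) (S := fun a c p q => a < q)
    (S₁ := fun a c p q => a < q ∧ c < q) (S₂ := fun a c p q => a < q ∧ q ≤ c)
    (fun a c p q _ _ _ _ => by constructor <;> omega)
  have s6 := qcount_swap_pq m fun a c p q => a < q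
  have s7 := qcount_swap_pq m fun a c p q => a < q ∧ c < q
  have e10 := qcount_add (m := m) (S := fun a c p q => a ≤ p ∧ c ≤ p)
    (S₁ := fun a c p q => a ≤ p ∧ c ≤ p ∧ p < a + c) (S₂ := fun a c p q => a + c ≤ p)
    (fun a c p q _ _ _ _ => by constructor <;> omega)
  have e11 := qcount_add (m := m) (S := fun a c p q => a ≤ p ∧ c ≤ p)
    (S₁ := fun a c p q => a < p ∧ c ≤ p) (S₂ := fun a c p q => a = p ∧ c ≤ a)
    (fun a c p q _ _ _ _ => by constructor <;> omega)
  have e12 := qcount_add (m := m) (S := fun a c p q => a < p ∧ c ≤ p)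
    (S₁ := fun a c p q => a < p ∧ c < p) (S₂ := fun a c p q => c = p ∧ a < c)
    (fun a c p q _ _ _ _ => by constructor <;> omega)
  have s8 := qcount_swap_ac m fun a c p q => c = p ∧ a < c
  have e13 := qcount_add (m := m) (S := fun a c p q => a < p)
    (S₁ := fun a c p q => a < p ∧ p < a + c) (S₂ := fun a c p q => a + c ≤ p)
    (fun a c p q _ _ _ _ => by constructor <;> omega)
  have e14 := qcount_add (m := m) (S := fun a c p q => a + c ≤ p)
    (S₁ := fun a c p q => a + c < p) (S₂ := fun a c p q => p = a + c)
    (fun a c p q _ _ _ _ => by constructor <;> omega)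
  have s9 : (qcount m fun a c p q => a < p ∧ p < a + c) = qcount m fun a c p q => a + c < p := by
    rw [qcount_shift m fun a c p q => p < a + c, qcount_swap_pairs, qcount_swap_pq]
    exact qcount_congr fun a c p q _ _ _ _ => by omega
  linarith

end ArcsinSum

namespace ArcsinSum

open Finset

/-! ### Solutions `(X, Y, Z, w)` of `(X + Y + w) (Z + w) + X Y = m` -/

/-- Solutions of `XY + YZ + ZX + w (X + Y + Z) + w² = m` with `w > 0`, `X, Y, Z > -w` and
positive pairwise sums `X + Y + w`, `Y + Z + w`, `X + Z + w`. -/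
noncomputable def trips (m : ℤ) : Finset (ℤ × ℤ × ℤ × ℤ) :=
  (Icc (-m) m ×ˢ Icc (-m) m ×ˢ Icc (-m) m ×ˢ Icc 1 (2 * m)).filter
    fun x => -x.2.2.2 < x.1 ∧ -x.2.2.2 < x.2.1 ∧ -x.2.2.2 < x.2.2.1 ∧
      0 < x.1 + x.2.1 + x.2.2.2 ∧ 0 < x.2.1 + x.2.2.1 + x.2.2.2 ∧ 0 < x.1 + x.2.2.1 + x.2.2.2 ∧
      (x.1 + x.2.1 + x.2.2.2) * (x.2.2.1 + x.2.2.2) + x.1 * x.2.1 = m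

lemma trips_bound {m X Y Z w : ℤ} (hX : -w < X) (h₂ : 0 < X + Y + w)
    (h₃ : 0 < X + Z + w) (h : (X + Y + w) * (Z + w) + X * Y = m) (hX0 : X < 0) :
    (-m ≤ X ∧ X ≤ m) ∧ (-m ≤ Y ∧ Y ≤ m) ∧ (-m ≤ Z ∧ Z ≤ m) ∧ 1 ≤ w ∧ w ≤ 2 * m := by
  have hq : (X + Z + w, X + Y + w, X + w, -X) ∈ quads m :=
    mem_quads.2 ⟨by omega, by omega, by omega, by omega, by rw [← h]; ring⟩
  simp only [quads, mem_filter, mem_product, mem_Icc] at hq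
  omega

lemma mem_trips {m X Y Z w : ℤ} :
    (X, Y, Z, w) ∈ trips m ↔ 0 < w ∧ -w < X ∧ -w < Y ∧ -w < Z ∧ 0 < X + Y + w ∧ 0 < Y + Z + w ∧
      0 < X + Z + w ∧ (X + Y + w) * (Z + w) + X * Y = m := by
  simp only [trips, mem_filter, mem_product, mem_Icc]
  constructor
  · rintro ⟨h, h'⟩
    exact ⟨by omega, h'⟩
  · rintro ⟨hw, h⟩
    refine ⟨?_, h⟩
    obtain ⟨h₁, h₂, h₃, h₄, h₅, h₆, h⟩ := h
    rcases lt_or_ge X 0 with hX | hX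
    · have := trips_bound h₁ h₄ h₆ h hX
      omega
    rcases lt_or_ge Y 0 with hY | hY
    · have := trips_bound (m := m) h₂ (by omega : 0 < Y + X + w) h₅ (by rw [← h]; ring) hY
      omega
    rcases lt_or_ge Z 0 with hZ | hZ
    · have := trips_bound (m := m) h₃ (by omega : 0 < Z + Y + w) (by omega : 0 < Z + X + w)
        (by rw [← h]; ring) hZ
      omega
    have e : X * Y + Y * Z + Z * X + w * X + w * Y + w * Z + w * w = m := by rw [← h]; ring
    have := mul_nonneg hX hY
    have := mul_nonneg hY hZ
    have := mul_nonneg hZ hX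
    refine ⟨⟨by nlinarith, by nlinarith⟩, ⟨by nlinarith, by nlinarith⟩,
      ⟨by nlinarith, by nlinarith⟩, by omega, by nlinarith⟩

open Classical in
/-- The number of elements of `trips m` satisfying `S`. -/
noncomputable def tcount (m : ℤ) (S : ℤ → ℤ → ℤ → ℤ → Prop) : ℤ :=
  ∑ x ∈ trips m, if S x.1 x.2.1 x.2.2.1 x.2.2.2 then 1 else 0

lemma tcount_congr {m : ℤ} {S S' : ℤ → ℤ → ℤ → ℤ → Prop}
    (h : ∀ X Y Z w, (X, Y, Z, w) ∈ trips m → (S X Y Z w ↔ S' X Y Z w)) :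
    tcount m S = tcount m S' := by
  classical
  refine sum_congr rfl ?_
  rintro ⟨X, Y, Z, w⟩ hx
  simp only [h X Y Z w hx]

lemma tcount_swap_xy (m : ℤ) (S : ℤ → ℤ → ℤ → ℤ → Prop) :
    tcount m S = tcount m fun X Y Z w => S Y X Z w := by
  refine sum_nbij' (fun x => (x.2.1, x.1, x.2.2.1, x.2.2.2))
    (fun x => (x.2.1, x.1, x.2.2.1, x.2.2.2)) ?_ ?_ (fun _ _ => rfl) (fun _ _ => rfl)
    (fun _ _ => rfl) <;>
  · rintro ⟨X, Y, Z, w⟩ h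
    simp only [mem_trips] at h ⊢
    refine ⟨by omega, by omega, by omega, by omega, by omega, by omega, by omega, ?_⟩
    rw [← h.2.2.2.2.2.2.2]; ring

lemma tcount_swap_xz (m : ℤ) (S : ℤ → ℤ → ℤ → ℤ → Prop) :
    tcount m S = tcount m fun X Y Z w => S Z Y X w := by
  refine sum_nbij' (fun x => (x.2.2.1, x.2.1, x.1, x.2.2.2))
    (fun x => (x.2.2.1, x.2.1, x.1, x.2.2.2)) ?_ ?_ (fun _ _ => rfl) (fun _ _ => rfl)
    (fun _ _ => rfl) <;>
  · rintro ⟨X, Y, Z, w⟩ h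
    simp only [mem_trips] at h ⊢
    refine ⟨by omega, by omega, by omega, by omega, by omega, by omega, by omega, ?_⟩
    rw [← h.2.2.2.2.2.2.2]; ring

lemma tcount_add {m : ℤ} (S R : ℤ → ℤ → ℤ → ℤ → Prop) :
    tcount m S = (tcount m fun X Y Z w => S X Y Z w ∧ R X Y Z w) +
      tcount m fun X Y Z w => S X Y Z w ∧ ¬ R X Y Z w := by
  classical
  rw [tcount, tcount, tcount, ← sum_add_distrib]
  refine sum_congr rfl fun x _ => ?_
  by_cases h₁ : S x.1 x.2.1 x.2.2.1 x.2.2.2 <;> by_cases h₂ : R x.1 x.2.1 x.2.2.1 x.2.2.2 <;>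
    simp [h₁, h₂]

/-- Solutions with `X < 0` correspond to quadruples. -/
lemma tcount_neg (m : ℤ) (S : ℤ → ℤ → ℤ → ℤ → Prop) :
    (tcount m fun X Y Z w => X < 0 ∧ S X Y Z w) =
      qcount m fun a c p q => p < a + c + q ∧ S (-q) (c - p) (a - p) (p + q) := by
  classical
  rw [tcount, qcount]
  refine (@sum_filter _ _ _ _ _ (fun _ => Classical.propDecidable _) _).symm.trans
    (Eq.trans ?_ (@sum_filter _ _ _ _ _ (fun _ => Classical.propDecidable _) _))
  refine sum_nbij' (fun x => (x.1 + x.2.2.1 + x.2.2.2, x.1 + x.2.1 + x.2.2.2, x.1 + x.2.2.2, -x.1))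
    (fun x => (-x.2.2.2, x.2.1 - x.2.2.1, x.1 - x.2.2.1, x.2.2.1 + x.2.2.2)) ?_ ?_ ?_ ?_
    (fun _ _ => rfl)
  · rintro ⟨X, Y, Z, w⟩ h
    simp only [mem_filter, mem_trips, mem_quads] at h ⊢
    obtain ⟨⟨h₁, h₂, h₃, h₄, h₅, h₆, h₇, h⟩, hX, hS⟩ := h
    refine ⟨⟨by omega, by omega, by omega, by omega, by rw [← h]; ring⟩, by omega, ?_⟩
    convert hS using 1 <;> ring
  · rintro ⟨a, c, p, q⟩ h
    simp only [mem_filter, mem_trips, mem_quads] at h ⊢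
    obtain ⟨⟨h₁, h₂, h₃, h₄, h⟩, hX, hS⟩ := h
    refine ⟨⟨by omega, by omega, by omega, by omega, by omega, by omega, by omega,
      by rw [← h]; ring⟩, by omega, hS⟩
  · rintro ⟨X, Y, Z, w⟩ _
    simp only [Prod.mk.injEq]
    refine ⟨by ring, by ring, by ring, by ring⟩
  · rintro ⟨X, Y, Z, w⟩ _
    simp only [Prod.mk.injEq]
    refine ⟨by ring, by ring, by ring, by ring⟩

lemma tcount_nonneg_pos (m : ℤ) :
    (tcount m fun X Y Z _ => (0 ≤ X ∧ 0 ≤ Y ∧ 0 ≤ Z) ∧ 0 < Z) =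
      qcount m fun a c p _ => a ≤ p ∧ c ≤ p ∧ p < a + c := by
  classical
  rw [tcount, qcount]
  refine (@sum_filter _ _ _ _ _ (fun _ => Classical.propDecidable _) _).symm.trans
    (Eq.trans ?_ (@sum_filter _ _ _ _ _ (fun _ => Classical.propDecidable _) _))
  refine sum_nbij' (fun x => (x.1 + x.2.2.2, x.2.1 + x.2.2.2, x.1 + x.2.1 + x.2.2.2, x.2.2.1))
    (fun x => (x.2.2.1 - x.2.1, x.2.2.1 - x.1, x.2.2.2, x.1 + x.2.1 - x.2.2.1)) ?_ ?_ ?_ ?_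
    (fun _ _ => rfl)
  · rintro ⟨X, Y, Z, w⟩ h
    simp only [mem_filter, mem_trips, mem_quads] at h ⊢
    obtain ⟨⟨h₁, h₂, h₃, h₄, h₅, h₆, h₇, h⟩, hX, hS⟩ := h
    refine ⟨⟨by omega, by omega, by omega, by omega, by rw [← h]; ring⟩, by omega, by omega,
      by omega⟩
  · rintro ⟨a, c, p, q⟩ h
    simp only [mem_filter, mem_trips, mem_quads] at h ⊢
    obtain ⟨⟨h₁, h₂, h₃, h₄, h⟩, hX, hS⟩ := h
    refine ⟨⟨by omega, by omega, by omega, by omega, by omega, by omega, by omega,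
      by rw [← h]; ring⟩, by omega, by omega⟩
  · rintro ⟨X, Y, Z, w⟩ _
    simp only [Prod.mk.injEq]
    refine ⟨by ring, by ring, trivial, by ring⟩
  · rintro ⟨X, Y, Z, w⟩ _
    simp only [Prod.mk.injEq]
    refine ⟨by ring, by ring, by ring, trivial⟩

lemma tcount_nonneg_zero (m : ℤ) :
    (tcount m fun X Y Z _ => (0 ≤ X ∧ 0 ≤ Y ∧ 0 ≤ Z) ∧ ¬ 0 < Z) =
      ∑ x ∈ dpairs m, min x.1 x.2 := by
  classical
  have h1 : ∀ x ∈ dpairs m, min x.1 x.2 = ∑ c ∈ Icc 1 (min x.1 x.2), 1 := by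
    rintro ⟨d, e⟩ h
    rw [mem_dpairs] at h
    simp only [sum_const, Int.card_Icc]
    simp; omega
  rw [sum_congr rfl h1, sum_sigma', tcount]
  refine (@sum_filter _ _ _ _ _ (fun _ => Classical.propDecidable _) _).symm.trans ?_
  refine sum_bij' (fun x _ => ⟨(x.1 + x.2.2.2, x.2.1 + x.2.2.2), x.2.2.2⟩)
    (fun y _ => (y.1.1 - y.2, y.1.2 - y.2, 0, y.2)) ?_ ?_ ?_ ?_ (fun _ _ => rfl)
  · rintro ⟨X, Y, Z, w⟩ h
    simp only [mem_filter, mem_trips] at h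
    obtain ⟨⟨h₁, h₂, h₃, h₄, h₅, h₆, h₇, h⟩, hX, hS⟩ := h
    obtain rfl : Z = 0 := by omega
    simp only [mem_sigma, mem_dpairs, mem_Icc]
    refine ⟨⟨by omega, by omega, by rw [← h]; ring⟩, by omega⟩
  · rintro ⟨⟨d, e⟩, c⟩ h
    simp only [mem_sigma, mem_dpairs, mem_Icc] at h
    obtain ⟨⟨hd, he, h⟩, hc⟩ := h
    simp only [mem_filter, mem_trips]
    refine ⟨⟨by omega, by omega, by omega, by omega, by omega, by omega, by omega,
      by rw [← h]; ring⟩, by omega, by omega⟩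
  · rintro ⟨X, Y, Z, w⟩ h
    simp only [mem_filter, mem_trips] at h
    simp only [Prod.mk.injEq]
    refine ⟨by ring, by ring, by omega, trivial⟩
  · rintro ⟨⟨d, e⟩, c⟩ h
    simp

/-- Twice the weight of a triple `(r, s, t)`: `2`, or `1` if one entry vanishes, or `0` if one is
negative. -/
def triWeight (r s t : ℤ) : ℤ :=
  if 0 < r ∧ 0 < s ∧ 0 < t then 2 else if 0 ≤ r ∧ 0 ≤ s ∧ 0 ≤ t then 1 else 0

/-- The weighted count of solutions with `2X + w, 2Y + w, 2Z + w ≥ 0`. -/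
lemma sum_trips_weight (m : ℤ) :
    ∑ x ∈ trips m, triWeight (2 * x.1 + x.2.2.2) (2 * x.2.1 + x.2.2.2) (2 * x.2.2.1 + x.2.2.2) =
      2 * (∑ x ∈ dpairs m, min x.1 x.2 + qcount m fun a c p _ => a ≤ p ∧ c ≤ p ∧ p < a + c) +
      2 * (qcount m fun a c p q => a < p ∧ c < p ∧ p < a + c + q) +
      3 * qcount m fun a _ p _ => a = p := by
  have key : ∑ x ∈ trips m,
      triWeight (2 * x.1 + x.2.2.2) (2 * x.2.1 + x.2.2.2) (2 * x.2.2.1 + x.2.2.2) =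
      2 * (tcount m fun _ _ _ _ => True) -
      2 * ((tcount m fun X _ _ w => 2 * X + w < 0) + (tcount m fun _ Y _ w => 2 * Y + w < 0) +
        (tcount m fun _ _ Z w => 2 * Z + w < 0)) -
      ((tcount m fun X _ _ w => 2 * X + w = 0) + (tcount m fun _ Y _ w => 2 * Y + w = 0) +
        (tcount m fun _ _ Z w => 2 * Z + w = 0)) := by
    simp only [tcount, mul_sum, ← sum_add_distrib, ← sum_sub_distrib]
    refine sum_congr rfl ?_
    rintro ⟨X, Y, Z, w⟩ h
    rw [mem_trips] at h
    simp only [triWeight]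
    rcases lt_trichotomy (2 * X + w) 0 with hx | hx | hx <;>
    rcases lt_trichotomy (2 * Y + w) 0 with hy | hy | hy <;>
    rcases lt_trichotomy (2 * Z + w) 0 with hz | hz | hz <;>
    first
    | omega
    | (simp [*, not_lt.2 hx.le, not_lt.2 hy.le, not_lt.2 hz.le, hx.ne', hy.ne', hz.ne'] <;> omega)
    | (split_ifs <;> omega)
  rw [key, ← tcount_swap_xy m fun X _ _ w => 2 * X + w < 0,
    ← tcount_swap_xz m fun X _ _ w => 2 * X + w < 0,
    ← tcount_swap_xy m fun X _ _ w => 2 * X + w = 0,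
    ← tcount_swap_xz m fun X _ _ w => 2 * X + w = 0]
  have e1 : (tcount m fun X _ _ w => 2 * X + w < 0) = qcount m fun a c p q => p < q := by
    have := tcount_neg m fun X _ _ w => 2 * X + w < 0
    rw [tcount_congr (S' := fun X _ _ w => 2 * X + w < 0), qcount_congr] at this
    · exact this
    · intros; omega
    · intro X Y Z w h; rw [mem_trips] at h; omega
  have e2 : (tcount m fun X _ _ w => 2 * X + w = 0) = qcount m fun a c p q => p = q := by
    have := tcount_neg m fun X _ _ w => 2 * X + w = 0
    rw [tcount_congr (S' := fun X _ _ w => 2 * X + w = 0), qcount_congr] at this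
    · exact this
    · intros; omega
    · intro X Y Z w h; rw [mem_trips] at h; omega
  have t1 := tcount_add (m := m) (fun _ _ _ _ => True) (fun X Y Z _ => 0 ≤ X ∧ 0 ≤ Y ∧ 0 ≤ Z)
  have t2 := tcount_add (m := m) (fun X Y Z _ => 0 ≤ X ∧ 0 ≤ Y ∧ 0 ≤ Z) (fun _ _ Z _ => 0 < Z)
  rw [tcount_nonneg_pos, tcount_nonneg_zero] at t2
  have t3 := tcount_add (m := m) (fun X Y Z _ => True ∧ ¬ (0 ≤ X ∧ 0 ≤ Y ∧ 0 ≤ Z))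
    (fun X _ _ _ => X < 0)
  have t4 := tcount_add (m := m)
    (fun X Y Z _ => (True ∧ ¬ (0 ≤ X ∧ 0 ≤ Y ∧ 0 ≤ Z)) ∧ ¬ X < 0) (fun _ Y _ _ => Y < 0)
  have t0 : (tcount m fun X Y Z _ => True ∧ (0 ≤ X ∧ 0 ≤ Y ∧ 0 ≤ Z)) =
      tcount m fun X Y Z _ => 0 ≤ X ∧ 0 ≤ Y ∧ 0 ≤ Z := tcount_congr fun _ _ _ _ _ => by simp
  have t5 : (tcount m fun X Y Z _ => (True ∧ ¬ (0 ≤ X ∧ 0 ≤ Y ∧ 0 ≤ Z)) ∧ X < 0) =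
      qcount m fun a c p q => p < a + c + q := by
    rw [tcount_congr (S' := fun X _ _ _ => X < 0 ∧ True)
        fun _ _ _ _ _ => by simp only [true_and, and_true]; omega,
      tcount_neg m fun _ _ _ _ => True]
    exact qcount_congr fun _ _ _ _ _ _ _ _ => by simp only [and_true]
  have t6 : (tcount m fun X Y Z _ => ((True ∧ ¬ (0 ≤ X ∧ 0 ≤ Y ∧ 0 ≤ Z)) ∧ ¬ X < 0) ∧ Y < 0) =
      qcount m fun a c p q => p ≤ c := by
    rw [tcount_congr (S' := fun X Y _ _ => Y < 0 ∧ 0 ≤ X)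
        fun _ _ _ _ _ => by simp only [true_and]; omega,
      tcount_swap_xy, tcount_neg m fun _ Y _ _ => 0 ≤ Y]
    exact qcount_congr fun _ _ _ _ _ _ _ _ => by omega
  have t7 : (tcount m fun X Y Z _ => ((True ∧ ¬ (0 ≤ X ∧ 0 ≤ Y ∧ 0 ≤ Z)) ∧ ¬ X < 0) ∧ ¬ Y < 0) =
      qcount m fun a c p q => p ≤ c ∧ p ≤ a := by
    rw [tcount_congr (S' := fun X Y Z _ => Z < 0 ∧ 0 ≤ Y ∧ 0 ≤ X)
        fun _ _ _ _ _ => by simp only [true_and]; omega,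
      tcount_swap_xz, tcount_neg m fun _ Y Z _ => 0 ≤ Y ∧ 0 ≤ Z]
    exact qcount_congr fun _ _ _ _ _ _ _ _ => by omega
  have q1 := qcount_add (m := m) (S := fun a c p q => p < a + c + q)
    (S₁ := fun a c p q => p ≤ c) (S₂ := fun a c p q => c < p ∧ p < a + c + q)
    (fun a c p q _ _ _ _ => by constructor <;> omega)
  have q2 := qcount_add (m := m) (S := fun a c p q => c < p ∧ p < a + c + q)
    (S₁ := fun a c p q => a < p ∧ c < p ∧ p < a + c + q) (S₂ := fun a c p q => c < p ∧ p ≤ a)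
    (fun a c p q _ _ _ _ => by constructor <;> omega)
  have q3 := qcount_add (m := m) (S := fun a c p q => p ≤ a)
    (S₁ := fun a c p q => p ≤ c ∧ p ≤ a) (S₂ := fun a c p q => c < p ∧ p ≤ a)
    (fun a c p q _ _ _ _ => by constructor <;> omega)
  have q4 := qcount_add (m := m) (S := fun a c p q => p ≤ a)
    (S₁ := fun a c p q => p < a) (S₂ := fun a c p q => a = p)
    (fun a c p q _ _ _ _ => by constructor <;> omega)
  have q5 := qcount_add (m := m) (S := fun a c p q => True)
    (S₁ := fun a c p q => p ≤ a) (S₂ := fun a c p q => a < p)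
    (fun a c p q _ _ _ _ => by simp only [true_iff]; constructor <;> omega)
  have q6 := qcount_add (m := m) (S := fun a c p q => True)
    (S₁ := fun a c p q => p ≤ q) (S₂ := fun a c p q => q < p)
    (fun a c p q _ _ _ _ => by simp only [true_iff]; constructor <;> omega)
  have q7 := qcount_add (m := m) (S := fun a c p q => p ≤ q)
    (S₁ := fun a c p q => p < q) (S₂ := fun a c p q => p = q)
    (fun a c p q _ _ _ _ => by constructor <;> omega)
  have s1 := qcount_swap_ac m fun a c p q => p ≤ a
  have s2 := qcount_swap_pairs m fun a c p q => p < a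
  have s3 := qcount_swap_pq m fun a c p q => p < q
  linarith

end ArcsinSum

namespace ArcsinSum

open Finset

/-- Triples `r, s, t ≥ 0` of the same parity with `rs + st + tr = N`. -/
noncomputable def tri (N : ℤ) : Finset (ℤ × ℤ × ℤ) :=
  (Icc 0 N ×ˢ Icc 0 N ×ˢ Icc 0 N).filter fun x => x.1 % 2 = x.2.1 % 2 ∧ x.1 % 2 = x.2.2 % 2 ∧
    x.1 * x.2.1 + x.2.1 * x.2.2 + x.2.2 * x.1 = N

lemma tri_entry_le {N r s t : ℤ} (hN : 0 < N) (hr : 0 ≤ r) (hs : 0 ≤ s) (ht : 0 ≤ t)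
    (h : r * s + s * t + t * r = N) : r ≤ N := by
  rcases hs.eq_or_lt with rfl | hs'
  · rcases ht.eq_or_lt with rfl | ht'
    · simp at h; omega
    · nlinarith
  · nlinarith [mul_nonneg hs ht, mul_nonneg ht hr]

lemma mem_tri {N r s t : ℤ} (hN : 0 < N) : (r, s, t) ∈ tri N ↔ 0 ≤ r ∧ 0 ≤ s ∧ 0 ≤ t ∧
    r % 2 = s % 2 ∧ r % 2 = t % 2 ∧ r * s + s * t + t * r = N := by
  simp only [tri, mem_filter, mem_product, mem_Icc]
  constructor
  · rintro ⟨h, h'⟩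
    exact ⟨by omega, by omega, by omega, h'⟩
  · rintro ⟨hr, hs, ht, h⟩
    have e := h.2.2
    exact ⟨⟨⟨hr, tri_entry_le hN hr hs ht e⟩,
      ⟨hs, tri_entry_le hN hs ht hr (by rw [← e]; ring)⟩,
      ⟨ht, tri_entry_le hN ht hr hs (by rw [← e]; ring)⟩⟩, h⟩

/-- The weighted number of triples, counted with `triWeight`. -/
noncomputable def triCount (N : ℤ) : ℤ := ∑ x ∈ tri N, triWeight x.1 x.2.1 x.2.2

/-- Integers `w` with `w² < 4m`. -/
noncomputable def traces (m : ℤ) : Finset ℤ :=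
  (Icc (-(2 * m)) (2 * m)).filter fun w => w ^ 2 < 4 * m

lemma mem_traces {m w : ℤ} : w ∈ traces m ↔ w ^ 2 < 4 * m := by
  simp only [traces, mem_filter, mem_Icc, and_iff_right_iff_imp]
  intro h
  constructor <;> nlinarith [sq_nonneg (w - 1), sq_nonneg (w + 1)]

lemma tri_parity {m w r s t : ℤ} (p1 : r % 2 = s % 2) (p2 : r % 2 = t % 2)
    (h : r * s + s * t + t * r = 4 * m - w ^ 2) : (r - w) % 2 = 0 := by
  have e : (w ^ 2 + (r * s + s * t + t * r)) % 4 = 0 := by rw [h]; omega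
  obtain ⟨s', rfl⟩ : ∃ s', s = r + 2 * s' := ⟨(s - r) / 2, by omega⟩
  obtain ⟨t', rfl⟩ : ∃ t', t = r + 2 * t' := ⟨(t - r) / 2, by omega⟩
  rcases Int.emod_two_eq_zero_or_one r with hr' | hr' <;>
  rcases Int.emod_two_eq_zero_or_one w with hw' | hw' <;>
  try omega
  · obtain ⟨r', rfl⟩ : ∃ r', r = 2 * r' := ⟨r / 2, by omega⟩
    obtain ⟨w', rfl⟩ : ∃ w', w = 2 * w' + 1 := ⟨w / 2, by omega⟩
    ring_nf at e
    omega
  · obtain ⟨r', rfl⟩ : ∃ r', r = 2 * r' + 1 := ⟨r / 2, by omega⟩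
    obtain ⟨w', rfl⟩ : ∃ w', w = 2 * w' := ⟨w / 2, by omega⟩
    ring_nf at e
    omega

lemma sum_triCount_pos (m : ℤ) :
    ∑ w ∈ (traces m).filter (0 < ·), triCount (4 * m - w ^ 2) =
      ∑ x ∈ trips m,
        triWeight (2 * x.1 + x.2.2.2) (2 * x.2.1 + x.2.2.2) (2 * x.2.2.1 + x.2.2.2) := by
  simp only [triCount]
  rw [sum_sigma']
  have h0 : ∑ x ∈ trips m,
        triWeight (2 * x.1 + x.2.2.2) (2 * x.2.1 + x.2.2.2) (2 * x.2.2.1 + x.2.2.2) =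
      ∑ x ∈ (trips m).filter
        (fun x => 0 ≤ 2 * x.1 + x.2.2.2 ∧ 0 ≤ 2 * x.2.1 + x.2.2.2 ∧ 0 ≤ 2 * x.2.2.1 + x.2.2.2),
        triWeight (2 * x.1 + x.2.2.2) (2 * x.2.1 + x.2.2.2) (2 * x.2.2.1 + x.2.2.2) := by
    rw [sum_filter]
    refine sum_congr rfl fun x _ => ?_
    split_ifs with h
    · rfl
    · rw [triWeight, if_neg (by omega), if_neg h]
  have hinv : ∀ y ∈ ((traces m).filter (0 < ·)).sigma fun w => tri (4 * m - w ^ 2),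
      2 * ((y.2.1 - y.1) / 2) + y.1 = y.2.1 ∧ 2 * ((y.2.2.1 - y.1) / 2) + y.1 = y.2.2.1 ∧
      2 * ((y.2.2.2 - y.1) / 2) + y.1 = y.2.2.2 := by
    rintro ⟨w, r, s, t⟩ h
    simp only [mem_sigma, mem_filter, mem_traces] at h
    obtain ⟨⟨h1, hw⟩, h⟩ := h
    rw [mem_tri (by linarith)] at h
    obtain ⟨hr, hs, ht, p1, p2, h⟩ := h
    have := tri_parity p1 p2 h
    dsimp only at *
    omega
  rw [h0]
  refine sum_bij' (fun y _ => ((y.2.1 - y.1) / 2, (y.2.2.1 - y.1) / 2, (y.2.2.2 - y.1) / 2, y.1))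
    (fun x _ => ⟨x.2.2.2, (2 * x.1 + x.2.2.2, 2 * x.2.1 + x.2.2.2, 2 * x.2.2.1 + x.2.2.2)⟩)
    ?_ ?_ ?_ ?_ ?_
  · rintro ⟨w, r, s, t⟩ h
    simp only [mem_sigma, mem_filter, mem_traces] at h
    obtain ⟨⟨h1, hw⟩, h⟩ := h
    rw [mem_tri (by linarith)] at h
    obtain ⟨hr, hs, ht, p1, p2, h⟩ := h
    have hmod := tri_parity p1 p2 h
    obtain ⟨X, rfl⟩ : ∃ X, r = 2 * X + w := ⟨(r - w) / 2, by omega⟩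
    obtain ⟨Y, rfl⟩ : ∃ Y, s = 2 * Y + w := ⟨(s - w) / 2, by omega⟩
    obtain ⟨Z, rfl⟩ : ∃ Z, t = 2 * Z + w := ⟨(t - w) / 2, by omega⟩
    simp only [add_sub_cancel_right, mul_div_cancel_left₀ _ (two_ne_zero' ℤ)]
    simp only [mem_filter, mem_trips]
    have hN : 0 < (2 * X + w) * (2 * Y + w) + (2 * Y + w) * (2 * Z + w) +
      (2 * Z + w) * (2 * X + w) := by rw [h]; linarith
    have aux : ∀ r s t : ℤ, 0 ≤ r → 0 ≤ s → 0 < r * s + s * t + t * r → 0 < r + s := by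
      intro r s t hr hs h
      by_contra h'
      obtain rfl : r = 0 := by omega
      obtain rfl : s = 0 := by omega
      simp at h
    have h12 := aux _ _ (2 * Z + w) hr hs hN
    have h23 := aux _ _ (2 * X + w) hs ht (by linarith)
    have h13 := aux _ _ (2 * Y + w) hr ht (by linarith)
    refine ⟨⟨hw, by omega, by omega, by omega, by omega, by omega, by omega, ?_⟩, hr, hs, ht⟩
    linarith
  · rintro ⟨X, Y, Z, w⟩ h
    simp only [mem_filter, mem_trips] at h
    obtain ⟨⟨hw, h1, h2, h3, h4, h5, h6, h⟩, hr, hs, ht⟩ := h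
    have e : (2 * X + w) * (2 * Y + w) + (2 * Y + w) * (2 * Z + w) +
      (2 * Z + w) * (2 * X + w) = 4 * m - w ^ 2 := by rw [← h]; ring
    have hN : 0 < 4 * m - w ^ 2 := by
      rw [← e]
      rcases hr.eq_or_lt with hr' | hr'
      · rw [← hr']
        have := mul_pos (by omega : 0 < 2 * Y + w) (by omega : 0 < 2 * Z + w)
        linarith
      · have := mul_nonneg hs ht
        have := mul_pos hr' (by omega : 0 < (2 * Y + w) + (2 * Z + w))
        linarith
    simp only [mem_sigma, mem_filter, mem_traces]
    rw [mem_tri hN]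
    exact ⟨⟨by linarith, hw⟩, hr, hs, ht, by omega, by omega, e⟩
  · rintro ⟨w, r, s, t⟩ h
    obtain ⟨e1, e2, e3⟩ := hinv _ h
    simp only [e1, e2, e3]
  · rintro ⟨X, Y, Z, w⟩ h
    simp
  · rintro ⟨w, r, s, t⟩ h
    obtain ⟨e1, e2, e3⟩ := hinv _ h
    simp only [e1, e2, e3]

lemma tri_rotate {m : ℤ} (hm : 0 < m) (g : ℤ → ℤ → ℤ → ℤ) :
    ∑ x ∈ tri m, g x.1 x.2.1 x.2.2 = ∑ x ∈ tri m, g x.2.1 x.2.2 x.1 := by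
  refine sum_nbij' (fun x => (x.2.2, x.1, x.2.1)) (fun x => (x.2.1, x.2.2, x.1)) ?_ ?_
    (fun _ _ => rfl) (fun _ _ => rfl) (fun _ _ => rfl) <;>
  · rintro ⟨r, s, t⟩ h
    simp only [mem_tri hm] at h ⊢
    exact ⟨by omega, by omega, by omega, by omega, by omega, by rw [← h.2.2.2.2.2]; ring⟩

lemma triCount_four_mul {m : ℤ} (hm : 0 < m) :
    triCount (4 * m) = 2 * (qcount m fun a c p _ => p = a + c) + 3 * (dpairs m).card := by
  classical
  have hm4 : 0 < 4 * m := by omega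
  have hev : ∀ r s t, (r, s, t) ∈ tri (4 * m) → r % 2 = 0 ∧ s % 2 = 0 ∧ t % 2 = 0 := by
    intro r s t h
    rw [mem_tri hm4] at h
    have := tri_parity (m := m) (w := 0) h.2.2.2.1 h.2.2.2.2.1 (by rw [h.2.2.2.2.2]; ring)
    omega
  have h1 : triCount (4 * m) = 2 * ∑ x ∈ tri (4 * m), (if 0 < x.1 ∧ 0 < x.2.1 ∧ 0 < x.2.2
        then 1 else 0) + (∑ x ∈ tri (4 * m), (if x.1 = 0 then 1 else 0) +
        (∑ x ∈ tri (4 * m), (if x.2.1 = 0 then 1 else 0) +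
        ∑ x ∈ tri (4 * m), (if x.2.2 = 0 then 1 else 0))) := by
    rw [triCount, mul_sum, ← sum_add_distrib, ← sum_add_distrib, ← sum_add_distrib]
    refine sum_congr rfl ?_
    rintro ⟨r, s, t⟩ h
    rw [mem_tri hm4] at h
    obtain ⟨hr, hs, ht, -, -, h⟩ := h
    simp only [triWeight]
    rcases hr.eq_or_lt with rfl | hr' <;> rcases hs.eq_or_lt with rfl | hs' <;>
    rcases ht.eq_or_lt with rfl | ht' <;> simp_all [ne_of_gt, le_of_lt]
  have h2 := tri_rotate hm4 (fun r _ _ => if r = 0 then 1 else 0)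
  have h3 := tri_rotate hm4 (fun _ s _ => if s = 0 then 1 else 0)
  have h4 : ∑ x ∈ tri (4 * m), (if x.1 = 0 then (1 : ℤ) else 0) = (dpairs m).card := by
    rw [← sum_filter, card_eq_sum_ones, Nat.cast_sum]
    refine sum_bij' (fun x _ => (x.2.1 / 2, x.2.2 / 2)) (fun y _ => (0, 2 * y.1, 2 * y.2))
      ?_ ?_ ?_ ?_ (fun _ _ => rfl)
    · rintro ⟨r, s, t⟩ h
      rw [mem_filter] at h
      have h' := hev _ _ _ h.1
      rw [mem_tri hm4] at h
      obtain ⟨⟨hr, hs, ht, -, -, h⟩, h0⟩ := h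
      obtain ⟨s, rfl⟩ : ∃ s', s = 2 * s' := ⟨s / 2, by omega⟩
      obtain ⟨t, rfl⟩ : ∃ t', t = 2 * t' := ⟨t / 2, by omega⟩
      simp only at h0
      subst h0
      simp only [mul_div_cancel_left₀ _ (two_ne_zero' ℤ), mem_dpairs]
      have e : s * t = m := by linarith
      have hs0 : s ≠ 0 := by rintro rfl; simp at e; omega
      have ht0 : t ≠ 0 := by rintro rfl; simp at e; omega
      exact ⟨by omega, by omega, e⟩
    · rintro ⟨d, e⟩ h
      rw [mem_dpairs] at h
      rw [mem_filter, mem_tri hm4]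
      exact ⟨⟨le_rfl, by omega, by omega, by omega, by omega, by rw [← h.2.2]; ring⟩, rfl⟩
    · rintro ⟨r, s, t⟩ h
      rw [mem_filter] at h
      have h' := hev _ _ _ h.1
      simp only [Prod.mk.injEq]
      simp only at h
      omega
    · rintro ⟨d, e⟩ h
      simp
  have h5 : ∑ x ∈ tri (4 * m), (if 0 < x.1 ∧ 0 < x.2.1 ∧ 0 < x.2.2 then (1 : ℤ) else 0) =
      qcount m fun a c p _ => p = a + c := by
    rw [qcount, ← sum_filter]
    refine Eq.trans ?_ (@sum_filter _ _ _ _ _ (fun _ => Classical.propDecidable _) _)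
    refine sum_bij' (fun x _ => (x.1 / 2, x.2.1 / 2, x.1 / 2 + x.2.1 / 2, x.2.2 / 2))
      (fun y _ => (2 * y.1, 2 * y.2.1, 2 * y.2.2.2)) ?_ ?_ ?_ ?_ (fun _ _ => rfl)
    · rintro ⟨r, s, t⟩ h
      rw [mem_filter] at h
      have h' := hev _ _ _ h.1
      rw [mem_tri hm4] at h
      obtain ⟨⟨hr, hs, ht, -, -, h⟩, h0⟩ := h
      obtain ⟨r, rfl⟩ : ∃ s', r = 2 * s' := ⟨r / 2, by omega⟩
      obtain ⟨s, rfl⟩ : ∃ s', s = 2 * s' := ⟨s / 2, by omega⟩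
      obtain ⟨t, rfl⟩ : ∃ t', t = 2 * t' := ⟨t / 2, by omega⟩
      simp only at h0
      simp only [mul_div_cancel_left₀ _ (two_ne_zero' ℤ), mem_filter, mem_quads, and_true]
      exact ⟨by omega, by omega, by omega, by omega, by linarith⟩
    · rintro ⟨a, c, p, q⟩ h
      simp only [mem_filter, mem_quads] at h
      obtain ⟨⟨ha, hc, hp, hq, h⟩, rfl⟩ := h
      rw [mem_filter, mem_tri hm4]
      dsimp only
      exact ⟨⟨by omega, by omega, by omega, by omega, by omega, by rw [← h]; ring⟩, by omega⟩
    · rintro ⟨r, s, t⟩ h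
      rw [mem_filter] at h
      have h' := hev _ _ _ h.1
      simp only [Prod.mk.injEq]
      omega
    · rintro ⟨a, c, p, q⟩ h
      simp only [mem_filter, mem_quads] at h
      simp only [Prod.mk.injEq]
      omega
  rw [h1, h5, ← h3, ← h2, h4]
  ring

/-- The Kronecker-Hurwitz relation in terms of triples. -/
lemma sum_triCount {m : ℤ} (hm : 0 < m) :
    ∑ w ∈ traces m, triCount (4 * m - w ^ 2) =
      12 * ∑ x ∈ dpairs m, x.2 - 6 * ∑ x ∈ dpairs m, min x.1 x.2 +
        ∑ x ∈ dpairs m, (if x.1 = x.2 then 1 else 0) := by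
  have h1 : ∑ w ∈ (traces m).filter (· < 0), triCount (4 * m - w ^ 2) =
      ∑ w ∈ (traces m).filter (0 < ·), triCount (4 * m - w ^ 2) := by
    refine sum_nbij' (fun w => -w) (fun w => -w) ?_ ?_ (fun _ _ => neg_neg _)
      (fun _ _ => neg_neg _) (fun w _ => by rw [neg_sq]) <;>
    · intro w
      simp only [mem_filter, mem_traces, neg_sq]
      omega
  have h2 : ∑ w ∈ traces m, triCount (4 * m - w ^ 2) =
      ∑ w ∈ (traces m).filter (0 < ·), triCount (4 * m - w ^ 2) + (triCount (4 * m) +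
      ∑ w ∈ (traces m).filter (· < 0), triCount (4 * m - w ^ 2)) := by
    have h0 : triCount (4 * m) = ∑ w ∈ traces m, if w = 0 then triCount (4 * m - w ^ 2) else 0 := by
      rw [sum_ite_eq' (traces m) 0, if_pos (by rw [mem_traces]; linarith)]
      simp
    rw [h0, sum_filter, sum_filter, ← sum_add_distrib, ← sum_add_distrib]
    refine sum_congr rfl fun w _ => ?_
    rcases lt_trichotomy w 0 with h | h | h
    · simp [h, h.ne, h.not_gt]
    · simp [h]
    · simp [h, h.ne', h.not_gt]
  rw [h2, h1, sum_triCount_pos, sum_trips_weight, triCount_four_mul hm]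
  linarith [qcount_relation m]

end ArcsinSum

namespace ArcsinSum

open Finset

/-! ### Reduced binary quadratic forms -/

/-- Reduced positive definite forms. -/
def IsReduced (Q : ℤ × ℤ × ℤ) : Prop :=
  0 < Q.1 ∧ |Q.2.1| ≤ Q.1 ∧ Q.1 ≤ Q.2.2 ∧ (|Q.2.1| = Q.1 ∨ Q.1 = Q.2.2 → 0 ≤ Q.2.1)

lemma qfAct_one (Q : ℤ × ℤ × ℤ) : qfAct 1 Q = Q := by
  simp [qfAct]

lemma qfAct_mul (g h : Matrix.SpecialLinearGroup (Fin 2) ℤ) (Q : ℤ × ℤ × ℤ) :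
    qfAct (g * h) Q = qfAct g (qfAct h Q) := by
  simp only [qfAct, Matrix.SpecialLinearGroup.coe_mul, Matrix.mul_apply, Fin.sum_univ_two,
    Prod.mk.injEq]
  refine ⟨by ring, by ring, by ring⟩

lemma qfRel_equivalence : Equivalence qfRel where
  refl Q := ⟨1, qfAct_one Q⟩
  symm := by
    rintro Q _ ⟨g, rfl⟩
    exact ⟨g⁻¹, by rw [← qfAct_mul, inv_mul_cancel, qfAct_one]⟩
  trans := by
    rintro Q _ _ ⟨g, rfl⟩ ⟨h, rfl⟩
    exact ⟨h * g, qfAct_mul h g Q⟩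

lemma quot_mk_eq_iff {Q Q' : ℤ × ℤ × ℤ} :
    Quot.mk qfRel Q = Quot.mk qfRel Q' ↔ qfRel Q Q' := by
  rw [Quot.eq, qfRel_equivalence.eqvGen_iff]

lemma qfAct_disc (g : Matrix.SpecialLinearGroup (Fin 2) ℤ) (Q : ℤ × ℤ × ℤ) :
    (qfAct g Q).2.1 ^ 2 - 4 * (qfAct g Q).1 * (qfAct g Q).2.2 = Q.2.1 ^ 2 - 4 * Q.1 * Q.2.2 := by
  have h := g.det_coe
  rw [Matrix.det_fin_two] at h
  simp only [qfAct]
  linear_combination (Q.2.1 ^ 2 - 4 * Q.1 * Q.2.2) *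
    (g.1 0 0 * g.1 1 1 - g.1 0 1 * g.1 1 0 + 1) * h

/-- A reduced form `[a, b, c]` takes no nonzero value below `a`. -/
lemma IsReduced.le_value {Q : ℤ × ℤ × ℤ} (h : IsReduced Q) {x y : ℤ} (hxy : ¬ (x = 0 ∧ y = 0)) :
    Q.1 ≤ Q.1 * x ^ 2 + Q.2.1 * x * y + Q.2.2 * y ^ 2 := by
  obtain ⟨h1, h2, h3, -⟩ := h
  rw [abs_le] at h2
  rcases eq_or_ne x 0 with rfl | hx
  · have hy : y ≠ 0 := fun hy => hxy ⟨rfl, hy⟩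
    have : 1 ≤ y ^ 2 := by have : 0 < y ^ 2 := by positivity
                           omega
    nlinarith
  have hx2 : 1 ≤ x ^ 2 := by have : 0 < x ^ 2 := by positivity
                             omega
  rcases eq_or_ne y 0 with rfl | hy
  · nlinarith
  have hy2 : 1 ≤ y ^ 2 := by have : 0 < y ^ 2 := by positivity
                             omega
  have hval : Q.1 * (x ^ 2 - |x * y| + y ^ 2) ≤ Q.1 * x ^ 2 + Q.2.1 * x * y + Q.2.2 * y ^ 2 := by
    have h4 : -(Q.1 * |x * y|) ≤ Q.2.1 * (x * y) := by
      rcases abs_cases (x * y) with ⟨e, h⟩ | ⟨e, h⟩ <;> rw [e] <;> nlinarith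
    nlinarith
  have h5 : 1 ≤ x ^ 2 - |x * y| + y ^ 2 := by
    have h6 : |x * y| = |x| * |y| := abs_mul x y
    have h7 := sq_abs x
    have h8 := sq_abs y
    have h9 := Int.one_le_abs hx
    have h10 := Int.one_le_abs hy
    nlinarith [sq_nonneg (|x| - |y|)]
  nlinarith

/-- Equivalent reduced forms have the same leading coefficient. -/
lemma IsReduced.fst_le {Q Q' : ℤ × ℤ × ℤ} (h : IsReduced Q) (hr : qfRel Q Q') : Q.1 ≤ Q'.1 := by
  obtain ⟨g, rfl⟩ := hr
  refine h.le_value ?_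
  rintro ⟨h0, h1⟩
  have h := g.det_coe
  rw [Matrix.det_fin_two, h0, h1] at h
  simp at h

lemma IsReduced.eq_of_rel {Q Q' : ℤ × ℤ × ℤ} (h : IsReduced Q) (h' : IsReduced Q')
    (hr : qfRel Q Q') : Q = Q' := by
  have ha : Q.1 = Q'.1 := le_antisymm (h.fst_le hr) (h'.fst_le (qfRel_equivalence.symm hr))
  obtain ⟨g, hg⟩ := hr
  have hdisc := qfAct_disc g Q
  rw [hg] at hdisc
  have hdet := g.det_coe
  rw [Matrix.det_fin_two] at hdet
  obtain ⟨a, b, c⟩ := Q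
  obtain ⟨a', b', c'⟩ := Q'
  simp only [qfAct, Prod.mk.injEq] at hg
  generalize g.1 0 0 = α at *
  generalize g.1 0 1 = β at *
  generalize g.1 1 0 = γ at *
  generalize g.1 1 1 = δ at *
  simp only at ha hdisc
  subst ha
  obtain ⟨h1, h2, h3, h4⟩ := h
  obtain ⟨-, h2', h3', h4'⟩ := h'
  simp only at *
  suffices hb : b' = b by
    subst hb
    have : 4 * a * (c' - c) = 0 := by linarith
    have : c' = c := by
      rcases mul_eq_zero.1 this with h | h <;> omega
    rw [this]
  rw [abs_le] at h2 h2'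
  -- equal `c` and `b' = -b` or `b' ≡ b` modulo `2a`
  have hcases : (∃ k, b' = b + 2 * a * k) ∨ (a = c ∧ ∃ k, b' = -b + 2 * a * k) ∨ (a = b ∧ a = c) := by
    rcases eq_or_ne β 0 with rfl | hβ
    · refine Or.inl ⟨α * γ, ?_⟩
      rw [← hg.2.1]
      have : α * δ = 1 := by linarith
      rw [this]
      ring
    have hβ2 : 1 ≤ β ^ 2 := by have : 0 < β ^ 2 := by positivity
                               omega
    rcases eq_or_ne α 0 with rfl | hα
    · have hc1 : c * β ^ 2 = a := by linarith [hg.1]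
      have hac : a = c := by nlinarith
      refine Or.inr (Or.inl ⟨hac, β * δ, ?_⟩)
      rw [← hg.2.1, hac]
      have : β * γ = -1 := by linarith
      rw [this]
      ring
    have hα2 : 1 ≤ α ^ 2 := by have : 0 < α ^ 2 := by positivity
                               omega
    have h9 := Int.one_le_abs hα
    have h10 := Int.one_le_abs hβ
    have h5 : -(a * (|α| * |β|)) ≤ b * (α * β) := by
      rw [← abs_mul]
      rcases abs_cases (α * β) with ⟨e, h⟩ | ⟨e, h⟩ <;> rw [e] <;> nlinarith
    have h7 := sq_abs α
    have h8 := sq_abs β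
    have h11 : c * β ^ 2 - a * β ^ 2 = (c - a) * β ^ 2 := by ring
    have h12 : 0 ≤ (c - a) * β ^ 2 := mul_nonneg (by omega) (by omega)
    have h13 : a * ((|α| - |β|) ^ 2 + |α| * |β|) ≤ a * 1 := by
      have e : a * ((|α| - |β|) ^ 2 + |α| * |β|) =
          a * |α| ^ 2 + a * |β| ^ 2 - a * (|α| * |β|) := by ring
      rw [e, h7, h8]
      linarith [hg.1]
    have h14 := le_of_mul_le_mul_left h13 h1
    have hαβ : |α| * |β| ≤ 1 := by linarith [sq_nonneg (|α| - |β|)]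
    have hα1 : |α| = 1 := by
      refine le_antisymm ?_ h9
      exact (le_mul_of_one_le_right (abs_nonneg _) h10).trans hαβ
    have hβ1 : |β| = 1 := by
      refine le_antisymm ?_ h10
      exact (le_mul_of_one_le_left (abs_nonneg _) h9).trans hαβ
    have eα : α ^ 2 = 1 := by rw [← h7, hα1]; norm_num
    have eβ : β ^ 2 = 1 := by rw [← h8, hβ1]; norm_num
    have hc : b * (α * β) + c = 0 := by
      have := hg.1
      rw [eα, eβ] at this
      linarith
    refine Or.inr (Or.inr ?_)
    rcases eq_or_eq_neg_of_abs_eq hα1 with rfl | rfl <;>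
    rcases eq_or_eq_neg_of_abs_eq hβ1 with rfl | rfl
    · have := h4 (Or.inr (by omega)); omega
    · omega
    · omega
    · have := h4 (Or.inr (by omega)); omega
  rcases hcases with ⟨k, hk⟩ | ⟨hac, k, hk⟩ | ⟨hab, hac⟩
  · have hk1 : k ≤ 1 := by nlinarith
    have hk2 : -1 ≤ k := by nlinarith
    have : k = -1 ∨ k = 0 ∨ k = 1 := by omega
    rcases this with rfl | rfl | rfl
    · have := h4' (Or.inl (by rw [abs_eq (by omega)]; omega)); omega
    · omega
    · have := h4 (Or.inl (by rw [abs_eq (by omega)]; omega)); omega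
  · have hb := h4 (Or.inr hac)
    have hk1 : k ≤ 1 := by nlinarith
    have hk2 : 0 ≤ k := by nlinarith
    have : k = 0 ∨ k = 1 := by omega
    rcases this with rfl | rfl
    · obtain rfl : b' = -b := by omega
      have : 4 * a * (c' - c) = 0 := by linarith
      have : c' = c := by
        rcases mul_eq_zero.1 this with h | h <;> omega
      have := h4' (Or.inr (by omega))
      omega
    · omega
  · subst hab hac
    have e : b' ^ 2 = 4 * a * c' - 3 * a ^ 2 := by linarith
    have h5 : a ^ 2 ≤ b' ^ 2 := by nlinarith
    have h6 := sq_le_sq.1 h5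
    rw [abs_of_pos h1] at h6
    have h7 := h4' (Or.inl (le_antisymm (abs_le.2 h2') h6))
    rw [abs_of_nonneg h7] at h6
    omega

/-- Every positive definite form is equivalent to a reduced one. -/
lemma exists_reduced (n : ℕ) : ∀ Q : ℤ × ℤ × ℤ, Q.1 = n → 0 < Q.1 →
    Q.2.1 ^ 2 - 4 * Q.1 * Q.2.2 < 0 → ∃ Q', IsReduced Q' ∧ qfRel Q Q' := by
  induction n using Nat.strong_induction_on with
  | _ n ih =>
  rintro ⟨a, b, c⟩ hn ha hD
  simp only at hn ha hD
  -- translate so that `-a < b ≤ a`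
  obtain ⟨k, hk1, hk2⟩ : ∃ k : ℤ, -a < b + 2 * a * k ∧ b + 2 * a * k ≤ a := by
    refine ⟨-((b + a - 1) / (2 * a)), ?_⟩
    have h1 := Int.emod_add_mul_ediv (b + a - 1) (2 * a)
    have h2 := Int.emod_nonneg (b + a - 1) (by omega : 2 * a ≠ 0)
    have h3 := Int.emod_lt_of_pos (b + a - 1) (by omega : 0 < 2 * a)
    constructor <;> linarith
  set b' := b + 2 * a * k with hb'
  set c' := a * k ^ 2 + b * k + c with hc'
  have hT : qfRel (a, b, c) (a, b', c') := by
    refine ⟨⟨!![1, 0; k, 1], by simp [Matrix.det_fin_two]⟩, ?_⟩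
    simp [qfAct, hb', hc']
    ring
  have hS : qfRel (a, b', c') (c', -b', a) := by
    refine ⟨⟨!![0, 1; -1, 0], by simp [Matrix.det_fin_two]⟩, ?_⟩
    simp [qfAct]
  have hD' : b' ^ 2 - 4 * a * c' = b ^ 2 - 4 * a * c := by rw [hb', hc']; ring
  have hc0 : 0 < c' := by
    by_contra h
    nlinarith [sq_nonneg b']
  rcases lt_trichotomy a c' with h | h | h
  · refine ⟨_, ⟨ha, abs_le.2 ⟨hk1.le, hk2⟩, h.le, ?_⟩, hT⟩
    rintro (h' | h')
    · simp only at h'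
      rcases abs_eq ha.le |>.1 h' with h' | h' <;> simp only <;> omega
    · simp only at h'; omega
  · rcases le_or_gt 0 b' with hb | hb
    · exact ⟨_, ⟨ha, abs_le.2 ⟨hk1.le, hk2⟩, h.le, fun _ => hb⟩, hT⟩
    · refine ⟨_, ⟨hc0, ?_, h.ge, fun _ => ?_⟩, qfRel_equivalence.trans hT hS⟩
      · simp only [abs_neg]; rw [← h]; exact abs_le.2 ⟨hk1.le, hk2⟩
      · simp only; omega
  · obtain ⟨Q', hQ', hr⟩ := ih c'.toNat (by omega) (c', -b', a) (by simp; omega) hc0 (by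
      simp only; linarith)
    exact ⟨Q', hQ', qfRel_equivalence.trans (qfRel_equivalence.trans hT hS) hr⟩

end ArcsinSum

namespace ArcsinSum

open Finset

open Classical in
/-- The reduced forms of discriminant `-N`. -/
noncomputable def redForms (N : ℤ) : Finset (ℤ × ℤ × ℤ) :=
  (Icc 1 N ×ˢ Icc (-N) N ×ˢ Icc 1 N).filter fun Q =>
    IsReduced Q ∧ Q.2.1 ^ 2 - 4 * Q.1 * Q.2.2 = -N

lemma mem_redForms {N : ℤ} {Q : ℤ × ℤ × ℤ} :
    Q ∈ redForms N ↔ IsReduced Q ∧ Q.2.1 ^ 2 - 4 * Q.1 * Q.2.2 = -N := by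
  simp only [redForms, mem_filter, mem_product, mem_Icc, and_iff_right_iff_imp]
  rintro ⟨⟨h1, h2, h3, -⟩, h⟩
  rw [abs_le] at h2
  have h4 : Q.2.1 ^ 2 ≤ Q.1 * Q.2.2 := by nlinarith
  have h5 : Q.2.2 ≤ Q.1 * Q.2.2 := by nlinarith
  rw [mul_assoc] at h
  omega

lemma mk_injOn_redForms (N : ℤ) : Set.InjOn (Quot.mk qfRel) (redForms N : Set (ℤ × ℤ × ℤ)) :=
  fun _ h _ h' e => (mem_redForms.1 h).1.eq_of_rel (mem_redForms.1 h').1 (quot_mk_eq_iff.1 e)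

lemma qfClasses_eq_image {N : ℤ} (hN : 0 < N) :
    qfClasses N = Quot.mk qfRel '' (redForms N : Set (ℤ × ℤ × ℤ)) := by
  ext q
  simp only [qfClasses, Set.mem_ofPred_eq, Set.mem_image, mem_coe, mem_redForms]
  constructor
  · rintro ⟨Q, rfl, h, h0⟩
    obtain ⟨Q', hQ', hr⟩ := exists_reduced Q.1.toNat Q (by omega) h0 (by omega)
    refine ⟨Q', ⟨hQ', ?_⟩, (quot_mk_eq_iff.2 hr).symm⟩
    obtain ⟨g, rfl⟩ := hr
    rw [qfAct_disc, h]
  · rintro ⟨Q, ⟨hQ, h⟩, rfl⟩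
    exact ⟨Q, rfl, h, hQ.1⟩

lemma ncard_classes_containing {N : ℤ} (hN : 0 < N) (G : ℤ → ℤ × ℤ × ℤ)
    (hG : ∀ k, 0 < k → IsReduced (G k)) (hpos : ∀ k Q, qfRel (G k) Q → 0 < Q.1 → 0 < k) :
    ({q ∈ qfClasses N | ∃ k : ℤ, Quot.mk qfRel (G k) = q}).ncard =
      ({Q ∈ (redForms N : Set (ℤ × ℤ × ℤ)) | ∃ k, 0 < k ∧ G k = Q}).ncard := by
  rw [← ((mk_injOn_redForms N).mono (Set.sep_subset _ _)).ncard_image]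
  congr 1
  ext q
  simp only [qfClasses_eq_image hN, Set.mem_ofPred_eq, Set.mem_image, mem_coe]
  constructor
  · rintro ⟨⟨Q, hQ, rfl⟩, k, hk⟩
    rw [quot_mk_eq_iff] at hk
    have hQ' := (mem_redForms.1 hQ).1
    have hk0 := hpos k Q hk hQ'.1
    exact ⟨Q, ⟨hQ, k, hk0, (hG k hk0).eq_of_rel hQ' hk⟩, rfl⟩
  · rintro ⟨Q, ⟨hQ, k, -, rfl⟩, rfl⟩
    exact ⟨⟨_, hQ, rfl⟩, k, rfl⟩

/-- The weight of a reduced form in `6 H(N)`. -/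
def redWeight (Q : ℤ × ℤ × ℤ) : ℤ :=
  6 - (if Q.2.1 = 0 ∧ Q.1 = Q.2.2 then 3 else 0) -
    (if Q.2.1 = Q.1 ∧ Q.1 = Q.2.2 then 4 else 0)

lemma six_mul_hurwitzH_eq_sum {N : ℤ} (hN : 0 < N) (h4 : N % 4 = 0 ∨ N % 4 = 3) :
    6 * hurwitzH N = ((∑ Q ∈ redForms N, redWeight Q : ℤ) : ℝ) := by
  have e0 : (qfClasses N).ncard = #(redForms N) := by
    rw [qfClasses_eq_image hN, (mk_injOn_redForms N).ncard_image,
      Set.ncard_coe_finset]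
  have e1 : ({q ∈ qfClasses N | ∃ k : ℤ, Quot.mk qfRel (k, 0, k) = q}).ncard =
      #((redForms N).filter fun Q => Q.2.1 = 0 ∧ Q.1 = Q.2.2) := by
    rw [ncard_classes_containing hN (fun k => (k, 0, k)), ← Set.ncard_coe_finset]
    · congr 1
      ext ⟨a, b, c⟩
      simp only [mem_coe, Set.mem_ofPred_eq, mem_filter, Prod.mk.injEq]
      constructor
      · rintro ⟨h, k, -, rfl, rfl, rfl⟩; exact ⟨h, rfl, rfl⟩
      · rintro ⟨h, rfl, rfl⟩; exact ⟨h, a, (mem_redForms.1 h).1.1, rfl, rfl, rfl⟩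
    · intro k hk
      exact ⟨hk, by simpa using hk.le, le_rfl, fun _ => le_rfl⟩
    · rintro k _ ⟨g, rfl⟩ h
      simp only [qfAct] at h
      by_contra hk
      nlinarith [sq_nonneg (g.1 0 0), sq_nonneg (g.1 0 1)]
  have e2 : ({q ∈ qfClasses N | ∃ k : ℤ, Quot.mk qfRel (k, k, k) = q}).ncard =
      #((redForms N).filter fun Q => Q.2.1 = Q.1 ∧ Q.1 = Q.2.2) := by
    rw [ncard_classes_containing hN (fun k => (k, k, k)), ← Set.ncard_coe_finset]
    · congr 1
      ext ⟨a, b, c⟩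
      simp only [mem_coe, Set.mem_ofPred_eq, mem_filter, Prod.mk.injEq]
      constructor
      · rintro ⟨h, k, -, rfl, rfl, rfl⟩; exact ⟨h, rfl, rfl⟩
      · rintro ⟨h, rfl, rfl⟩; exact ⟨h, b, (mem_redForms.1 h).1.1, rfl, rfl, rfl⟩
    · intro k hk
      exact ⟨hk, (abs_of_pos hk).le, le_rfl, fun _ => hk.le⟩
    · rintro k _ ⟨g, rfl⟩ h
      simp only [qfAct] at h
      by_contra hk
      nlinarith [sq_nonneg (g.1 0 0 + g.1 0 1), sq_nonneg (g.1 0 0), sq_nonneg (g.1 0 1)]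
  rw [hurwitzH, if_neg hN.ne', if_pos ⟨hN, h4⟩, e0, e1, e2]
  simp only [redWeight, sum_sub_distrib, ← sum_filter, sum_const, nsmul_eq_mul]
  push_cast
  ring

/-- The contribution of an ordered triple to the count of reduced forms. -/
def orderedWeight (r s t : ℤ) : ℤ :=
  (if t ≤ r ∧ r ≤ s then
    6 - (if t = 0 ∧ r = s then 3 else 0) - (if t = r ∧ r = s then 4 else 0) else 0) +
  if 0 < t ∧ t < r ∧ r < s then 6 else 0

lemma sum_redWeight {N : ℤ} (hN : 0 < N) :
    ∑ Q ∈ redForms N, redWeight Q = ∑ x ∈ tri N, orderedWeight x.1 x.2.1 x.2.2 := by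
  simp only [orderedWeight, sum_add_distrib, ← sum_filter]
  rw [← sum_filter_add_sum_filter_not (redForms N) (fun Q => 0 ≤ Q.2.1)]
  congr 1
  · refine sum_nbij' (fun Q => (2 * Q.1 - Q.2.1, 2 * Q.2.2 - Q.2.1, Q.2.1))
      (fun x => ((x.1 + x.2.2) / 2, x.2.2, (x.2.1 + x.2.2) / 2)) ?_ ?_ ?_ ?_ ?_
    · rintro ⟨a, b, c⟩ h
      simp only [mem_filter, mem_redForms, IsReduced] at h
      obtain ⟨⟨⟨h1, h2, h3, h4⟩, h5⟩, h6⟩ := h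
      rw [abs_of_nonneg h6] at h2
      simp only [mem_filter, mem_tri hN]
      refine ⟨⟨by omega, by omega, by omega, by omega, by omega, by linarith⟩, by omega⟩
    · rintro ⟨r, s, t⟩ h
      simp only [mem_filter, mem_tri hN] at h
      obtain ⟨⟨h1, h2, h3, h4, h5, h6⟩, h7, h8⟩ := h
      obtain ⟨a, rfl⟩ : ∃ a, r = 2 * a - t := ⟨(r + t) / 2, by omega⟩
      obtain ⟨c, rfl⟩ : ∃ c, s = 2 * c - t := ⟨(s + t) / 2, by omega⟩
      simp only [mem_filter, mem_redForms, IsReduced]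
      rw [show (2 * a - t + t) / 2 = a by omega, show (2 * c - t + t) / 2 = c by omega,
        abs_of_nonneg h3]
      refine ⟨⟨⟨?_, by omega, by omega, by omega⟩, by linarith⟩, h3⟩
      by_contra h
      obtain rfl : t = 0 := by omega
      obtain rfl : a = 0 := by omega
      omega
    · rintro ⟨a, b, c⟩ h
      simp only [Prod.mk.injEq, true_and]
      omega
    · rintro ⟨r, s, t⟩ h
      simp only [mem_filter, mem_tri hN] at h
      simp only [Prod.mk.injEq, and_true]
      omega
    · rintro ⟨a, b, c⟩ h
      simp only [redWeight]
      congr 1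
      · congr 1
        exact if_congr (by constructor <;> intro h <;> omega) rfl rfl
      · exact if_congr (by constructor <;> intro h <;> omega) rfl rfl
  · refine sum_nbij' (fun Q => (2 * Q.1 + Q.2.1, 2 * Q.2.2 + Q.2.1, -Q.2.1))
      (fun x => ((x.1 + x.2.2) / 2, -x.2.2, (x.2.1 + x.2.2) / 2)) ?_ ?_ ?_ ?_ ?_
    · rintro ⟨a, b, c⟩ h
      simp only [mem_filter, mem_redForms, IsReduced] at h
      obtain ⟨⟨⟨h1, h2, h3, h4⟩, h5⟩, h6⟩ := h
      rw [abs_of_neg (by omega)] at h2 h4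
      simp only [mem_filter, mem_tri hN]
      refine ⟨⟨by omega, by omega, by omega, by omega, by omega, by linarith⟩, by omega⟩
    · rintro ⟨r, s, t⟩ h
      simp only [mem_filter, mem_tri hN] at h
      obtain ⟨⟨h1, h2, h3, h4, h5, h6⟩, h7, h8⟩ := h
      obtain ⟨a, rfl⟩ : ∃ a, r = 2 * a - t := ⟨(r + t) / 2, by omega⟩
      obtain ⟨c, rfl⟩ : ∃ c, s = 2 * c - t := ⟨(s + t) / 2, by omega⟩
      simp only [mem_filter, mem_redForms, IsReduced]
      rw [show (2 * a - t + t) / 2 = a by omega, show (2 * c - t + t) / 2 = c by omega,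
        abs_neg, abs_of_nonneg h3]
      exact ⟨⟨⟨by omega, by omega, by omega, by omega⟩, by linarith⟩, by omega⟩
    · rintro ⟨a, b, c⟩ h
      simp only [Prod.mk.injEq, neg_neg, true_and]
      omega
    · rintro ⟨r, s, t⟩ h
      simp only [mem_filter, mem_tri hN] at h
      simp only [Prod.mk.injEq, neg_neg, and_true]
      omega
    · rintro ⟨a, b, c⟩ h
      simp only [mem_filter, mem_redForms, IsReduced] at h
      simp only [redWeight]
      rw [if_neg (by omega), if_neg (by omega)]
      rfl

lemma orderedWeight_eq_zero {r s t : ℤ} (h : r < t ∨ s < r) : orderedWeight r s t = 0 := by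
  rw [orderedWeight, if_neg (by omega), if_neg (by omega), add_zero]

lemma sum_orderedWeight_perms_of_le {r s t : ℤ} (ht : 0 ≤ t) (htr : t ≤ r) (hrs : r ≤ s)
    (hr : 0 < r) :
    orderedWeight r s t + orderedWeight s t r + orderedWeight t r s +
      (orderedWeight s r t + orderedWeight r t s + orderedWeight t s r) =
      6 * if 0 < t then 2 else 1 := by
  rcases htr.eq_or_lt with rfl | h1 <;> rcases hrs.eq_or_lt with rfl | h2
  · simp [orderedWeight, hr, hr.ne']
  · rw [orderedWeight_eq_zero (r := s) (s := t) (Or.inr h2),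
      orderedWeight_eq_zero (r := t) (s := t) (t := s) (Or.inl h2)]
    simp [orderedWeight, hr, hr.ne', h2.le, h2.ne]
  · rw [orderedWeight_eq_zero (r := r) (s := t) (Or.inr h1),
      orderedWeight_eq_zero (r := t) (s := r) (Or.inl h1)]
    rcases ht.eq_or_lt with rfl | h0
    · simp [orderedWeight, hr.le, hr.ne]
    · simp [orderedWeight, h0, h0.ne', h1.le, h1.ne]
  · rw [orderedWeight_eq_zero (r := s) (s := t) (Or.inr (by omega)),
      orderedWeight_eq_zero (r := t) (s := r) (Or.inl (by omega)),
      orderedWeight_eq_zero (r := s) (s := r) (Or.inr (by omega)),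
      orderedWeight_eq_zero (r := r) (s := t) (Or.inr (by omega)),
      orderedWeight_eq_zero (r := t) (s := s) (Or.inl (by omega))]
    simp only [orderedWeight]
    split_ifs <;> omega

lemma sum_orderedWeight_perms {r s t : ℤ} (hr : 0 ≤ r) (hs : 0 ≤ s) (ht : 0 ≤ t)
    (h : 0 < r * s + s * t + t * r) :
    orderedWeight r s t + orderedWeight s t r + orderedWeight t r s +
      (orderedWeight s r t + orderedWeight r t s + orderedWeight t s r) = 6 * triWeight r s t := by
  have h1 : ¬ (r = 0 ∧ s = 0) := by rintro ⟨rfl, rfl⟩; simp at h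
  have h2 : ¬ (s = 0 ∧ t = 0) := by rintro ⟨rfl, rfl⟩; simp at h
  have h3 : ¬ (t = 0 ∧ r = 0) := by rintro ⟨rfl, rfl⟩; simp at h
  clear h
  rw [triWeight, if_pos (⟨hr, hs, ht⟩ : 0 ≤ r ∧ 0 ≤ s ∧ 0 ≤ t)]
  rcases le_total r s with a | a <;> rcases le_total s t with b | b <;>
    rcases le_total r t with c | c
  · rw [if_congr (show _ ↔ 0 < r by omega) rfl rfl,
      ← sum_orderedWeight_perms_of_le hr a b (by omega)]; ring
  · rw [if_congr (show _ ↔ 0 < r by omega) rfl rfl,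
      ← sum_orderedWeight_perms_of_le hr a b (by omega)]; ring
  · rw [if_congr (show _ ↔ 0 < r by omega) rfl rfl,
      ← sum_orderedWeight_perms_of_le hr c b (by omega)]; ring
  · rw [if_congr (show _ ↔ 0 < t by omega) rfl rfl,
      ← sum_orderedWeight_perms_of_le ht c a (by omega)]
  · rw [if_congr (show _ ↔ 0 < s by omega) rfl rfl,
      ← sum_orderedWeight_perms_of_le hs a c (by omega)]; ring
  · rw [if_congr (show _ ↔ 0 < s by omega) rfl rfl,
      ← sum_orderedWeight_perms_of_le hs b c (by omega)]; ring
  · rw [if_congr (show _ ↔ 0 < t by omega) rfl rfl,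
      ← sum_orderedWeight_perms_of_le ht b a (by omega)]; ring
  · rw [if_congr (show _ ↔ 0 < t by omega) rfl rfl,
      ← sum_orderedWeight_perms_of_le ht b a (by omega)]; ring

lemma sum_tri_rotate {N : ℤ} (hN : 0 < N) (F : ℤ → ℤ → ℤ → ℤ) :
    ∑ x ∈ tri N, F x.2.1 x.2.2 x.1 = ∑ x ∈ tri N, F x.1 x.2.1 x.2.2 := by
  refine sum_nbij' (fun x => (x.2.1, x.2.2, x.1)) (fun x => (x.2.2, x.1, x.2.1)) ?_ ?_
    (fun _ _ => rfl) (fun _ _ => rfl) (fun _ _ => rfl) <;>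
  · rintro ⟨r, s, t⟩ h
    simp only [mem_tri hN] at h ⊢
    exact ⟨by omega, by omega, by omega, by omega, by omega, by linarith⟩

lemma sum_tri_swap {N : ℤ} (hN : 0 < N) (F : ℤ → ℤ → ℤ → ℤ) :
    ∑ x ∈ tri N, F x.2.1 x.1 x.2.2 = ∑ x ∈ tri N, F x.1 x.2.1 x.2.2 := by
  refine sum_nbij' (fun x => (x.2.1, x.1, x.2.2)) (fun x => (x.2.1, x.1, x.2.2)) ?_ ?_
    (fun _ _ => rfl) (fun _ _ => rfl) (fun _ _ => rfl) <;>
  · rintro ⟨r, s, t⟩ h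
    simp only [mem_tri hN] at h ⊢
    exact ⟨by omega, by omega, by omega, by omega, by omega, by linarith⟩

lemma sum_orderedWeight {N : ℤ} (hN : 0 < N) :
    ∑ x ∈ tri N, orderedWeight x.1 x.2.1 x.2.2 = triCount N := by
  have h : ∑ x ∈ tri N, (orderedWeight x.1 x.2.1 x.2.2 + orderedWeight x.2.1 x.2.2 x.1 +
      orderedWeight x.2.2 x.1 x.2.1 + (orderedWeight x.2.1 x.1 x.2.2 +
      orderedWeight x.1 x.2.2 x.2.1 + orderedWeight x.2.2 x.2.1 x.1)) = 6 * triCount N := by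
    rw [triCount, mul_sum]
    refine sum_congr rfl fun x hx => ?_
    obtain ⟨r, s, t⟩ := x
    rw [mem_tri hN] at hx
    exact sum_orderedWeight_perms hx.1 hx.2.1 hx.2.2.1 (by rw [hx.2.2.2.2.2]; exact hN)
  have e1 := sum_tri_rotate hN orderedWeight
  have e2 := sum_tri_rotate hN fun r s t => orderedWeight s t r
  have e3 := sum_tri_swap hN orderedWeight
  have e4 := sum_tri_swap hN fun r s t => orderedWeight s t r
  have e5 := sum_tri_swap hN fun r s t => orderedWeight t r s
  simp only [sum_add_distrib] at h
  linarith

/-- Hurwitz class numbers as weighted counts of triples. -/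
lemma six_mul_hurwitzH {N : ℤ} (hN : 0 < N) : 6 * hurwitzH N = (triCount N : ℝ) := by
  by_cases h4 : N % 4 = 0 ∨ N % 4 = 3
  · rw [six_mul_hurwitzH_eq_sum hN h4, sum_redWeight hN, sum_orderedWeight hN]
  · have h0 : tri N = ∅ := by
      refine eq_empty_of_forall_notMem ?_
      rintro ⟨r, s, t⟩ h
      rw [mem_tri hN] at h
      obtain ⟨-, -, -, h1, h2, h3⟩ := h
      obtain ⟨s', rfl⟩ : ∃ s', s = r + 2 * s' := ⟨(s - r) / 2, by omega⟩
      obtain ⟨t', rfl⟩ : ∃ t', t = r + 2 * t' := ⟨(t - r) / 2, by omega⟩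
      rcases Int.emod_two_eq_zero_or_one r with hr | hr
      · obtain ⟨r', rfl⟩ : ∃ r', r = 2 * r' := ⟨r / 2, by omega⟩
        ring_nf at h3
        omega
      · obtain ⟨r', rfl⟩ : ∃ r', r = 2 * r' + 1 := ⟨r / 2, by omega⟩
        ring_nf at h3
        omega
    rw [hurwitzH, if_neg hN.ne', if_neg (fun h => h4 h.2), triCount, h0]
    simp

end ArcsinSum

namespace ArcsinSum

open Finset

lemma hurwitzH_of_neg {n : ℤ} (hn : n < 0) : hurwitzH n = 0 := by
  rw [hurwitzH, if_neg hn.ne, if_neg (by omega)]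

lemma sum_dpairs_max (m : ℤ) :
    ∑ x ∈ dpairs m, max x.1 x.2 = 2 * ∑ x ∈ dpairs m, x.2 - ∑ x ∈ dpairs m, min x.1 x.2 := by
  have h : ∑ x ∈ dpairs m, x.1 = ∑ x ∈ dpairs m, x.2 :=
    sum_dpairs_swap m fun a _ => a
  have h' : ∑ x ∈ dpairs m, (max x.1 x.2 + min x.1 x.2) = ∑ x ∈ dpairs m, (x.1 + x.2) :=
    sum_congr rfl fun x _ => max_add_min _ _
  rw [sum_add_distrib, sum_add_distrib] at h'
  linarith

lemma card_sq_eq {B N : ℤ} (hB : N ≤ B) {k : ℤ} (hk : 0 < k) (hkN : k ^ 2 = N) :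
    (Icc (-B) B).filter (fun w => w ^ 2 = N) = {k, -k} := by
  ext w
  simp only [mem_filter, mem_Icc, mem_insert, mem_singleton]
  rw [← hkN, sq_eq_sq_iff_eq_or_eq_neg]
  have : k ≤ k ^ 2 := by nlinarith
  constructor
  · exact fun h => h.2
  · rintro (rfl | rfl)
    · exact ⟨by omega, Or.inl rfl⟩
    · exact ⟨by omega, Or.inr rfl⟩

lemma sum_dpairs_diag {m B : ℤ} (hm : 0 < m) (hB : 4 * m ≤ B) :
    2 * ∑ x ∈ dpairs m, (if x.1 = x.2 then (1 : ℤ) else 0) =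
      #((Icc (-B) B).filter fun w => w ^ 2 = 4 * m) := by
  rw [← sum_filter, sum_const, nsmul_eq_mul, mul_one]
  by_cases h : ∃ k, 0 < k ∧ k ^ 2 = m
  · obtain ⟨k, hk, rfl⟩ := h
    rw [card_sq_eq hB (k := 2 * k) (by omega) (by ring), card_pair (by omega)]
    have : (dpairs (k ^ 2)).filter (fun x => x.1 = x.2) = {(k, k)} := by
      ext ⟨d, e⟩
      simp only [mem_filter, mem_dpairs, mem_singleton, Prod.mk.injEq]
      constructor
      · rintro ⟨⟨h1, h2, h3⟩, rfl⟩
        have : d = k := by nlinarith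
        exact ⟨this, this⟩
      · rintro ⟨rfl, rfl⟩
        exact ⟨⟨hk, hk, by ring⟩, rfl⟩
    rw [this]
    rfl
  · have e1 : (dpairs m).filter (fun x => x.1 = x.2) = ∅ := by
      refine filter_eq_empty_iff.2 ?_
      rintro ⟨d, e⟩ h1 h2
      obtain rfl : d = e := h2
      rw [mem_dpairs] at h1
      exact h ⟨d, h1.1, by rw [← h1.2.2]; ring⟩
    have e2 : (Icc (-B) B).filter (fun w => w ^ 2 = 4 * m) = ∅ := by
      refine filter_eq_empty_iff.2 ?_
      intro w _ hw
      have h2 : Even w := by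
        have : Even (w ^ 2) := ⟨2 * m, by rw [hw]; ring⟩
        exact (Int.even_pow.1 this).1
      obtain ⟨k, rfl⟩ := h2
      refine h ⟨|k|, ?_, ?_⟩
      · rw [abs_pos]; rintro rfl; simp at hw; omega
      · rw [sq_abs]; linarith
    rw [e1, e2]
    rfl

/-- The Kronecker–Hurwitz class number relation. -/
lemma kronecker_hurwitz {m B : ℤ} (hm : 0 < m) (hB : 4 * m ≤ B) :
    ∑ w ∈ Icc (-B) B, hurwitzH (4 * m - w ^ 2) = ((∑ x ∈ dpairs m, max x.1 x.2 : ℤ) : ℝ) := by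
  have hsplit : ∑ w ∈ Icc (-B) B, hurwitzH (4 * m - w ^ 2) =
      ∑ w ∈ traces m, hurwitzH (4 * m - w ^ 2) +
      ∑ w ∈ (Icc (-B) B).filter (fun w => w ^ 2 = 4 * m), hurwitzH (4 * m - w ^ 2) := by
    have e : traces m = (Icc (-B) B).filter fun w => w ^ 2 < 4 * m := by
      ext w
      simp only [mem_traces, mem_filter, mem_Icc, iff_and_self]
      intro h
      constructor <;> nlinarith [sq_nonneg (w - 1), sq_nonneg (w + 1)]
    rw [e, sum_filter, sum_filter, ← sum_add_distrib]
    refine sum_congr rfl fun w _ => ?_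
    rcases lt_trichotomy (w ^ 2) (4 * m) with h | h | h
    · simp [h, h.ne]
    · simp [h]
    · simp [h.not_gt, h.ne', hurwitzH_of_neg (show 4 * m - w ^ 2 < 0 by omega)]
  have e1 : 6 * ∑ w ∈ traces m, hurwitzH (4 * m - w ^ 2) =
      ((∑ w ∈ traces m, triCount (4 * m - w ^ 2) : ℤ) : ℝ) := by
    rw [mul_sum, Int.cast_sum]
    refine sum_congr rfl fun w hw => six_mul_hurwitzH ?_
    rw [mem_traces] at hw
    omega
  have e2 : ∑ w ∈ (Icc (-B) B).filter (fun w => w ^ 2 = 4 * m), hurwitzH (4 * m - w ^ 2) =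
      -(1 / 12) * (#((Icc (-B) B).filter fun w => w ^ 2 = 4 * m) : ℝ) := by
    rw [sum_congr rfl (g := fun _ => -(1 / 12)), sum_const, nsmul_eq_mul, mul_comm]
    intro w hw
    rw [mem_filter] at hw
    rw [hw.2, sub_self, hurwitzH, if_pos rfl]
  have e3 := sum_dpairs_diag hm hB
  have e4 := sum_triCount hm
  have e5 := sum_dpairs_max m
  have e3' : 2 * ((∑ x ∈ dpairs m, (if x.1 = x.2 then (1 : ℤ) else 0) : ℤ) : ℝ) =
      (#((Icc (-B) B).filter fun w => w ^ 2 = 4 * m) : ℝ) := by exact_mod_cast e3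
  rw [hsplit, e2, ← e3', e5]
  rw [e4] at e1
  push_cast at e1 ⊢
  linarith

/-- The indefinite forms `[a, b, c]` of discriminant `D` with `a < 0 < c`. -/
noncomputable def mixedForms (D : ℤ) : Finset (ℤ × ℤ × ℤ) :=
  (Icc (-D) D ×ˢ Icc (-D) D ×ˢ Icc (-D) D).filter fun Q =>
    Q.2.1 ^ 2 - 4 * Q.1 * Q.2.2 = D ∧ Q.1 < 0 ∧ 0 < Q.2.2

lemma mem_mixedForms {D : ℤ} {Q : ℤ × ℤ × ℤ} : Q ∈ mixedForms D ↔
    Q.2.1 ^ 2 - 4 * Q.1 * Q.2.2 = D ∧ Q.1 < 0 ∧ 0 < Q.2.2 := by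
  obtain ⟨a, b, c⟩ := Q
  simp only [mixedForms, mem_filter, mem_product, mem_Icc, and_iff_right_iff_imp]
  rintro ⟨h1, h2, h3⟩
  have h4 : c ≤ -a * c := by nlinarith
  have h5 : -a ≤ -a * c := by nlinarith
  have h6 : b ≤ b ^ 2 := by nlinarith [sq_nonneg (b - 1), sq_nonneg b, Int.le_self_sq b]
  have h7 : -b ≤ b ^ 2 := by have := Int.le_self_sq (-b); rwa [neg_sq] at this
  have h8 := sq_nonneg b
  have h9 : b ^ 2 + 4 * (-a * c) = D := by linarith
  refine ⟨⟨?_, ?_⟩, ⟨?_, ?_⟩, ?_, ?_⟩ <;> linarith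

lemma hurwitz_support_subset (D : ℤ) :
    {p : ℤ × ℤ | p.1 % 2 = D % 2 ∧ hurwitzH (D - p.1 ^ 2 - p.2 ^ 2) ≠ 0} ⊆
      ((Icc (-D) D).filter (fun x => x % 2 = D % 2) ×ˢ Icc (-D) D : Finset (ℤ × ℤ)) := by
  rintro ⟨x, w⟩ ⟨h1, h2⟩
  have h : 0 ≤ D - x ^ 2 - w ^ 2 := by
    by_contra h
    exact h2 (hurwitzH_of_neg (not_le.1 h))
  have hx := Int.le_self_sq x
  have hx' := Int.le_self_sq (-x)
  have hw := Int.le_self_sq w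
  have hw' := Int.le_self_sq (-w)
  rw [neg_sq] at hx' hw'
  have hx2 := sq_nonneg x
  have hw2 := sq_nonneg w
  simp only [coe_product, coe_filter, Set.mem_prod, Set.mem_ofPred_eq, mem_coe, mem_Icc]
  exact ⟨⟨⟨by omega, by omega⟩, h1⟩, by omega, by omega⟩

lemma hurwitz_support_finite (D : ℤ) :
    ({p : ℤ × ℤ | p.1 % 2 = D % 2 ∧ hurwitzH (D - p.1 ^ 2 - p.2 ^ 2) ≠ 0}).Finite :=
  (Finset.finite_toSet _).subset (hurwitz_support_subset D)

lemma four_dvd_sub_sq {D x : ℤ} (hD : D % 4 = 0 ∨ D % 4 = 1) (hx : x % 2 = D % 2) :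
    4 * ((D - x ^ 2) / 4) = D - x ^ 2 := by
  rcases Int.emod_two_eq_zero_or_one x with h | h
  · obtain ⟨y, rfl⟩ : ∃ y, x = 2 * y := ⟨x / 2, by omega⟩
    ring_nf at *
    omega
  · obtain ⟨y, rfl⟩ : ∃ y, x = 2 * y + 1 := ⟨x / 2, by omega⟩
    ring_nf at *
    omega

lemma sum_hurwitz_fiber {D x : ℤ} (hD0 : 0 < D) (hD : D % 4 = 0 ∨ D % 4 = 1)
    (hx : x % 2 = D % 2) :
    ∑ w ∈ Icc (-D) D, hurwitzH (D - x ^ 2 - w ^ 2) =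
      (if x ^ 2 < D then ((∑ y ∈ dpairs ((D - x ^ 2) / 4), max y.1 y.2 : ℤ) : ℝ) else 0) +
      if x ^ 2 = D then -(1 / 12) else 0 := by
  have h4 := four_dvd_sub_sq hD hx
  rcases lt_trichotomy (x ^ 2) D with h | h | h
  · rw [if_pos h, if_neg h.ne, add_zero,
      ← kronecker_hurwitz (m := (D - x ^ 2) / 4) (B := D) (by omega)
        (by nlinarith [sq_nonneg x]), h4]
  · rw [if_neg h.not_lt, if_pos h, zero_add, sum_eq_single_of_mem 0 (by simp; omega)]
    · rw [h, hurwitzH, if_pos (by ring)]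
    · intro w _ hw
      have : 0 < w ^ 2 := by positivity
      exact hurwitzH_of_neg (by omega)
  · rw [if_neg h.not_gt, if_neg h.ne', zero_add]
    refine sum_eq_zero fun w _ => hurwitzH_of_neg ?_
    have := sq_nonneg w
    omega

lemma finsum_hurwitz {D : ℤ} (hD0 : 0 < D) (hD : D % 4 = 0 ∨ D % 4 = 1) :
    ∑ᶠ p ∈ {p : ℤ × ℤ | p.1 % 2 = D % 2}, hurwitzH (D - p.1 ^ 2 - p.2 ^ 2) =
      ((∑ Q ∈ mixedForms D, max (-Q.1) Q.2.2 : ℤ) : ℝ) - if IsSquare D then 1 / 6 else 0 := by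
  rw [finsum_mem_eq_sum_of_inter_support_eq
    (t := (Icc (-D) D).filter (fun x => x % 2 = D % 2) ×ˢ Icc (-D) D)]
  · rw [sum_product]
    rw [sum_congr rfl fun x hx => sum_hurwitz_fiber hD0 hD (mem_filter.1 hx).2, sum_add_distrib,
      sub_eq_add_neg]
    congr 1
    · rw [← sum_filter, ← Int.cast_sum, sum_sigma']
      congr 1
      refine sum_nbij' (fun z => (-z.2.1, z.1, z.2.2)) (fun Q => ⟨Q.2.1, (-Q.1, Q.2.2)⟩)
        ?_ ?_ ?_ ?_ ?_
      · rintro ⟨x, d, e⟩ h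
        simp only [mem_sigma, mem_filter, mem_dpairs] at h
        obtain ⟨⟨⟨h1, h2⟩, h3⟩, h4, h5, h6⟩ := h
        have := four_dvd_sub_sq hD h2
        rw [mem_mixedForms]
        refine ⟨?_, by simpa using h4, h5⟩
        rw [← h6] at this
        linarith
      · rintro ⟨a, b, c⟩ h
        have hbox := (mem_filter.1 h).1
        simp only [mem_product] at hbox
        rw [mem_mixedForms] at h
        obtain ⟨h1, h2, h3⟩ := h
        simp only at h1 h2 h3
        have hac : (D - b ^ 2) / 4 = -a * c := by
          rw [← h1]
          have : b ^ 2 - 4 * a * c - b ^ 2 = 4 * (-a * c) := by ring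
          rw [this]
          omega
        have hpos : 0 < -a * c := mul_pos (by omega) h3
        simp only [mem_sigma, mem_filter, mem_dpairs]
        refine ⟨⟨⟨hbox.2.1, ?_⟩, by linarith⟩, by omega, h3, hac.symm⟩
        have : D % 2 = b ^ 2 % 2 := by
          rw [← h1, mul_assoc]; omega
        rw [this, sq, Int.mul_emod]
        rcases Int.emod_two_eq_zero_or_one b with h | h <;> simp [h]
      · rintro ⟨x, d, e⟩ _; simp
      · rintro ⟨a, b, c⟩ _; simp
      · rintro ⟨x, d, e⟩ _; simp
    · rw [← sum_filter, sum_const, filter_filter, nsmul_eq_mul]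
      split_ifs with h
      · obtain ⟨k, hk⟩ := h
        have hk0 : k ≠ 0 := by rintro rfl; omega
        have e : (Icc (-D) D).filter (fun x => x % 2 = D % 2 ∧ x ^ 2 = D) = {|k|, -|k|} := by
          rw [← card_sq_eq le_rfl (abs_pos.2 hk0) (N := D) (by rw [sq_abs, sq, hk])]
          refine filter_congr fun x _ => and_iff_right_of_imp ?_
          rintro rfl
          rw [sq, Int.mul_emod]
          rcases Int.emod_two_eq_zero_or_one x with h | h <;> simp [h]
        rw [e, card_pair (by have := abs_pos.2 hk0; omega)]
        norm_num
      · have e : (Icc (-D) D).filter (fun x => x % 2 = D % 2 ∧ x ^ 2 = D) = ∅ := by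
          refine filter_eq_empty_iff.2 ?_
          rintro x _ ⟨_, hx⟩
          exact h ⟨x, by rw [← hx, sq]⟩
        rw [e]
        simp
  · ext p
    simp only [Set.mem_inter_iff, Set.mem_ofPred_eq, Function.mem_support, mem_coe]
    refine and_congr_left fun h => ⟨fun h' => ?_, fun h' => ?_⟩
    · exact hurwitz_support_subset D ⟨h', h⟩
    · exact (mem_filter.1 (mem_product.1 h').1).2

end ArcsinSum

namespace ArcsinSum

open Finset MeasureTheory Set Filter Topology
open scoped Real

/-! ### Integrals against `(1 + x²)⁻²` -/

/-- The kernel `(1 + x²)⁻²`. -/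
noncomputable def kern (x : ℝ) : ℝ := ((1 + x ^ 2) ^ 2)⁻¹

lemma kern_nonneg (x : ℝ) : 0 ≤ kern x := by unfold kern; positivity

lemma continuous_kern : Continuous kern := by
  unfold kern
  exact Continuous.inv₀ (by fun_prop) fun x => by positivity

/-- A primitive of `(a x² + b x + c) kern x`. -/
noncomputable def kernPrim (a b c x : ℝ) : ℝ :=
  (a + c) / 2 * Real.arctan x + ((c - a) * x - b) / (2 * (1 + x ^ 2))

lemma hasDerivAt_kernPrim (a b c x : ℝ) :
    HasDerivAt (kernPrim a b c) ((a * x ^ 2 + b * x + c) * kern x) x := by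
  have h1 : (2 * (1 + x ^ 2)) ≠ 0 := by positivity
  have h2 : HasDerivAt (fun x : ℝ => (c - a) * x - b) (c - a) x := by
    simpa using ((hasDerivAt_id x).const_mul (c - a)).sub_const b
  have h3 : HasDerivAt (fun x : ℝ => 2 * (1 + x ^ 2)) (2 * (2 * x)) x := by
    simpa using ((hasDerivAt_pow 2 x).const_add 1).const_mul 2
  have h := ((Real.hasDerivAt_arctan x).const_mul ((a + c) / 2)).add (h2.div h3 h1)
  refine h.congr_deriv ?_
  have h4 : (1 + x ^ 2) ≠ 0 := by positivity
  unfold kern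
  field_simp
  ring

/-- Values of the primitive at a root of the quadratic polynomial. -/
lemma kernPrim_root {a b c r : ℝ} (h : a * r ^ 2 + b * r + c = 0) :
    kernPrim a b c r = (a + c) / 2 * Real.arctan r - (a * r + b / 2) + (a * r) / 2 := by
  have h4 : (1 + r ^ 2) ≠ 0 := by positivity
  have : c = -(a * r ^ 2 + b * r) := by linarith
  subst this
  unfold kernPrim
  field_simp
  ring

lemma tendsto_kernPrim_atTop (a b c : ℝ) :
    Tendsto (kernPrim a b c) atTop (𝓝 ((a + c) / 2 * (π / 2))) := by
  have h1 : Tendsto (fun x : ℝ => ((c - a) * x - b) / (2 * (1 + x ^ 2))) atTop (𝓝 0) := by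
    have e : (fun x : ℝ => ((c - a) * x - b) / (2 * (1 + x ^ 2))) =
        fun x => ((Polynomial.C (c - a) * Polynomial.X - Polynomial.C b).eval x) /
          ((Polynomial.C 2 * (1 + Polynomial.X ^ 2) : Polynomial ℝ).eval x) := by
      ext x; simp
    rw [e]
    apply Polynomial.div_tendsto_atTop_zero_of_degree_lt
    have e2 : (Polynomial.C 2 * (1 + Polynomial.X ^ 2) : Polynomial ℝ).degree = 2 := by
      compute_degree!
    rw [e2]
    refine lt_of_le_of_lt (b := 1) ?_ (by norm_num)
    compute_degree
  have h2 := ((Real.tendsto_arctan_atTop.mono_right nhdsWithin_le_nhds).const_mul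
    ((a + c) / 2)).add h1
  rw [add_zero] at h2
  exact h2

/-- The summand of the series, for a real quadratic polynomial. -/
noncomputable def arcsinTerm (a b c : ℝ) : ℝ :=
  √(b ^ 2 - 4 * a * c) -
    |a + c| * Real.arcsin (√(b ^ 2 - 4 * a * c) / √((a - c) ^ 2 + b ^ 2))

lemma arcsinTerm_eq_arctan {a b c : ℝ} (hD : 0 < b ^ 2 - 4 * a * c) :
    arcsinTerm a b c = √(b ^ 2 - 4 * a * c) -
      |a + c| * Real.arctan (√(b ^ 2 - 4 * a * c) / |a + c|) := by
  rcases eq_or_ne (a + c) 0 with h | h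
  · simp [arcsinTerm, h]
  · rw [arcsinTerm, Real.arctan_eq_arcsin]
    have h0 : 0 < |a + c| := abs_pos.2 h
    have h1 : 1 + (√(b ^ 2 - 4 * a * c) / |a + c|) ^ 2 =
        ((a - c) ^ 2 + b ^ 2) / |a + c| ^ 2 := by
      rw [div_pow, Real.sq_sqrt hD.le, sq_abs]
      field_simp
      ring
    rw [h1, Real.sqrt_div' _ (by positivity), Real.sqrt_sq h0.le, div_div_div_cancel_right₀ h0.ne']

lemma arctan_le_self {x : ℝ} (hx : 0 ≤ x) : Real.arctan x ≤ x := by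
  rcases hx.eq_or_lt with rfl | hx
  · simp
  · have h1 := Real.arctan_pos.2 hx
    have h2 := Real.lt_tan h1 (Real.arctan_lt_pi_div_two x)
    rw [Real.tan_arctan] at h2
    exact h2.le

lemma arcsinTerm_nonneg {a b c : ℝ} (hD : 0 < b ^ 2 - 4 * a * c) : 0 ≤ arcsinTerm a b c := by
  rw [arcsinTerm_eq_arctan hD]
  rcases eq_or_ne (a + c) 0 with h | h
  · simp [h]
  · have h0 : 0 < |a + c| := abs_pos.2 h
    have := mul_le_mul_of_nonneg_left
      (arctan_le_self (x := √(b ^ 2 - 4 * a * c) / |a + c|) (by positivity)) h0.le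
    rw [mul_div_cancel₀ _ h0.ne'] at this
    linarith

/-- The difference of the arctangents of the two roots. -/
lemma arctan_roots {a c r₁ r₂ s : ℝ} (ha : a < 0) (hs : 0 < s) (hsub : a * (r₂ - r₁) = -s)
    (hmul : a * (r₁ * r₂) = c) :
    (a + c) / 2 * (Real.arctan r₂ - Real.arctan r₁) =
      1 / 2 * (π * max (a + c) 0 - |a + c| * Real.arctan (s / |a + c|)) := by
  have key : (r₂ + -r₁) / (1 - r₂ * -r₁) = -s / (a + c) := by
    rw [← hmul, ← hsub, show a + a * (r₁ * r₂) = a * (1 - r₂ * -r₁) by ring,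
      show r₂ + -r₁ = r₂ - r₁ by ring, mul_div_mul_left _ _ ha.ne]
  rcases lt_trichotomy (a + c) 0 with h | h | h
  · have h1 : r₂ * -r₁ < 1 := by
      rw [← hmul] at h
      nlinarith
    have h2 := Real.arctan_add h1
    rw [key, Real.arctan_neg] at h2
    rw [max_eq_right h.le, abs_of_neg h, sub_eq_add_neg, h2, neg_div, div_neg]
    ring
  · simp [h]
  · have h1 : 1 < r₂ * -r₁ := by
      rw [← hmul] at h
      nlinarith
    have h3 : 0 < r₂ := by
      by_contra h3
      have : 0 < r₂ - r₁ := by nlinarith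
      nlinarith
    have h2 := Real.arctan_add_eq_add_pi h1 h3
    rw [key, Real.arctan_neg] at h2
    rw [max_eq_left h.le, abs_of_pos h, sub_eq_add_neg, h2, neg_div, Real.arctan_neg]
    ring

lemma lintegral_posPart_kern {a b c : ℝ} (ha : a < 0) (hD : 0 < b ^ 2 - 4 * a * c) :
    ∫⁻ x, ENNReal.ofReal (a * x ^ 2 + b * x + c) * ENNReal.ofReal (kern x) =
      ENNReal.ofReal (1 / 2 * (arcsinTerm a b c + π * max (a + c) 0)) := by
  set s := √(b ^ 2 - 4 * a * c) with hs
  have hs0 : 0 < s := Real.sqrt_pos.2 hD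
  have hs2 : s ^ 2 = b ^ 2 - 4 * a * c := Real.sq_sqrt hD.le
  set r₁ := (-b + s) / (2 * a) with hr₁
  set r₂ := (-b - s) / (2 * a) with hr₂
  have e1 : 2 * a * r₁ = -b + s := mul_div_cancel₀ _ (mul_ne_zero two_ne_zero ha.ne)
  have e2 : 2 * a * r₂ = -b - s := mul_div_cancel₀ _ (mul_ne_zero two_ne_zero ha.ne)
  have hsub : a * (r₂ - r₁) = -s := by linarith
  have hle : r₁ ≤ r₂ := by nlinarith
  have hfac : ∀ x, 4 * a * (a * x ^ 2 + b * x + c) = (2 * a * (x - r₁)) * (2 * a * (x - r₂)) := by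
    intro x
    rw [mul_sub, mul_sub, e1, e2]
    linear_combination hs2
  have hfac' : ∀ x, a * x ^ 2 + b * x + c = a * ((x - r₁) * (x - r₂)) := by
    intro x
    refine mul_left_cancel₀ (show 4 * a ≠ 0 by linarith) ?_
    rw [hfac]; ring
  have hroot1 : a * r₁ ^ 2 + b * r₁ + c = 0 := by rw [hfac']; simp
  have hroot2 : a * r₂ ^ 2 + b * r₂ + c = 0 := by rw [hfac']; simp
  have hmul : a * (r₁ * r₂) = c := by have := hfac' 0; simp at this; linarith
  have hind : (fun x => ENNReal.ofReal (a * x ^ 2 + b * x + c) * ENNReal.ofReal (kern x)) =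
      (Icc r₁ r₂).indicator fun x => ENNReal.ofReal ((a * x ^ 2 + b * x + c) * kern x) := by
    ext x
    by_cases hx : x ∈ Icc r₁ r₂
    · rw [indicator_of_mem hx, ENNReal.ofReal_mul]
      rw [hfac']
      exact mul_nonneg_of_nonpos_of_nonpos ha.le
        (mul_nonpos_of_nonneg_of_nonpos (by linarith [hx.1]) (by linarith [hx.2]))
    · rw [indicator_of_notMem hx, ENNReal.ofReal_of_nonpos, zero_mul]
      rw [hfac']
      refine mul_nonpos_of_nonpos_of_nonneg ha.le ?_
      by_contra h
      refine hx ⟨?_, ?_⟩ <;> by_contra h' <;> nlinarith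
  have hcont : Continuous fun x => (a * x ^ 2 + b * x + c) * kern x :=
    Continuous.mul (by fun_prop) continuous_kern
  rw [hind, lintegral_indicator measurableSet_Icc, ← ofReal_integral_eq_lintegral_ofReal
    (hcont.integrableOn_Icc)]
  · rw [integral_Icc_eq_integral_Ioc, ← intervalIntegral.integral_of_le hle,
      intervalIntegral.integral_eq_sub_of_hasDerivAt (fun x _ => hasDerivAt_kernPrim a b c x)
        (hcont.intervalIntegrable _ _), kernPrim_root hroot1, kernPrim_root hroot2]
    congr 1
    have := arctan_roots ha hs0 hsub hmul
    rw [arcsinTerm_eq_arctan hD, ← hs]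
    linarith
  · rw [EventuallyLE, ae_restrict_iff' measurableSet_Icc]
    refine ae_of_all _ fun x hx => mul_nonneg ?_ (kern_nonneg x)
    rw [hfac']
    exact mul_nonneg_of_nonpos_of_nonpos ha.le
      (mul_nonpos_of_nonneg_of_nonpos (by linarith [hx.1]) (by linarith [hx.2]))

lemma integrableOn_Ioi_kern {a b c r : ℝ} (h : ∀ x ∈ Ioi r, 0 ≤ a * x ^ 2 + b * x + c) :
    IntegrableOn (fun x => (a * x ^ 2 + b * x + c) * kern x) (Ioi r) :=
  integrableOn_Ioi_deriv_of_nonneg' (fun x _ => hasDerivAt_kernPrim a b c x)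
    (fun x hx => mul_nonneg (h x hx) (kern_nonneg x)) (tendsto_kernPrim_atTop a b c)

lemma integral_Ioi_kern {a b c r : ℝ} (h : ∀ x ∈ Ioi r, 0 ≤ a * x ^ 2 + b * x + c) :
    ∫ x in Ioi r, (a * x ^ 2 + b * x + c) * kern x = (a + c) / 2 * (π / 2) - kernPrim a b c r :=
  integral_Ioi_of_hasDerivAt_of_tendsto' (fun x _ => hasDerivAt_kernPrim a b c x)
    (integrableOn_Ioi_kern h) (tendsto_kernPrim_atTop a b c)

end ArcsinSum

namespace ArcsinSum

open MeasureTheory Set Filter Topology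
open scoped Real

lemma lintegral_comp_abs (f : ℝ → ENNReal) :
    ∫⁻ x, f |x| = 2 * ∫⁻ x in Ioi (0 : ℝ), f x := by
  have h1 : ∫⁻ x in Ioi (0 : ℝ), f |x| = ∫⁻ x in Ioi (0 : ℝ), f x :=
    setLIntegral_congr_fun measurableSet_Ioi fun x hx => by rw [abs_of_pos hx]
  have h2 : ∫⁻ x in Iio (0 : ℝ), f |x| = ∫⁻ x in Ioi (0 : ℝ), f |x| := by
    rw [← lintegral_indicator measurableSet_Iio, ← lintegral_indicator measurableSet_Ioi,
      ← lintegral_neg_eq_self]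
    refine lintegral_congr fun x => ?_
    by_cases hx : 0 < x
    · rw [indicator_of_mem (show -x ∈ Iio 0 by simpa using hx),
        indicator_of_mem (show x ∈ Ioi 0 from hx), abs_neg]
    · rw [indicator_of_notMem (show -x ∉ Iio 0 by simpa using hx),
        indicator_of_notMem (show x ∉ Ioi 0 from hx)]
  rw [← lintegral_add_compl _ (measurableSet_Ioi (a := (0 : ℝ))), compl_Ioi,
    ← restrict_Iio_eq_restrict_Iic, h2, h1, two_mul]

lemma lintegral_abs_kern {k c : ℝ} (hk : 0 < k) :
    ∫⁻ x, ENNReal.ofReal (k * |x| - |c|) * ENNReal.ofReal (kern x) =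
      ENNReal.ofReal (arcsinTerm 0 k c) := by
  have hev : ∀ x, kern |x| = kern x := fun x => by simp [kern]
  have h0 := lintegral_comp_abs fun x => ENNReal.ofReal (k * x - |c|) * ENNReal.ofReal (kern x)
  simp only [hev] at h0
  rw [h0]
  set r := |c| / k with hr
  have hr0 : 0 ≤ r := by positivity
  have hkr : k * r = |c| := mul_div_cancel₀ _ hk.ne'
  have hnn : ∀ x ∈ Ioi r, 0 ≤ 0 * x ^ 2 + k * x + -|c| := by
    intro x hx
    have := mul_lt_mul_of_pos_left (mem_Ioi.1 hx) hk
    linarith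
  have h1 : ∫⁻ x in Ioi (0 : ℝ), ENNReal.ofReal (k * x - |c|) * ENNReal.ofReal (kern x) =
      ∫⁻ x in Ioi r, ENNReal.ofReal ((0 * x ^ 2 + k * x + -|c|) * kern x) := by
    rw [← lintegral_indicator measurableSet_Ioi, ← lintegral_indicator measurableSet_Ioi]
    refine lintegral_congr fun x => ?_
    by_cases hx : r < x
    · rw [indicator_of_mem (show x ∈ Ioi 0 from hr0.trans_lt hx),
        indicator_of_mem (show x ∈ Ioi r from hx), ENNReal.ofReal_mul (hnn x hx)]
      congr 2
      ring
    · rw [indicator_of_notMem (show x ∉ Ioi r from hx)]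
      have : k * x - |c| ≤ 0 := by
        have := mul_le_mul_of_nonneg_left (not_lt.1 hx) hk.le
        linarith
      by_cases h : 0 < x
      · rw [indicator_of_mem (show x ∈ Ioi 0 from h), ENNReal.ofReal_of_nonpos this, zero_mul]
      · rw [indicator_of_notMem (show x ∉ Ioi 0 from h)]
  rw [h1, ← ofReal_integral_eq_lintegral_ofReal (integrableOn_Ioi_kern hnn),
    integral_Ioi_kern hnn, kernPrim_root (by rw [hkr]; ring),
    show (2 : ENNReal) = ENNReal.ofReal 2 by simp, ← ENNReal.ofReal_mul (by norm_num)]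
  · congr 1
    have hD : 0 < k ^ 2 - 4 * 0 * c := by simp; positivity
    rw [arcsinTerm_eq_arctan hD]
    simp only [mul_zero, zero_mul, sub_zero, zero_add, Real.sqrt_sq hk.le]
    rcases eq_or_ne c 0 with rfl | hc
    · simp
      ring
    · have hc' : 0 < |c| := abs_pos.2 hc
      have := Real.arctan_inv_of_pos (x := |c| / k) (by positivity)
      rw [inv_div] at this
      rw [this]
      ring
  · rw [EventuallyLE, ae_restrict_iff' measurableSet_Ioi]
    exact ae_of_all _ fun x hx => mul_nonneg (hnn x hx) (kern_nonneg x)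

lemma kern_le (x : ℝ) : kern x ≤ (1 + x ^ 2)⁻¹ := by
  unfold kern
  gcongr
  nlinarith [sq_nonneg x]

lemma integrable_kern : Integrable kern :=
  integrable_inv_one_add_sq.mono' continuous_kern.aestronglyMeasurable
    (ae_of_all _ fun x => by rw [Real.norm_of_nonneg (kern_nonneg x)]; exact kern_le x)

lemma integrable_sq_mul_kern : Integrable fun x => x ^ 2 * kern x := by
  refine integrable_inv_one_add_sq.mono'
    ((continuous_pow 2).mul continuous_kern).aestronglyMeasurable
    (ae_of_all _ fun x => ?_)
  rw [Real.norm_of_nonneg (mul_nonneg (sq_nonneg x) (kern_nonneg x)), kern]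
  have : 0 < 1 + x ^ 2 := by positivity
  rw [← div_eq_mul_inv, div_le_iff₀ (by positivity), sq (1 + x ^ 2), ← mul_assoc,
    inv_mul_cancel₀ this.ne']
  linarith

lemma integral_even_kern {p q : ℝ} (hp : 0 ≤ p) (hq : 0 ≤ q) :
    ∫ x, (p * x ^ 2 + q) * kern x = (p + q) * (π / 2) := by
  have hev : ∀ x, kern |x| = kern x := fun x => by simp [kern]
  have h := integral_comp_abs (f := fun x => (p * x ^ 2 + 0 * x + q) * kern x)
  simp only [sq_abs, zero_mul, add_zero, hev] at h
  rw [h]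
  have h2 := integral_Ioi_kern (a := p) (b := 0) (c := q) (r := 0)
    (fun x _ => by nlinarith [mul_nonneg hp (sq_nonneg x)])
  simp only [zero_mul, add_zero] at h2
  rw [h2]
  simp [kernPrim]
  ring

/-- The periodic second Bernoulli polynomial. -/
noncomputable def bern2 (y : ℝ) : ℝ := Int.fract y ^ 2 - Int.fract y + 1 / 6

lemma measurable_bern2 : Measurable bern2 := by
  unfold bern2
  exact ((measurable_fract.pow_const 2).sub measurable_fract).add_const _

lemma abs_bern2_le (y : ℝ) : |bern2 y| ≤ 1 := by
  have h1 := Int.fract_nonneg y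
  have h2 := (Int.fract_lt_one y).le
  rw [bern2, abs_le]
  constructor <;> nlinarith

lemma bern2_add_int (y : ℝ) (m : ℤ) : bern2 (y + m) = bern2 y := by
  rw [bern2, Int.fract_add_intCast, bern2]

lemma bern2_neg (y : ℝ) : bern2 (-y) = bern2 y := by
  rcases eq_or_ne (Int.fract y) 0 with h | h
  · rw [bern2, bern2, Int.fract_neg_eq_zero.2 h, h]
  · rw [bern2, bern2, Int.fract_neg h]
    ring

lemma bern2_abs (y : ℝ) : bern2 |y| = bern2 y := by
  rcases abs_choice y with h | h <;> rw [h]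
  exact bern2_neg y

lemma tsum_nat_posPart {y : ℝ} (hy : 0 ≤ y) :
    ∑' j : ℕ, ENNReal.ofReal (y - (j + 1)) =
      ENNReal.ofReal (1 / 2 * (y ^ 2 - y) - 1 / 2 * bern2 y + 1 / 12) := by
  have h1 := Nat.floor_le hy
  have h2 := Nat.lt_floor_add_one y
  rw [tsum_eq_sum (s := Finset.range ⌊y⌋₊), ← ENNReal.ofReal_sum_of_nonneg]
  · congr 1
    have h3 : ∀ n : ℕ, ∑ j ∈ Finset.range n, (y - ((j : ℝ) + 1)) = n * y - n * (n + 1) / 2 := by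
      intro n
      induction n with
      | zero => simp
      | succ n ih => rw [Finset.sum_range_succ, ih]; push_cast; ring
    have h4 : Int.fract y = y - ⌊y⌋₊ := by
      rw [Int.fract, natCast_floor_eq_intCast_floor hy]
    rw [h3, bern2, h4]
    ring
  · intro j hj
    have h5 : (j : ℝ) + 1 ≤ ⌊y⌋₊ := by exact_mod_cast Finset.mem_range.1 hj
    linarith
  · intro j hj
    refine ENNReal.ofReal_of_nonpos ?_
    have h5 : (⌊y⌋₊ : ℝ) ≤ j := by exact_mod_cast not_lt.1 (fun h => hj (Finset.mem_range.2 h))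
    linarith

lemma tsum_int_neg (F : ℤ → ENNReal) :
    ∑' c : ℤ, (if c < 0 then F c else 0) = ∑' j : ℕ, F (-(j + 1)) := by
  rw [tsum_of_nat_of_neg_add_one ENNReal.summable ENNReal.summable]
  have h1 : ∀ n : ℕ, ¬ ((n : ℤ) < 0) := fun n => by omega
  have h2 : ∀ n : ℕ, -((n : ℤ) + 1) < 0 := fun n => by omega
  simp only [h1, h2, if_true, if_false, tsum_zero, zero_add]

/-- `∑_{c < 0} (y + c)⁺`. -/
lemma tsum_int_neg_posPart {y : ℝ} (hy : 0 ≤ y) :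
    ∑' c : ℤ, (if c < 0 then ENNReal.ofReal (y + c) else 0) =
      ENNReal.ofReal (1 / 2 * (y ^ 2 - y) - 1 / 2 * bern2 y + 1 / 12) := by
  rw [tsum_int_neg fun c => ENNReal.ofReal (y + c), ← tsum_nat_posPart hy]
  refine tsum_congr fun j => ?_
  push_cast
  ring_nf

lemma bern2_bound_nonneg {y : ℝ} (hy : 0 ≤ y) :
    0 ≤ 1 / 2 * (y ^ 2 - y) - 1 / 2 * bern2 y + 1 / 12 := by
  have h0 := Int.floor_nonneg.2 hy
  have h1 := Int.fract_nonneg y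
  have h2 := Int.floor_add_fract y
  have h3 : (⌊y⌋ : ℝ) ≤ ⌊y⌋ ^ 2 := by exact_mod_cast Int.le_self_sq _
  have h4 : (0 : ℝ) ≤ ⌊y⌋ := by exact_mod_cast h0
  rw [bern2]
  generalize Int.fract y = f at *
  generalize (⌊y⌋ : ℝ) = m at *
  subst h2
  nlinarith [mul_nonneg h4 h1]

lemma tsum_int_abs_posPart (t : ℝ) :
    ∑' c : ℤ, ENNReal.ofReal (|t| - |(c : ℝ)|) = ENNReal.ofReal (t ^ 2 + 1 / 6 - bern2 t) := by
  have ht := abs_nonneg t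
  have h1 : ∀ j : ℕ, |((-((j : ℤ) + 1) : ℤ) : ℝ)| = j + 1 := by
    intro j
    push_cast
    rw [abs_neg, abs_of_nonneg (by positivity)]
  have h2 : ∑' j : ℕ, ENNReal.ofReal (|t| - |((j : ℤ) : ℝ)|) =
      ENNReal.ofReal |t| + ∑' j : ℕ, ENNReal.ofReal (|t| - (j + 1)) := by
    rw [tsum_eq_zero_add' ENNReal.summable]
    congr 1
    · simp
    · refine tsum_congr fun j => ?_
      congr 2
      push_cast
      rw [abs_of_nonneg (by positivity)]
  rw [tsum_of_nat_of_neg_add_one ENNReal.summable ENNReal.summable, h2]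
  simp only [h1]
  rw [tsum_nat_posPart ht, ← ENNReal.ofReal_add ht (bern2_bound_nonneg ht),
    ← ENNReal.ofReal_add (by have := bern2_bound_nonneg ht; positivity) (bern2_bound_nonneg ht),
    bern2_abs, sq_abs]
  congr 1
  ring

end ArcsinSum

namespace ArcsinSum

open MeasureTheory Set Filter Topology
open scoped Real

/-- The discriminant of a binary quadratic form. -/
def disc (Q : ℤ × ℤ × ℤ) : ℤ := Q.2.1 ^ 2 - 4 * Q.1 * Q.2.2

/-- The value `Q(x, 1)`. -/
def qv (Q : ℤ × ℤ × ℤ) (x : ℝ) : ℝ := Q.1 * x ^ 2 + Q.2.1 * x + Q.2.2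

/-- The sum of `Q(x, 1)⁺` over a set of forms. -/
noncomputable def posSum (S : Set (ℤ × ℤ × ℤ)) (x : ℝ) : ENNReal :=
  ∑' Q : S, ENNReal.ofReal (qv Q x)

/-- Forms of discriminant `D` with negative leading coefficient. -/
def negForms (D : ℤ) : Set (ℤ × ℤ × ℤ) := {Q | disc Q = D ∧ Q.1 < 0}

lemma tsum_bijOn {α β : Type*} {S : Set α} {T : Set β} {e : α → β} (h : BijOn e S T)
    (F : β → ENNReal) : ∑' y : T, F y = ∑' x : S, F (e x) := by
  rw [← tsum_image F h.injOn, h.image_eq]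

lemma posSum_union {S T : Set (ℤ × ℤ × ℤ)} (h : Disjoint S T) (x : ℝ) :
    posSum (S ∪ T) x = posSum S x + posSum T x :=
  Summable.tsum_union_disjoint (f := fun Q => ENNReal.ofReal (qv Q x)) h ENNReal.summable
    ENNReal.summable

lemma continuous_qv (Q : ℤ × ℤ × ℤ) : Continuous (qv Q) := by
  unfold qv
  fun_prop

lemma measurable_posSum (S : Set (ℤ × ℤ × ℤ)) : Measurable (posSum S) := by
  unfold posSum
  exact Measurable.tsum fun Q => (continuous_qv Q).measurable.ennreal_ofReal

lemma posSum_negForms_add_one (D : ℤ) (x : ℝ) :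
    posSum (negForms D) (x + 1) = posSum (negForms D) x := by
  have h : BijOn (fun Q : ℤ × ℤ × ℤ => (Q.1, Q.2.1 + 2 * Q.1, Q.1 + Q.2.1 + Q.2.2))
      (negForms D) (negForms D) := by
    refine BijOn.mk ?_ ?_ ?_
    · rintro ⟨a, b, c⟩ ⟨h1, h2⟩
      refine ⟨?_, h2⟩
      simp only [disc] at h1 ⊢
      linarith
    · rintro ⟨a, b, c⟩ - ⟨a', b', c'⟩ - h
      simp only [Prod.mk.injEq] at h ⊢
      omega
    · rintro ⟨a, b, c⟩ ⟨h1, h2⟩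
      refine ⟨(a, b - 2 * a, a - b + c), ⟨?_, h2⟩, ?_⟩
      · simp only [disc] at h1 ⊢
        linarith
      · simp only [Prod.mk.injEq]
        refine ⟨trivial, ?_, ?_⟩ <;> ring
  rw [posSum, posSum, tsum_bijOn h fun Q => ENNReal.ofReal (qv Q x)]
  refine tsum_congr fun Q => ?_
  congr 1
  simp only [qv]
  push_cast
  ring

/-- Forms of discriminant `D` whose outer coefficients have the given signs. -/
def signForms (D s t : ℤ) : Set (ℤ × ℤ × ℤ) := {Q | disc Q = D ∧ Q.1.sign = s ∧ Q.2.2.sign = t}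

lemma negForms_eq (D : ℤ) : negForms D =
    signForms D (-1) (-1) ∪ (signForms D (-1) 0 ∪ signForms D (-1) 1) := by
  ext ⟨a, b, c⟩
  have := Int.sign_trichotomy c
  have h0 := Int.sign_eq_neg_one_iff_neg (a := a)
  simp only [negForms, signForms, mem_union, Set.mem_ofPred_eq, ← h0]
  tauto

lemma disjoint_signForms {D s t s' t' : ℤ} (h : s ≠ s' ∨ t ≠ t') :
    Disjoint (signForms D s t) (signForms D s' t') := by
  rw [Set.disjoint_left]
  rintro Q ⟨_, h1, h2⟩ ⟨_, h3, h4⟩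
  rcases h with h | h
  · exact h (h1.symm.trans h3)
  · exact h (h2.symm.trans h4)

lemma posSum_negForms_eq (D : ℤ) (x : ℝ) : posSum (negForms D) x =
    posSum (signForms D (-1) (-1)) x +
      (posSum (signForms D (-1) 0) x + posSum (signForms D (-1) 1) x) := by
  rw [negForms_eq, posSum_union, posSum_union]
  · exact disjoint_signForms (by norm_num)
  · exact Set.disjoint_union_right.2
      ⟨disjoint_signForms (by norm_num), disjoint_signForms (by norm_num)⟩

lemma posSum_signForms_inv (D s t : ℤ) {x : ℝ} (hx : 0 < x) :
    ENNReal.ofReal (x ^ 2) * posSum (signForms D s t) (1 / x) = posSum (signForms D t s) x := by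
  have h : BijOn (fun Q : ℤ × ℤ × ℤ => (Q.2.2, Q.2.1, Q.1)) (signForms D s t)
      (signForms D t s) := by
    refine BijOn.mk ?_ ?_ ?_
    · rintro ⟨a, b, c⟩ ⟨h1, h2, h3⟩
      refine ⟨?_, h3, h2⟩
      simp only [disc] at h1 ⊢
      linarith
    · rintro ⟨a, b, c⟩ - ⟨a', b', c'⟩ - h
      simp only [Prod.mk.injEq] at h ⊢
      tauto
    · rintro ⟨a, b, c⟩ ⟨h1, h2, h3⟩
      refine ⟨(c, b, a), ⟨?_, h3, h2⟩, rfl⟩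
      simp only [disc] at h1 ⊢
      linarith
  rw [posSum, posSum, tsum_bijOn h fun Q => ENNReal.ofReal (qv Q x), ← ENNReal.tsum_mul_left]
  refine tsum_congr fun Q => ?_
  rw [← ENNReal.ofReal_mul (by positivity)]
  congr 1
  simp only [qv]
  field_simp
  ring

lemma coe_mixedForms (D : ℤ) : (mixedForms D : Set (ℤ × ℤ × ℤ)) = signForms D (-1) 1 := by
  ext ⟨a, b, c⟩
  simp only [Finset.mem_coe, mem_mixedForms, signForms, disc, Set.mem_ofPred_eq,
    Int.sign_eq_neg_one_iff_neg, Int.sign_eq_one_iff_pos]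

lemma posSum_mixed (D : ℤ) (x : ℝ) : posSum (signForms D (-1) 1) x =
    ∑ Q ∈ mixedForms D, ENNReal.ofReal (qv Q x) := by
  rw [← coe_mixedForms, posSum,
    Finset.tsum_subtype' (mixedForms D) (fun Q => ENNReal.ofReal (qv Q x))]

lemma posSum_mixed_neg (D : ℤ) (x : ℝ) : posSum (signForms D 1 (-1)) x =
    ∑ Q ∈ mixedForms D, ENNReal.ofReal (-qv Q x) := by
  have h : BijOn (fun Q : ℤ × ℤ × ℤ => (-Q.1, -Q.2.1, -Q.2.2)) (signForms D (-1) 1)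
      (signForms D 1 (-1)) := by
    refine BijOn.mk ?_ ?_ ?_
    · rintro ⟨a, b, c⟩ ⟨h1, h2, h3⟩
      refine ⟨?_, by simp only [Int.sign_neg, h2]; rfl, by simp only [Int.sign_neg, h3]⟩
      simp only [disc] at h1 ⊢
      linarith
    · rintro ⟨a, b, c⟩ - ⟨a', b', c'⟩ - h
      simp only [Prod.mk.injEq] at h ⊢
      omega
    · rintro ⟨a, b, c⟩ ⟨h1, h2, h3⟩
      refine ⟨(-a, -b, -c), ⟨?_, by simp only [Int.sign_neg, h2],
        by simp only [Int.sign_neg, h3]; rfl⟩, by simp⟩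
      simp only [disc] at h1 ⊢
      linarith
  rw [posSum, tsum_bijOn h fun Q => ENNReal.ofReal (qv Q x), ← coe_mixedForms,
    Finset.tsum_subtype' (mixedForms D)
      (fun Q => ENNReal.ofReal (qv ((-Q.1, -Q.2.1, -Q.2.2)) x))]
  refine Finset.sum_congr rfl fun Q _ => ?_
  congr 1
  simp only [qv]
  push_cast
  ring

lemma sum_mixed_anti (D : ℤ) :
    ∑ Q ∈ mixedForms D, Q.1 = -∑ Q ∈ mixedForms D, Q.2.2 ∧ ∑ Q ∈ mixedForms D, Q.2.1 = 0 := by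
  have key : ∀ F : ℤ × ℤ × ℤ → ℤ, ∑ Q ∈ mixedForms D, F Q =
      ∑ Q ∈ mixedForms D, F (-Q.2.2, -Q.2.1, -Q.1) := by
    intro F
    have hm : ∀ Q ∈ mixedForms D, ((-Q.2.2, -Q.2.1, -Q.1) : ℤ × ℤ × ℤ) ∈ mixedForms D := by
      intro Q hQ
      rw [mem_mixedForms] at hQ ⊢
      refine ⟨?_, by simpa using hQ.2.2, by simpa using hQ.2.1⟩
      rw [← hQ.1]
      ring
    exact (Finset.sum_nbij' (fun Q => (-Q.2.2, -Q.2.1, -Q.1)) (fun Q => (-Q.2.2, -Q.2.1, -Q.1))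
      hm hm (by simp) (by simp) (by simp))
  constructor
  · rw [key fun Q => Q.1, ← Finset.sum_neg_distrib]
  · have := key fun Q => Q.2.1
    simp only [Finset.sum_neg_distrib] at this
    omega

lemma sum_mixed_qv (D : ℤ) (x : ℝ) : ∑ Q ∈ mixedForms D, qv Q x =
    (1 - x ^ 2) * ((∑ Q ∈ mixedForms D, Q.2.2 : ℤ) : ℝ) := by
  obtain ⟨h1, h2⟩ := sum_mixed_anti D
  have h1' : ∑ Q ∈ mixedForms D, (Q.1 : ℝ) = -∑ Q ∈ mixedForms D, (Q.2.2 : ℝ) := by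
    exact_mod_cast h1
  have h2' : ∑ Q ∈ mixedForms D, (Q.2.1 : ℝ) = 0 := by exact_mod_cast h2
  simp only [qv, Finset.sum_add_distrib, ← Finset.sum_mul]
  rw [h1', h2']
  push_cast
  ring

lemma sum_ofReal_sub (D : ℤ) (x : ℝ) :
    (∑ Q ∈ mixedForms D, ENNReal.ofReal (qv Q x)).toReal -
      (∑ Q ∈ mixedForms D, ENNReal.ofReal (-qv Q x)).toReal = ∑ Q ∈ mixedForms D, qv Q x := by
  rw [ENNReal.toReal_sum (by simp), ENNReal.toReal_sum (by simp), ← Finset.sum_sub_distrib]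
  refine Finset.sum_congr rfl fun Q _ => ?_
  rw [ENNReal.toReal_ofReal', ENNReal.toReal_ofReal', max_zero_sub_max_neg_zero_eq_self]

lemma signForms_zero_of_not_isSquare {D : ℤ} (h : ¬ IsSquare D) (s : ℤ) :
    signForms D 0 s = ∅ := by
  ext ⟨a, b, c⟩
  simp only [signForms, disc, Set.mem_ofPred_eq, mem_empty_iff_false, iff_false, not_and]
  intro h1 h2
  rw [Int.sign_eq_zero_iff_zero.1 h2] at h1
  exact absurd ⟨b, by rw [← h1]; ring⟩ h

/-- `∑ (k x + c)⁺` over `c < 0`. -/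
lemma posSum_zero_neg {k : ℤ} (hk : 0 < k) {x : ℝ} (hx : 0 < x) :
    posSum (signForms (k * k) 0 (-1)) x =
      ENNReal.ofReal (1 / 2 * ((k * x) ^ 2 - k * x) - 1 / 2 * bern2 (k * x) + 1 / 12) := by
  have hkx : 0 < (k : ℝ) * x := mul_pos (by exact_mod_cast hk) hx
  have hS : signForms (k * k) 0 (-1) = (fun c : ℤ => ((0, k, c) : ℤ × ℤ × ℤ)) '' {c | c < 0} ∪
      (fun c : ℤ => ((0, -k, c) : ℤ × ℤ × ℤ)) '' {c | c < 0} := by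
    ext ⟨a, b, c⟩
    simp only [signForms, disc, Set.mem_ofPred_eq, mem_union, mem_image, Prod.mk.injEq,
      Int.sign_eq_zero_iff_zero, Int.sign_eq_neg_one_iff_neg]
    constructor
    · rintro ⟨h1, rfl, h3⟩
      have : b * b = k * k := by rw [← h1]; ring
      rcases mul_self_eq_mul_self_iff.1 this with rfl | rfl
      · exact Or.inl ⟨c, h3, rfl, rfl, rfl⟩
      · exact Or.inr ⟨c, h3, rfl, rfl, rfl⟩
    · rintro (⟨c, h3, rfl, rfl, rfl⟩ | ⟨c, h3, rfl, rfl, rfl⟩) <;>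
        exact ⟨by ring, rfl, h3⟩
  have hinj : ∀ j : ℤ, InjOn (fun c : ℤ => ((0, j, c) : ℤ × ℤ × ℤ)) {c | c < 0} := by
    intro j c _ c' _ h
    simpa using h
  rw [hS, posSum_union]
  · have h2 : posSum ((fun c : ℤ => ((0, -k, c) : ℤ × ℤ × ℤ)) '' {c | c < 0}) x = 0 := by
      rw [posSum, tsum_image (fun Q => ENNReal.ofReal (qv Q x)) (hinj _), ENNReal.tsum_eq_zero]
      rintro ⟨c, hc⟩
      have hc' : (c : ℝ) < 0 := by exact_mod_cast hc
      refine ENNReal.ofReal_of_nonpos ?_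
      simp only [qv]
      push_cast
      nlinarith
    rw [h2, add_zero, posSum, tsum_image (fun Q => ENNReal.ofReal (qv Q x)) (hinj _),
      ← tsum_int_neg_posPart hkx.le,
      tsum_subtype {c : ℤ | c < 0} (fun c => ENNReal.ofReal (qv (0, k, c) x))]
    refine tsum_congr fun c => ?_
    by_cases hc : c < 0
    · rw [indicator_of_mem (by exact hc), if_pos hc]
      congr 1
      simp [qv]
    · rw [indicator_of_notMem (by exact hc), if_neg hc]
  · rw [Set.disjoint_left]
    rintro _ ⟨c, _, rfl⟩ ⟨c', _, h⟩
    simp only [Prod.mk.injEq] at h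
    omega

end ArcsinSum

namespace ArcsinSum

open MeasureTheory Set Filter Topology
open scoped Real

open Classical in
/-- The mean value of the sum `∑ Q(x)⁺` over the forms in `negForms D`. -/
noncomputable def meanVal (D : ℤ) : ℝ :=
  ((∑ Q ∈ mixedForms D, Q.2.2 : ℤ) : ℝ) + if IsSquare D then (D : ℝ) / 2 - 1 / 12 else 0

open Classical in
/-- The oscillating part of the sum `∑ Q(x)⁺` over the forms in `negForms D`. -/
noncomputable def oscPart (D : ℤ) (x : ℝ) : ℝ :=
  if IsSquare D then 1 / 2 * bern2 (√D * x) else 0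

lemma measurable_oscPart (D : ℤ) : Measurable (oscPart D) := by
  unfold oscPart
  split_ifs
  · exact (measurable_bern2.comp (measurable_const_mul _)).const_mul _
  · exact measurable_const

lemma exists_sqrt_eq {D : ℤ} (hD : 0 < D) (h : IsSquare D) :
    ∃ k : ℤ, 0 < k ∧ D = k * k ∧ √(D : ℝ) = k := by
  obtain ⟨k, rfl⟩ := h
  have hk : k ≠ 0 := by rintro rfl; simp at hD
  refine ⟨|k|, abs_pos.2 hk, (abs_mul_abs_self k).symm, ?_⟩
  push_cast
  rw [Real.sqrt_mul_self_eq_abs]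

lemma oscPart_add_one {D : ℤ} (hD : 0 < D) (x : ℝ) : oscPart D (x + 1) = oscPart D x := by
  unfold oscPart
  split_ifs with h
  · obtain ⟨k, _, _, hk⟩ := exists_sqrt_eq hD h
    rw [hk, mul_add, mul_one, bern2_add_int]
  · rfl

lemma abs_oscPart_le (D : ℤ) (x : ℝ) : |oscPart D x| ≤ 1 := by
  unfold oscPart
  split_ifs with h
  · rw [abs_mul, abs_of_pos (by norm_num : (0 : ℝ) < 1 / 2)]
    have := abs_bern2_le (√D * x)
    linarith
  · simp

lemma posSum_linear_sub {D : ℤ} (hD : 0 < D) {x : ℝ} (hx : 0 < x) :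
    posSum (signForms D (-1) 0) x ≠ ⊤ ∧ posSum (signForms D 0 (-1)) x ≠ ⊤ ∧
    (posSum (signForms D (-1) 0) x).toReal - (posSum (signForms D 0 (-1)) x).toReal =
      (1 - x ^ 2) * (meanVal D - ((∑ Q ∈ mixedForms D, Q.2.2 : ℤ) : ℝ)) +
        oscPart D x - x ^ 2 * oscPart D (1 / x) := by
  rw [← posSum_signForms_inv D 0 (-1) hx]
  by_cases h : IsSquare D
  · obtain ⟨k, hk, rfl, hs⟩ := exists_sqrt_eq hD h
    have hk' : (0 : ℝ) < k := by exact_mod_cast hk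
    have e : (k : ℝ) * (1 / x) = k / x := by ring
    rw [posSum_zero_neg hk hx, posSum_zero_neg hk (one_div_pos.2 hx), ENNReal.toReal_mul,
      ENNReal.toReal_ofReal (by positivity),
      ENNReal.toReal_ofReal (bern2_bound_nonneg (by positivity)),
      ENNReal.toReal_ofReal (bern2_bound_nonneg (by positivity)), oscPart, oscPart, meanVal,
      if_pos h, if_pos h, if_pos h, hs]
    refine ⟨ENNReal.mul_ne_top (by simp) (by simp), by simp, ?_⟩
    push_cast
    field_simp
    ring
  · simp [signForms_zero_of_not_isSquare h, posSum, oscPart, meanVal, h]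

lemma posSum_inv_eq_top_iff {D : ℤ} (hD : 0 < D) {x : ℝ} (hx : 0 < x) :
    posSum (negForms D) (1 / x) = ⊤ ↔ posSum (negForms D) x = ⊤ := by
  have hx2 : ENNReal.ofReal (x ^ 2) ≠ 0 := by
    rw [Ne, ENNReal.ofReal_eq_zero, not_le]
    positivity
  obtain ⟨h1, h2, -⟩ := posSum_linear_sub hD hx
  have h3 : posSum (signForms D (-1) 1) x ≠ ⊤ := by
    rw [posSum_mixed]
    simp
  have h4 : posSum (signForms D 1 (-1)) x ≠ ⊤ := by
    rw [posSum_mixed_neg]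
    simp
  have h5 : posSum (negForms D) (1 / x) = ⊤ ↔
      ENNReal.ofReal (x ^ 2) * posSum (negForms D) (1 / x) = ⊤ := by
    rw [ENNReal.mul_eq_top]
    simp [hx2]
  rw [h5, posSum_negForms_eq, mul_add, mul_add, posSum_signForms_inv D _ _ hx,
    posSum_signForms_inv D _ _ hx, posSum_signForms_inv D _ _ hx, posSum_negForms_eq]
  simp [h1, h2, h3, h4]

/-- The functional equation under `x ↦ 1 / x`. -/
lemma posSum_negForms_inv {D : ℤ} (hD : 0 < D) {x : ℝ} (hx : 0 < x)
    (hfin : posSum (negForms D) x ≠ ⊤) :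
    (posSum (negForms D) x).toReal - oscPart D x - meanVal D =
      x ^ 2 * ((posSum (negForms D) (1 / x)).toReal - oscPart D (1 / x) - meanVal D) := by
  obtain ⟨h1, h2, h3⟩ := posSum_linear_sub hD hx
  have h4 : posSum (signForms D (-1) 1) x ≠ ⊤ := by
    rw [posSum_mixed]
    simp
  have h5 : posSum (signForms D 1 (-1)) x ≠ ⊤ := by
    rw [posSum_mixed_neg]
    simp
  have h6 : posSum (signForms D (-1) (-1)) x ≠ ⊤ := by
    rw [posSum_negForms_eq, Ne, ENNReal.add_eq_top, not_or] at hfin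
    exact hfin.1
  have h7 : x ^ 2 * (posSum (negForms D) (1 / x)).toReal =
      (ENNReal.ofReal (x ^ 2) * posSum (negForms D) (1 / x)).toReal := by
    rw [ENNReal.toReal_mul, ENNReal.toReal_ofReal (by positivity)]
  have h8 := sum_ofReal_sub D x
  rw [← posSum_mixed, ← posSum_mixed_neg, sum_mixed_qv] at h8
  rw [mul_sub, mul_sub, h7, posSum_negForms_eq, posSum_negForms_eq, mul_add, mul_add,
    posSum_signForms_inv D _ _ hx, posSum_signForms_inv D _ _ hx, posSum_signForms_inv D _ _ hx,
    ENNReal.toReal_add h6 (ENNReal.add_ne_top.2 ⟨h1, h4⟩), ENNReal.toReal_add h1 h4,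
    ENNReal.toReal_add h6 (ENNReal.add_ne_top.2 ⟨h2, h5⟩), ENNReal.toReal_add h2 h5]
  linear_combination h3 + h8

/-- The contraction weights telescope. -/
lemma tsum_weight_le {u : ℝ} (hu : 0 < u) :
    ∑' n : ℕ, ENNReal.ofReal ((((n + 1 + u) * (n + 2 + u)) ^ 2)⁻¹) ≤
      ENNReal.ofReal (1 / 2 * ((1 + u) ^ 2)⁻¹) := by
  have h : ∀ N : ℕ, ∑ n ∈ Finset.range N, (((n + 1 + u) * (n + 2 + u)) ^ 2)⁻¹ ≤
      ((1 + u) * (2 + u))⁻¹ * ((1 + u)⁻¹ - (N + 1 + u)⁻¹) := by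
    intro N
    induction N with
    | zero => simp
    | succ N ih =>
      rw [Finset.sum_range_succ]
      have hN : (0 : ℝ) ≤ N := N.cast_nonneg
      have h1 : (((N + 1 + u) * (N + 2 + u)) ^ 2)⁻¹ ≤
          ((1 + u) * (2 + u))⁻¹ * ((N + 1 + u)⁻¹ - (N + 2 + u)⁻¹) := by
        have e : ((N + 1 + u)⁻¹ - (N + 2 + u)⁻¹ : ℝ) = ((N + 1 + u) * (N + 2 + u))⁻¹ := by
          field_simp
          ring
        rw [e, sq, mul_inv]
        gcongr <;> linarith
      push_cast
      rw [show (N : ℝ) + 1 + 1 + u = N + 2 + u by ring]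
      linarith
  refine ENNReal.tsum_le_of_sum_range_le fun N => ?_
  rw [← ENNReal.ofReal_sum_of_nonneg fun _ _ => by positivity]
  refine ENNReal.ofReal_le_ofReal ((h N).trans ?_)
  have hN : (0 : ℝ) ≤ N := N.cast_nonneg
  calc ((1 + u) * (2 + u))⁻¹ * ((1 + u)⁻¹ - (N + 1 + u)⁻¹)
      ≤ ((1 + u) * 2)⁻¹ * (1 + u)⁻¹ := by
        have h1 : (0 : ℝ) < (N + 1 + u)⁻¹ := by positivity
        have h2 : (N + 1 + u)⁻¹ ≤ (1 + u)⁻¹ := by gcongr; linarith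
        exact mul_le_mul (by gcongr; linarith) (by linarith) (by linarith) (by positivity)
    _ = 1 / 2 * ((1 + u) ^ 2)⁻¹ := by
        field_simp

/-- A nonnegative `1`-periodic locally integrable function with `G x = x² G (1 / x)` is zero. -/
lemma ae_zero_of_periodic_of_inv {G : ℝ → ENNReal} (hm : Measurable G)
    (hper : ∀ x, G (x + 1) = G x)
    (hinv : ∀ x, 0 < x → G x = ENNReal.ofReal (x ^ 2) * G (1 / x))
    (hfin : ∫⁻ x in Ioc 0 1, G x ≠ ⊤) : ∀ᵐ x, G x = 0 := by
  set w : ℝ → ENNReal := fun x => ENNReal.ofReal (((1 + x) ^ 2)⁻¹) with hw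
  have hwm : Measurable w := by
    rw [hw]
    fun_prop
  have himg : (fun y : ℝ => y⁻¹) '' Ioi 1 = Ioo 0 1 := by
    ext x
    simp only [mem_image, mem_Ioi, mem_Ioo]
    constructor
    · rintro ⟨y, hy, rfl⟩
      exact ⟨by positivity, inv_lt_one_of_one_lt₀ hy⟩
    · rintro ⟨h1, h2⟩
      exact ⟨x⁻¹, (one_lt_inv₀ h1).2 h2, inv_inv x⟩
  have hpern : ∀ (n : ℕ) x, G (x + n) = G x := by
    intro n x
    induction n with
    | zero => simp
    | succ n ih => rw [← ih, ← hper (x + n)]; push_cast; ring_nf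
  have hI1 : ∫⁻ x in Ioc 0 1, G x * w x =
      ∫⁻ y in Ioi 1, G y * ENNReal.ofReal (((y * (1 + y)) ^ 2)⁻¹) := by
    rw [setLIntegral_congr Ioo_ae_eq_Ioc.symm, ← himg,
      lintegral_image_eq_lintegral_abs_deriv_mul measurableSet_Ioi
        (f := fun y : ℝ => y⁻¹) (f' := fun y => -(y ^ 2)⁻¹)
        (fun y hy => (hasDerivAt_inv (by linarith [mem_Ioi.1 hy])).hasDerivWithinAt)
        inv_injective.injOn]
    refine setLIntegral_congr_fun measurableSet_Ioi fun y hy => ?_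
    have hy0 : 0 < y := by linarith [mem_Ioi.1 hy]
    rw [hinv y⁻¹ (by positivity), one_div, inv_inv, mul_comm (ENNReal.ofReal (y⁻¹ ^ 2)), hw,
      mul_assoc, mul_left_comm, ← ENNReal.ofReal_mul (by positivity),
      ← ENNReal.ofReal_mul (by positivity), abs_neg, abs_of_pos (by positivity)]
    congr 2
    field_simp
    ring
  have hI2 : ∫⁻ y in Ioi 1, G y * ENNReal.ofReal (((y * (1 + y)) ^ 2)⁻¹) =
      ∑' n : ℕ, ∫⁻ u in Ioc 0 1, G u * ENNReal.ofReal ((((n + 1 + u) * (n + 2 + u)) ^ 2)⁻¹) := by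
    have hU : Ioi (1 : ℝ) = ⋃ n : ℕ, Ioc ((n : ℝ) + 1) (n + 1 + 1) := by
      ext y
      simp only [mem_Ioi, mem_iUnion, mem_Ioc]
      constructor
      · intro hy
        have h1 : 0 < y - 1 := by linarith
        refine ⟨⌈y - 1⌉₊ - 1, ?_⟩
        have h2 := Nat.ceil_lt_add_one h1.le
        have h3 := Nat.le_ceil (y - 1)
        have h4 : 1 ≤ ⌈y - 1⌉₊ := Nat.one_le_ceil_iff.2 h1
        push_cast [h4]
        constructor <;> linarith
      · rintro ⟨n, h1, _⟩
        have : (0 : ℝ) ≤ n := n.cast_nonneg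
        linarith
    rw [hU, lintegral_iUnion (fun n => measurableSet_Ioc)]
    · refine tsum_congr fun n => ?_
      have hp : Ioc (0 : ℝ) 1 = (fun u : ℝ => u + (n + 1 : ℝ)) ⁻¹' Ioc ((n : ℝ) + 1) (n + 1 + 1) := by
        ext u
        simp only [mem_Ioc, mem_preimage]
        constructor <;> rintro ⟨h1, h2⟩ <;> constructor <;> linarith
      rw [← (measurePreserving_add_right volume ((n : ℝ) + 1)).setLIntegral_comp_preimage
        measurableSet_Ioc (by fun_prop), ← hp]
      refine setLIntegral_congr_fun measurableSet_Ioc fun u _ => ?_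
      rw [← hpern (n + 1) u]
      push_cast
      congr 3
      ring
    · intro i j hij
      rw [Function.onFun, Set.disjoint_left]
      rintro y ⟨h1, h2⟩ ⟨h3, h4⟩
      have h5 : (i : ℝ) < j + 1 := by linarith
      have h6 : (j : ℝ) < i + 1 := by linarith
      have h7 : i < j + 1 := by exact_mod_cast h5
      have h8 : j < i + 1 := by exact_mod_cast h6
      omega
  have hI3 : ∫⁻ x in Ioc 0 1, G x * w x ≤ 2⁻¹ * ∫⁻ x in Ioc 0 1, G x * w x := by
    nth_rewrite 1 [hI1]
    rw [hI2, ← lintegral_tsum (fun n => by fun_prop), ← lintegral_const_mul _ (by fun_prop)]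
    refine setLIntegral_mono (by fun_prop) fun u hu => ?_
    rw [ENNReal.tsum_mul_left, mul_left_comm]
    gcongr
    refine (tsum_weight_le hu.1).trans ?_
    rw [ENNReal.ofReal_mul (by norm_num), hw]
    gcongr
    simp [ENNReal.ofReal_inv_of_pos]
  have hI4 : ∫⁻ x in Ioc 0 1, G x * w x ≠ ⊤ := by
    refine ne_top_of_le_ne_top hfin (setLIntegral_mono hm fun x hx => ?_)
    refine mul_le_of_le_one_right zero_le (ENNReal.ofReal_le_one.2 (inv_le_one_of_one_le₀ ?_))
    nlinarith [hx.1]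
  have hI5 : ∫⁻ x in Ioc 0 1, G x * w x = 0 := by
    by_contra h
    have := ENNReal.mul_lt_mul_left h hI4 (ENNReal.inv_lt_one.2 ENNReal.one_lt_two)
    rw [one_mul] at this
    exact absurd hI3 (not_le.2 (by simpa [mul_comm] using this))
  rw [lintegral_eq_zero_iff (by fun_prop)] at hI5
  have hI6 : volume ({x | G x ≠ 0} ∩ Ioc 0 1) = 0 := by
    rw [EventuallyEq, ae_restrict_iff' measurableSet_Ioc] at hI5
    refine measure_mono_null ?_ hI5
    rintro x ⟨hx, hx1⟩
    simp only [mem_compl_iff, Set.mem_ofPred_eq, Classical.not_imp, Pi.zero_apply, mul_eq_zero,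
      not_or]
    refine ⟨hx1, hx, ?_⟩
    rw [hw, ENNReal.ofReal_eq_zero, not_le]
    have := hx1.1
    positivity
  have hdom := isAddFundamentalDomain_Ioc (T := (1 : ℝ)) one_pos 0
  rw [zero_add] at hdom
  refine hdom.measure_zero_of_invariant {x | G x ≠ 0} ?_ hI6
  have hperz : ∀ (n : ℤ) x, G (x + n) = G x := by
    intro n x
    obtain ⟨m, rfl | rfl⟩ := n.eq_nat_or_neg
    · exact hpern m x
    · rw [← hpern m (x + _)]
      push_cast
      ring_nf
  rintro ⟨g, hg⟩
  obtain ⟨n, rfl⟩ := AddSubgroup.mem_zmultiples_iff.1 hg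
  ext x
  rw [mem_vadd_set_iff_neg_vadd_mem]
  simp only [Set.mem_ofPred_eq]
  have : (-(⟨n • (1 : ℝ), hg⟩ : AddSubgroup.zmultiples (1 : ℝ)) +ᵥ x) = x + ((-n : ℤ) : ℝ) := by
    rw [AddSubgroup.vadd_def]
    simp
    ring
  rw [this, hperz]

end ArcsinSum

namespace ArcsinSum

open MeasureTheory Set Filter Topology
open scoped Real

/-- The sum of `Q(x)⁺` over `negForms D` equals `meanVal D + oscPart D x` almost everywhere. -/
lemma ae_posSum_eq {D : ℤ} (hD : 0 < D) (hfin : ∫⁻ x in Ioc 0 1, posSum (negForms D) x ≠ ⊤) :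
    ∀ᵐ x, posSum (negForms D) x = ENNReal.ofReal (meanVal D + oscPart D x) ∧
      0 ≤ meanVal D + oscPart D x := by
  classical
  set G : ℝ → ENNReal := fun x => if posSum (negForms D) x = ⊤ then ⊤ else
    ‖(posSum (negForms D) x).toReal - oscPart D x - meanVal D‖ₑ with hG
  have hA := measurable_posSum (negForms D)
  have hE := measurable_oscPart D
  have hGm : Measurable G := by
    refine Measurable.ite (hA (measurableSet_singleton ⊤)) measurable_const ?_
    fun_prop
  have h := ae_zero_of_periodic_of_inv hGm ?_ ?_ ?_
  · filter_upwards [h] with x hx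
    rw [hG] at hx
    simp only [] at hx
    split_ifs at hx with hx'
    · simp at hx
    · rw [enorm_eq_zero] at hx
      have e : meanVal D + oscPart D x = (posSum (negForms D) x).toReal := by linarith
      rw [e, ENNReal.ofReal_toReal hx']
      exact ⟨rfl, ENNReal.toReal_nonneg⟩
  · intro x
    rw [hG]
    simp only [posSum_negForms_add_one, oscPart_add_one hD]
  · intro x hx
    rw [hG]
    simp only [posSum_inv_eq_top_iff hD hx]
    split_ifs with hx'
    · rw [ENNReal.mul_top]
      rw [Ne, ENNReal.ofReal_eq_zero, not_le]
      positivity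
    · rw [posSum_negForms_inv hD hx hx', enorm_mul, Real.enorm_of_nonneg (by positivity)]
  · have hle : ∀ x, G x ≤ posSum (negForms D) x + ENNReal.ofReal (1 + |meanVal D|) := by
      intro x
      rw [hG]
      simp only []
      split_ifs with hx
      · simp [hx]
      · rw [Real.enorm_eq_ofReal_abs]
        nth_rewrite 2 [← ENNReal.ofReal_toReal hx]
        rw [← ENNReal.ofReal_add ENNReal.toReal_nonneg (by positivity)]
        refine ENNReal.ofReal_le_ofReal ?_
        have h1 := abs_oscPart_le D x
        have h2 := abs_sub ((posSum (negForms D) x).toReal - oscPart D x) (meanVal D)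
        have h3 := abs_sub (posSum (negForms D) x).toReal (oscPart D x)
        rw [abs_of_nonneg ENNReal.toReal_nonneg] at h3
        linarith
    refine ne_top_of_le_ne_top ?_ (setLIntegral_mono (by fun_prop) fun x _ => hle x)
    rw [lintegral_add_right _ measurable_const, ENNReal.add_ne_top]
    refine ⟨hfin, ?_⟩
    simp

/-- The summand of the arcsine series. -/
noncomputable def formTerm (Q : ℤ × ℤ × ℤ) : ℝ := arcsinTerm Q.1 Q.2.1 Q.2.2

lemma disc_cast (Q : ℤ × ℤ × ℤ) :
    (Q.2.1 : ℝ) ^ 2 - 4 * Q.1 * Q.2.2 = (disc Q : ℝ) := by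
  unfold disc
  push_cast
  ring

lemma formTerm_nonneg {Q : ℤ × ℤ × ℤ} (h : 0 < disc Q) : 0 ≤ formTerm Q :=
  arcsinTerm_nonneg (by rw [disc_cast]; exact_mod_cast h)

lemma formTerm_neg (Q : ℤ × ℤ × ℤ) : formTerm (-Q) = formTerm Q := by
  simp only [formTerm, arcsinTerm, Prod.fst_neg, Prod.snd_neg, Int.cast_neg]
  rw [show (-(Q.1 : ℝ) + -Q.2.2) = -(Q.1 + Q.2.2) by ring, abs_neg]
  ring_nf

lemma integrable_oscPart_mul_kern (D : ℤ) : Integrable fun x => oscPart D x * kern x := by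
  refine integrable_kern.mono' ((measurable_oscPart D).mul
    continuous_kern.measurable).aestronglyMeasurable (ae_of_all _ fun x => ?_)
  rw [norm_mul, Real.norm_of_nonneg (kern_nonneg x), Real.norm_eq_abs]
  exact mul_le_of_le_one_left (kern_nonneg x) (abs_oscPart_le D x)

lemma integral_kern : ∫ x, kern x = π / 2 := by
  have := integral_even_kern (p := 0) (q := 1) le_rfl zero_le_one
  simpa using this

lemma lintegral_posSum_kern {D : ℤ} (hD : 0 < D)
    (hfin : ∫⁻ x in Ioc 0 1, posSum (negForms D) x ≠ ⊤) :
    0 ≤ meanVal D * (π / 2) + ∫ x, oscPart D x * kern x ∧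
    ∫⁻ x, posSum (negForms D) x * ENNReal.ofReal (kern x) =
      ENNReal.ofReal (meanVal D * (π / 2) + ∫ x, oscPart D x * kern x) := by
  have hint : Integrable fun x => (meanVal D + oscPart D x) * kern x := by
    simp only [add_mul]
    exact (integrable_kern.const_mul _).add (integrable_oscPart_mul_kern D)
  have hval : ∫ x, (meanVal D + oscPart D x) * kern x =
      meanVal D * (π / 2) + ∫ x, oscPart D x * kern x := by
    simp only [add_mul]
    rw [integral_add (integrable_kern.const_mul _) (integrable_oscPart_mul_kern D),
      integral_const_mul, integral_kern]
  have hae := ae_posSum_eq hD hfin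
  have hnn : 0 ≤ᵐ[volume] fun x => (meanVal D + oscPart D x) * kern x := by
    filter_upwards [hae] with x hx
    exact mul_nonneg hx.2 (kern_nonneg x)
  rw [← hval, ofReal_integral_eq_lintegral_ofReal hint hnn]
  refine ⟨integral_nonneg_of_ae hnn, lintegral_congr_ae ?_⟩
  filter_upwards [hae] with x hx
  rw [hx.1, ENNReal.ofReal_mul hx.2]

lemma tsum_negForms {D : ℤ} (hD : 0 < D)
    (hfin : ∫⁻ x in Ioc 0 1, posSum (negForms D) x ≠ ⊤) :
    ∑' Q : negForms D, ENNReal.ofReal (formTerm Q) ≠ ⊤ ∧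
    (∑' Q : negForms D, ENNReal.ofReal (formTerm Q)).toReal =
      π * meanVal D + 2 * (∫ x, oscPart D x * kern x) -
        π * ((∑ Q ∈ mixedForms D, max (Q.1 + Q.2.2) 0 : ℤ) : ℝ) := by
  classical
  obtain ⟨h0, h1⟩ := lintegral_posSum_kern hD hfin
  have h2 : ∫⁻ x, posSum (negForms D) x * ENNReal.ofReal (kern x) =
      ∑' Q : negForms D, ∫⁻ x, ENNReal.ofReal (qv Q x) * ENNReal.ofReal (kern x) := by
    simp only [posSum, ← ENNReal.tsum_mul_right]
    refine lintegral_tsum fun Q => ?_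
    exact (((continuous_qv Q).measurable.ennreal_ofReal).mul
      continuous_kern.measurable.ennreal_ofReal).aemeasurable
  have h3 : ∀ Q : negForms D, ∫⁻ x, ENNReal.ofReal (qv Q x) * ENNReal.ofReal (kern x) =
      ENNReal.ofReal (1 / 2) * ENNReal.ofReal (formTerm Q) +
        ENNReal.ofReal (π / 2 * max (((Q : ℤ × ℤ × ℤ).1 : ℝ) + (Q : ℤ × ℤ × ℤ).2.2) 0) := by
    rintro ⟨Q, hQ, hQ'⟩
    have hd : 0 < (Q.2.1 : ℝ) ^ 2 - 4 * Q.1 * Q.2.2 := by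
      rw [disc_cast, hQ]
      exact_mod_cast hD
    rw [← ENNReal.ofReal_mul (by norm_num), ← ENNReal.ofReal_add]
    · rw [formTerm]
      simp only [qv]
      rw [lintegral_posPart_kern (by exact_mod_cast hQ') hd]
      congr 1
      ring
    · exact mul_nonneg (by norm_num) (arcsinTerm_nonneg hd)
    · positivity
  have h4 : ∑' Q : negForms D,
      ENNReal.ofReal (π / 2 * max (((Q : ℤ × ℤ × ℤ).1 : ℝ) + (Q : ℤ × ℤ × ℤ).2.2) 0) =
      ENNReal.ofReal (π / 2 * ((∑ Q ∈ mixedForms D, max (Q.1 + Q.2.2) 0 : ℤ) : ℝ)) := by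
    rw [tsum_subtype (negForms D)
      (fun Q => ENNReal.ofReal (π / 2 * max ((Q.1 : ℝ) + Q.2.2) 0)),
      tsum_eq_sum (s := mixedForms D)]
    · push_cast
      rw [Finset.mul_sum, ENNReal.ofReal_sum_of_nonneg fun _ _ => by positivity]
      refine Finset.sum_congr rfl fun Q hQ => ?_
      rw [mem_mixedForms] at hQ
      rw [indicator_of_mem]
      exact ⟨hQ.1, hQ.2.1⟩
    · intro Q hQ
      rw [indicator_apply_eq_zero]
      rintro ⟨h5, h6⟩
      have h7 : Q.2.2 ≤ 0 := by
        by_contra h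
        exact hQ (mem_mixedForms.2 ⟨h5, h6, not_le.1 h⟩)
      have h8 : (Q.1 : ℝ) + Q.2.2 ≤ 0 := by exact_mod_cast (by omega : Q.1 + Q.2.2 ≤ 0)
      rw [max_eq_right h8]
      simp
  rw [h1, tsum_congr h3, ENNReal.tsum_add, ENNReal.tsum_mul_left, h4] at h2
  have hne : ENNReal.ofReal (1 / 2) * ∑' Q : negForms D, ENNReal.ofReal (formTerm Q) ≠ ⊤ := by
    intro h
    rw [h] at h2
    simp at h2
  have hne' : ∑' Q : negForms D, ENNReal.ofReal (formTerm Q) ≠ ⊤ := by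
    intro h
    rw [h, ENNReal.mul_top (by simp)] at hne
    exact hne rfl
  refine ⟨hne', ?_⟩
  have h9 := congrArg ENNReal.toReal h2
  rw [ENNReal.toReal_ofReal h0, ENNReal.toReal_add hne (by simp), ENNReal.toReal_mul,
    ENNReal.toReal_ofReal (by norm_num), ENNReal.toReal_ofReal] at h9
  · linarith
  · have : (0 : ℤ) ≤ ∑ Q ∈ mixedForms D, max (Q.1 + Q.2.2) 0 :=
      Finset.sum_nonneg fun _ _ => le_max_right _ _
    have : (0 : ℝ) ≤ (∑ Q ∈ mixedForms D, max (Q.1 + Q.2.2) 0 : ℤ) := by exact_mod_cast this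
    positivity

lemma tsum_linear {D : ℤ} (hD : 0 < D) {k : ℤ} (hk : 0 < k) (hDk : D = k * k) :
    ∑' c : ℤ, ENNReal.ofReal (formTerm (0, k, c)) ≠ ⊤ ∧
    (∑' c : ℤ, ENNReal.ofReal (formTerm (0, k, c))).toReal =
      (D + 1 / 6) * (π / 2) - 2 * ∫ x, oscPart D x * kern x := by
  have hk' : (0 : ℝ) < k := by exact_mod_cast hk
  have hs : √(D : ℝ) = k := by
    rw [hDk]
    push_cast
    exact Real.sqrt_mul_self hk'.le
  have hosc : ∀ x, oscPart D x = 1 / 2 * bern2 (k * x) := fun x => by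
    rw [oscPart, if_pos ⟨k, hDk⟩, hs]
  have hx : ∀ x : ℝ, ∑' c : ℤ, ENNReal.ofReal (k * |x| - |(c : ℝ)|) * ENNReal.ofReal (kern x) =
      ENNReal.ofReal ((D * x ^ 2 + 1 / 6) * kern x - 2 * (oscPart D x * kern x)) := by
    intro x
    rw [ENNReal.tsum_mul_right]
    have h1 := tsum_int_abs_posPart (k * x)
    rw [abs_mul, abs_of_pos hk'] at h1
    rw [h1, ← ENNReal.ofReal_mul' (kern_nonneg x), hosc, hDk]
    congr 1
    push_cast
    ring
  have hnn : ∀ x : ℝ, 0 ≤ (D * x ^ 2 + 1 / 6) * kern x - 2 * (oscPart D x * kern x) := by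
    intro x
    have h1 : bern2 (k * x) ≤ 1 / 6 := by
      have h2 := Int.fract_nonneg (k * x)
      have h3 := (Int.fract_lt_one (k * x)).le
      rw [bern2]
      nlinarith
    have h4 : (0 : ℝ) ≤ D := by exact_mod_cast hD.le
    rw [hosc, show (D * x ^ 2 + 1 / 6) * kern x - 2 * (1 / 2 * bern2 (k * x) * kern x) =
      (D * x ^ 2 + (1 / 6 - bern2 (k * x))) * kern x by ring]
    exact mul_nonneg (by nlinarith [mul_nonneg h4 (sq_nonneg x)]) (kern_nonneg x)
  have hi1 : Integrable fun x : ℝ => (D * x ^ 2 + 1 / 6) * kern x := by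
    have : (fun x : ℝ => (D * x ^ 2 + 1 / 6) * kern x) =
        fun x => (D : ℝ) * (x ^ 2 * kern x) + 1 / 6 * kern x := by
      ext x
      ring
    rw [this]
    exact (integrable_sq_mul_kern.const_mul _).add (integrable_kern.const_mul _)
  have hi2 := (integrable_oscPart_mul_kern D).const_mul 2
  have hi3 : Integrable fun x : ℝ => (D * x ^ 2 + 1 / 6) * kern x - 2 * (oscPart D x * kern x) :=
    hi1.sub hi2
  have key : ∑' c : ℤ, ENNReal.ofReal (formTerm (0, k, c)) =
      ENNReal.ofReal ((D + 1 / 6) * (π / 2) - 2 * ∫ x, oscPart D x * kern x) := by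
    have h1 : ∀ c : ℤ, ENNReal.ofReal (formTerm (0, k, c)) =
        ∫⁻ x, ENNReal.ofReal (k * |x| - |(c : ℝ)|) * ENNReal.ofReal (kern x) := by
      intro c
      rw [lintegral_abs_kern hk']
      simp [formTerm]
    rw [tsum_congr h1, ← lintegral_tsum]
    · rw [lintegral_congr hx, ← ofReal_integral_eq_lintegral_ofReal hi3
        (ae_of_all _ hnn), integral_sub hi1 hi2, integral_const_mul,
        integral_even_kern (by exact_mod_cast hD.le) (by norm_num)]
    · intro c
      refine (Measurable.mul ?_ continuous_kern.measurable.ennreal_ofReal).aemeasurable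
      fun_prop
  have hnn2 : 0 ≤ (D + 1 / 6) * (π / 2) - 2 * ∫ x, oscPart D x * kern x := by
    have : 0 ≤ ∫ x : ℝ, (D * x ^ 2 + 1 / 6) * kern x - 2 * (oscPart D x * kern x) :=
      integral_nonneg hnn
    rwa [integral_sub hi1 hi2, integral_const_mul,
      integral_even_kern (by exact_mod_cast hD.le) (by norm_num)] at this
  rw [key]
  exact ⟨by simp, ENNReal.toReal_ofReal hnn2⟩

lemma tsum_disc_split (D : ℤ) : ∑' Q : {Q | disc Q = D}, ENNReal.ofReal (formTerm Q) =
    2 * ∑' Q : negForms D, ENNReal.ofReal (formTerm Q) +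
      ∑' Q : {Q : ℤ × ℤ × ℤ | disc Q = D ∧ Q.1 = 0}, ENNReal.ofReal (formTerm Q) := by
  have hneg : BijOn (fun Q : ℤ × ℤ × ℤ => -Q) (negForms D) {Q | disc Q = D ∧ 0 < Q.1} := by
    refine BijOn.mk ?_ neg_injective.injOn ?_
    · rintro ⟨a, b, c⟩ ⟨h1, h2⟩
      refine ⟨?_, by simpa using h2⟩
      rw [← h1]
      simp [disc]
    · rintro ⟨a, b, c⟩ ⟨h1, h2⟩
      refine ⟨-(a, b, c), ⟨?_, by simpa using h2⟩, neg_neg _⟩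
      rw [← h1]
      simp [disc]
  have hU : {Q | disc Q = D} = (negForms D ∪ {Q | disc Q = D ∧ 0 < Q.1}) ∪
      {Q : ℤ × ℤ × ℤ | disc Q = D ∧ Q.1 = 0} := by
    ext Q
    have := lt_trichotomy Q.1 0
    simp only [negForms, mem_union, Set.mem_ofPred_eq]
    tauto
  rw [tsum_congr_set_coe (fun Q => ENNReal.ofReal (formTerm Q)) hU,
    Summable.tsum_union_disjoint (f := fun Q => ENNReal.ofReal (formTerm Q)) _ ENNReal.summable
      ENNReal.summable,
    Summable.tsum_union_disjoint (f := fun Q => ENNReal.ofReal (formTerm Q)) _ ENNReal.summable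
      ENNReal.summable, tsum_bijOn hneg fun Q => ENNReal.ofReal (formTerm Q)]
  · simp only [formTerm_neg]
    rw [two_mul]
  · rw [Set.disjoint_left]
    rintro Q ⟨_, h1⟩ ⟨_, h2⟩
    omega
  · rw [Set.disjoint_left]
    rintro Q (⟨_, h1⟩ | ⟨_, h1⟩) ⟨_, h2⟩ <;> omega

lemma tsum_zero_forms {D k : ℤ} (hk : 0 < k) (hDk : D = k * k) :
    ∑' Q : {Q : ℤ × ℤ × ℤ | disc Q = D ∧ Q.1 = 0}, ENNReal.ofReal (formTerm Q) =
      2 * ∑' c : ℤ, ENNReal.ofReal (formTerm (0, k, c)) := by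
  have hU : {Q : ℤ × ℤ × ℤ | disc Q = D ∧ Q.1 = 0} =
      (fun c : ℤ => ((0, k, c) : ℤ × ℤ × ℤ)) '' univ ∪
        (fun c : ℤ => ((0, -k, -c) : ℤ × ℤ × ℤ)) '' univ := by
    ext ⟨a, b, c⟩
    simp only [disc, Set.mem_ofPred_eq, mem_union, image_univ, mem_range, Prod.mk.injEq]
    constructor
    · rintro ⟨h1, rfl⟩
      have : b * b = k * k := by rw [← hDk, ← h1]; ring
      rcases mul_self_eq_mul_self_iff.1 this with rfl | rfl
      · exact Or.inl ⟨c, rfl, rfl, rfl⟩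
      · exact Or.inr ⟨-c, rfl, rfl, neg_neg c⟩
    · rintro (⟨c, rfl, rfl, rfl⟩ | ⟨c, rfl, rfl, rfl⟩) <;> exact ⟨by rw [hDk]; ring, rfl⟩
  rw [tsum_congr_set_coe (fun Q => ENNReal.ofReal (formTerm Q)) hU,
    Summable.tsum_union_disjoint (f := fun Q => ENNReal.ofReal (formTerm Q)) _ ENNReal.summable
      ENNReal.summable,
      tsum_image (fun Q => ENNReal.ofReal (formTerm Q)) (by intro c _ c' _ h; simpa using h),
      tsum_image (fun Q => ENNReal.ofReal (formTerm Q)) (by intro c _ c' _ h; simpa using h),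
      two_mul,
      tsum_univ (fun c : ℤ => ENNReal.ofReal (formTerm (0, k, c))),
      tsum_univ (fun c : ℤ => ENNReal.ofReal (formTerm (0, -k, -c)))]
  · congr 1
    refine tsum_congr fun c => ?_
    rw [← formTerm_neg]
    simp
  · rw [Set.disjoint_left]
    rintro _ ⟨c, _, rfl⟩ ⟨c', _, h⟩
    simp only [Prod.mk.injEq] at h
    omega

open Classical in
/-- The arcsine series in terms of the mean value. -/
lemma tsum_formTerm {D : ℤ} (hD : 0 < D)
    (hfin : ∫⁻ x in Ioc 0 1, posSum (negForms D) x ≠ ⊤) :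
    ∑' Q : {Q | disc Q = D}, ENNReal.ofReal (formTerm Q) ≠ ⊤ ∧
    (∑' Q : {Q | disc Q = D}, ENNReal.ofReal (formTerm Q)).toReal =
      4 * π * meanVal D - 2 * π * (((∑ Q ∈ mixedForms D, max (-Q.1) Q.2.2 : ℤ) : ℝ) -
        if IsSquare D then 1 / 6 else 0) := by
  obtain ⟨h1, h2⟩ := tsum_negForms hD hfin
  have h3 : (∑ Q ∈ mixedForms D, max (Q.1 + Q.2.2) 0) =
      (∑ Q ∈ mixedForms D, max (-Q.1) Q.2.2) - ∑ Q ∈ mixedForms D, Q.2.2 := by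
    rw [← neg_eq_iff_eq_neg.2 (sum_mixed_anti D).1, ← Finset.sum_neg_distrib,
      ← Finset.sum_sub_distrib]
    refine Finset.sum_congr rfl fun Q _ => ?_
    omega
  rw [h3] at h2
  rw [tsum_disc_split]
  by_cases hsq : IsSquare D
  · obtain ⟨k, hk, hDk, -⟩ := exists_sqrt_eq hD hsq
    obtain ⟨h4, h5⟩ := tsum_linear hD hk hDk
    rw [tsum_zero_forms hk hDk]
    have h6 : ∀ {x : ENNReal}, x ≠ ⊤ → 2 * x ≠ ⊤ := fun h => ENNReal.mul_ne_top (by simp) h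
    refine ⟨ENNReal.add_ne_top.2 ⟨h6 h1, h6 h4⟩, ?_⟩
    rw [ENNReal.toReal_add (h6 h1) (h6 h4), ENNReal.toReal_mul, ENNReal.toReal_mul, h2, h5,
      meanVal, if_pos hsq, if_pos hsq]
    push_cast
    simp only [ENNReal.toReal_ofNat]
    ring
  · have h4 : {Q : ℤ × ℤ × ℤ | disc Q = D ∧ Q.1 = 0} = ∅ := by
      ext ⟨a, b, c⟩
      simp only [disc, Set.mem_ofPred_eq, mem_empty_iff_false, iff_false, not_and]
      rintro h5 rfl
      exact hsq ⟨b, by rw [← h5]; ring⟩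
    rw [tsum_congr_set_coe (fun Q => ENNReal.ofReal (formTerm Q)) h4,
      tsum_empty (f := fun Q : (∅ : Set (ℤ × ℤ × ℤ)) => ENNReal.ofReal (formTerm Q)), add_zero]
    refine ⟨ENNReal.mul_ne_top (by simp) h1, ?_⟩
    rw [ENNReal.toReal_mul, h2, meanVal, if_neg hsq, if_neg hsq]
    simp only [oscPart, if_neg hsq, ENNReal.toReal_ofNat]
    push_cast
    simp
    ring

end ArcsinSum

namespace ArcsinSum

open MeasureTheory Set Filter Topology
open scoped Real

/-- The number of roots modulo `n` of the monic quadratic polynomial of discriminant `D`. -/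
def rho (D : ℤ) (n : ℕ) : ℕ :=
  ((Finset.range n).filter fun t : ℕ => (n : ℤ) ∣ (t : ℤ) ^ 2 + D % 4 * t - D / 4).card

lemma lintegral_parabola {s β : ℝ} (hs : 0 ≤ s) {n : ℝ} (hn : 0 < n) :
    ∫⁻ x, ENNReal.ofReal ((s ^ 2 - (2 * n * x - β) ^ 2) / (4 * n)) =
      ENNReal.ofReal (s ^ 3 / (6 * n ^ 2)) := by
  set u := (β - s) / (2 * n) with hu
  set v := (β + s) / (2 * n) with hv
  have huv : u ≤ v := by
    rw [hu, hv]
    gcongr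
    linarith
  have hu' : 2 * n * u - β = -s := by rw [hu]; field_simp; ring
  have hv' : 2 * n * v - β = s := by rw [hv]; field_simp; ring
  have h1 : ∫⁻ x, ENNReal.ofReal ((s ^ 2 - (2 * n * x - β) ^ 2) / (4 * n)) =
      ∫⁻ x in Ioc u v, ENNReal.ofReal ((s ^ 2 - (2 * n * x - β) ^ 2) / (4 * n)) := by
    rw [← lintegral_indicator measurableSet_Ioc]
    refine lintegral_congr fun x => ?_
    by_cases hx : x ∈ Ioc u v
    · rw [indicator_of_mem hx]
    · rw [indicator_of_notMem hx, ENNReal.ofReal_eq_zero]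
      refine div_nonpos_of_nonpos_of_nonneg ?_ (by positivity)
      rw [mem_Ioc, not_and_or, not_lt, not_le] at hx
      rcases hx with hx | hx
      · have : n * x ≤ n * u := by gcongr
        nlinarith
      · have : n * v ≤ n * x := by gcongr
        nlinarith
  have hc : Continuous fun x : ℝ => (s ^ 2 - (2 * n * x - β) ^ 2) / (4 * n) := by fun_prop
  rw [h1, ← ofReal_integral_eq_lintegral_ofReal (hc.integrableOn_Ioc), ← intervalIntegral.integral_of_le huv,
    intervalIntegral.integral_comp_mul_sub (fun y => (s ^ 2 - y ^ 2) / (4 * n))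
      (by positivity : 2 * n ≠ 0), hu', hv', intervalIntegral.integral_div,
    intervalIntegral.integral_sub (continuous_const.intervalIntegrable _ _)
      ((continuous_pow 2).intervalIntegrable _ _), integral_pow]
  · congr 1
    simp
    field_simp
    ring
  · rw [EventuallyLE, ae_restrict_iff' measurableSet_Ioc]
    refine ae_of_all _ fun x hx => div_nonneg ?_ (by positivity)
    have h2 : n * u ≤ n * x := by gcongr; exact hx.1.le
    have h3 : n * x ≤ n * v := by gcongr; exact hx.2
    nlinarith

lemma tsum_lintegral_translate {F : ℝ → ENNReal} (hF : Measurable F) :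
    ∑' m : ℤ, ∫⁻ x in Ioc 0 1, F (x - m) = ∫⁻ x, F x := by
  have hdom := isAddFundamentalDomain_Ioc (T := (1 : ℝ)) one_pos 0
  rw [zero_add] at hdom
  have h1 : (⋃ m : ℤ, Ioc (-(m : ℝ)) (-m + 1)) = univ := by
    rw [← iUnion_Ioc_add_intCast (0 : ℝ)]
    ext y
    simp only [mem_iUnion]
    refine (Equiv.neg ℤ).exists_congr fun m => ?_
    simp
  rw [← setLIntegral_univ, ← h1, lintegral_iUnion (fun n => measurableSet_Ioc)]
  · refine tsum_congr fun m => ?_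
    have hp : Ioc (0 : ℝ) 1 = (fun u : ℝ => u + (-m : ℝ)) ⁻¹' Ioc (-(m : ℝ)) (-m + 1) := by
      ext u
      simp only [mem_Ioc, mem_preimage]
      constructor <;> rintro ⟨h1, h2⟩ <;> constructor <;> linarith
    rw [← (measurePreserving_add_right volume (-(m : ℝ))).setLIntegral_comp_preimage
      measurableSet_Ioc hF, ← hp]
    simp only [sub_eq_add_neg]
  · intro i j hij
    rw [Function.onFun, Set.disjoint_left]
    rintro y ⟨h1, h2⟩ ⟨h3, h4⟩
    have h5 : (i : ℝ) < j + 1 := by linarith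
    have h6 : (j : ℝ) < i + 1 := by linarith
    have h7 : i < j + 1 := by exact_mod_cast h5
    have h8 : j < i + 1 := by exact_mod_cast h6
    omega

/-- Index set for forms with negative leading coefficient. -/
def formIndex (D : ℤ) : Set (ℕ × ℕ × ℤ) :=
  {z | z.2.1 < z.1 ∧ (z.1 : ℤ) ∣ (z.2.1 : ℤ) ^ 2 + D % 4 * z.2.1 - D / 4}

/-- The form with leading coefficient `-n` attached to the root `r + n m`. -/
def indexForm (D : ℤ) (z : ℕ × ℕ × ℤ) : ℤ × ℤ × ℤ :=
  (-z.1, 2 * (z.2.1 + z.1 * z.2.2) + D % 4,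
    -(((z.2.1 + z.1 * z.2.2) ^ 2 + D % 4 * (z.2.1 + z.1 * z.2.2) - D / 4) / z.1))

lemma root_shift_dvd (D : ℤ) (n r m : ℤ) : n ∣ (r + n * m) ^ 2 + D % 4 * (r + n * m) - D / 4 ↔
    n ∣ r ^ 2 + D % 4 * r - D / 4 := by
  rw [show (r + n * m) ^ 2 + D % 4 * (r + n * m) - D / 4 =
    (r ^ 2 + D % 4 * r - D / 4) + n * (m * (2 * r + n * m + D % 4)) by ring]
  exact (Int.dvd_add_left (dvd_mul_right _ _))

lemma bijOn_indexForm {D : ℤ} (hD : D % 4 = 0 ∨ D % 4 = 1) :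
    BijOn (indexForm D) (formIndex D) (negForms D) := by
  have he : (D % 4) ^ 2 = D % 4 := by rcases hD with h | h <;> rw [h] <;> norm_num
  have hD4 : D = 4 * (D / 4) + D % 4 := (Int.mul_ediv_add_emod D 4).symm
  refine BijOn.mk ?_ ?_ ?_
  · rintro ⟨n, r, m⟩ ⟨h1, h2⟩
    have h1' : r < n := h1
    have hd := (root_shift_dvd D n r m).2 h2
    obtain ⟨q, hq⟩ := hd
    have hn : (n : ℤ) ≠ 0 := by
      have : n ≠ 0 := by omega
      exact_mod_cast this
    refine ⟨?_, ?_⟩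
    · simp only [disc, indexForm]
      rw [hq, Int.mul_ediv_cancel_left _ hn]
      generalize (r : ℤ) + n * m = t at *
      nlinarith
    · simp only [indexForm]
      omega
  · rintro ⟨n, r, m⟩ ⟨h1, h2⟩ ⟨n', r', m'⟩ ⟨h1', h2'⟩ h
    simp only [indexForm, Prod.mk.injEq] at h h1 h1' ⊢
    obtain ⟨e1, e2, -⟩ := h
    have hn : n = n' := by omega
    subst hn
    have e3 : (r : ℤ) + n * m = r' + n * m' := by omega
    have hr : r = r' := by
      have := congrArg (· % (n : ℤ)) e3
      simp only [Int.add_mul_emod_self_left] at this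
      rw [Int.emod_eq_of_lt (by omega) (by omega), Int.emod_eq_of_lt (by omega) (by omega)] at this
      exact_mod_cast this
    subst hr
    refine ⟨rfl, rfl, ?_⟩
    have hn : (n : ℤ) ≠ 0 := by omega
    exact mul_left_cancel₀ hn (by linarith)
  · rintro ⟨a, b, c⟩ ⟨h1, h2⟩
    simp only [disc] at h1 h2
    have hb : b % 2 = D % 4 := by
      have h3 : b ^ 2 % 4 = D % 4 := by
        rw [← h1, show b ^ 2 - 4 * a * c = b ^ 2 + 4 * (-(a * c)) by ring,
          Int.add_mul_emod_self_left]
      rcases Int.emod_two_eq_zero_or_one b with h | h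
      · have : b = 2 * (b / 2) := by omega
        rw [this, mul_pow] at h3
        omega
      · have : b = 2 * (b / 2) + 1 := by omega
        rw [this, show (2 * (b / 2) + 1) ^ 2 = 4 * ((b / 2) ^ 2 + b / 2) + 1 by ring] at h3
        omega
    have ht : b = 2 * (b / 2) + D % 4 := by omega
    generalize b / 2 = t at ht
    have hn : ((-a).toNat : ℤ) = -a := Int.toNat_of_nonneg (by omega)
    have hr : ((t % -a).toNat : ℤ) = t % -a := Int.toNat_of_nonneg (Int.emod_nonneg _ (by omega))
    have htt : t % -a + -a * (t / -a) = t := Int.emod_add_mul_ediv t (-a)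
    have hq : t ^ 2 + D % 4 * t - D / 4 = -a * (-c) := by
      subst ht
      nlinarith
    refine ⟨((-a).toNat, (t % -a).toNat, t / -a), ⟨?_, ?_⟩, ?_⟩
    · simp only []
      have := Int.emod_lt_of_pos t (by omega : 0 < -a)
      omega
    · simp only []
      rw [hn, hr, ← root_shift_dvd D (-a) (t % -a) (t / -a), htt, hq]
      exact dvd_mul_right _ _
    · simp only [indexForm, hn, hr, htt, hq, Prod.mk.injEq]
      refine ⟨neg_neg a, ht.symm, ?_⟩
      rw [Int.mul_ediv_cancel_left _ (by omega), neg_neg]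

lemma qv_indexForm {D : ℤ} (hD0 : 0 < D) (hD : D % 4 = 0 ∨ D % 4 = 1) {z : ℕ × ℕ × ℤ}
    (hz : z ∈ formIndex D) (x : ℝ) : qv (indexForm D z) x =
      (√D ^ 2 - (2 * z.1 * (x - z.2.2) - (2 * z.2.1 + (D % 4 : ℤ))) ^ 2) / (4 * z.1) := by
  have hn : (0 : ℝ) < z.1 := by
    have : 0 < z.1 := by have := hz.1; omega
    exact_mod_cast this
  have h1 := ((bijOn_indexForm hD).mapsTo hz).1
  rw [Real.sq_sqrt (by exact_mod_cast hD0.le)]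
  have h2 : (D : ℝ) = ((disc (indexForm D z) : ℤ) : ℝ) := by rw [h1]
  rw [h2]
  simp only [disc, qv]
  generalize hc : (indexForm D z).2.2 = c
  have ha : (indexForm D z).1 = -(z.1 : ℤ) := rfl
  have hb : (indexForm D z).2.1 = 2 * (z.2.1 + z.1 * z.2.2) + D % 4 := rfl
  rw [ha, hb]
  push_cast
  field_simp
  ring

/-- The integral of the sum over `negForms D` over a period. -/
lemma lintegral_posSum_negForms {D : ℤ} (hD0 : 0 < D) (hD : D % 4 = 0 ∨ D % 4 = 1) :
    ∫⁻ x in Ioc 0 1, posSum (negForms D) x =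
      ∑' n : ℕ, ENNReal.ofReal (√D ^ 3 / 6 * (rho D n / (n : ℝ) ^ 2)) := by
  classical
  simp only [posSum]
  rw [lintegral_tsum fun Q : negForms D =>
      (continuous_qv (Q : ℤ × ℤ × ℤ)).measurable.ennreal_ofReal.aemeasurable,
    tsum_bijOn (bijOn_indexForm hD) fun Q => ∫⁻ x in Ioc 0 1, ENNReal.ofReal (qv Q x),
    tsum_subtype (formIndex D) (fun z => ∫⁻ x in Ioc 0 1, ENNReal.ofReal (qv (indexForm D z) x)),
    ENNReal.tsum_prod']
  refine tsum_congr fun n => ?_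
  rw [ENNReal.tsum_prod', rho]
  have key : ∀ r : ℕ, ∑' m : ℤ, (formIndex D).indicator
      (fun z => ∫⁻ x in Ioc 0 1, ENNReal.ofReal (qv (indexForm D z) x)) (n, r, m) =
      if r < n ∧ (n : ℤ) ∣ (r : ℤ) ^ 2 + D % 4 * r - D / 4 then
        ENNReal.ofReal (√D ^ 3 / (6 * (n : ℝ) ^ 2)) else 0 := by
    intro r
    split_ifs with h
    · have hn : (0 : ℝ) < n := by
        have : 0 < n := by omega
        exact_mod_cast this
      rw [← lintegral_parabola (β := 2 * r + (D % 4 : ℤ)) (Real.sqrt_nonneg _) hn,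
        ← tsum_lintegral_translate (by fun_prop)]
      refine tsum_congr fun m => ?_
      have hz : (n, r, m) ∈ formIndex D := h
      rw [indicator_of_mem hz]
      simp only [qv_indexForm hD0 hD hz]
    · rw [ENNReal.tsum_eq_zero]
      intro m
      exact indicator_of_notMem (show (n, r, m) ∉ formIndex D from h) _
  rw [tsum_congr key, tsum_eq_sum (s := (Finset.range n).filter fun t : ℕ =>
    (n : ℤ) ∣ (t : ℤ) ^ 2 + D % 4 * t - D / 4)]
  · rw [Finset.sum_congr rfl (g := fun _ => ENNReal.ofReal (√D ^ 3 / (6 * (n : ℝ) ^ 2)))]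
    · rw [Finset.sum_const, nsmul_eq_mul, ← ENNReal.ofReal_natCast,
        ← ENNReal.ofReal_mul (by positivity)]
      congr 1
      ring
    · intro r hr
      rw [Finset.mem_filter, Finset.mem_range] at hr
      rw [if_pos hr]
  · intro r hr
    rw [Finset.mem_filter, Finset.mem_range] at hr
    rw [if_neg hr]

lemma integral_bern2 (k : ℤ) (hk : 0 < k) : ∫ x in (0 : ℝ)..1, bern2 (k * x) = 0 := by
  have hk' : (k : ℝ) ≠ 0 := by exact_mod_cast hk.ne'
  rw [intervalIntegral.integral_comp_mul_left (fun y => bern2 y) hk', mul_zero, mul_one]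
  have hper : Function.Periodic bern2 1 := fun y => by
    simpa using bern2_add_int y 1
  have h1 : ∫ y in (0 : ℝ)..0 + k • (1 : ℝ), bern2 y = k • ∫ y in (0 : ℝ)..0 + 1, bern2 y :=
    hper.intervalIntegral_add_zsmul_eq k 0 (fun t₁ t₂ => by
      refine (intervalIntegrable_const (c := (1 : ℝ))).mono_fun
        measurable_bern2.aestronglyMeasurable (ae_of_all _ fun y => ?_)
      simpa using abs_bern2_le y)
  have h2 : ∫ y in (0 : ℝ)..1, bern2 y = 0 := by
    have : ∫ y in (0 : ℝ)..1, bern2 y = ∫ y in (0 : ℝ)..1, (y ^ 2 - y + 1 / 6) := by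
      rw [intervalIntegral.integral_of_le zero_le_one, intervalIntegral.integral_of_le zero_le_one,
        integral_Ioc_eq_integral_Ioo, integral_Ioc_eq_integral_Ioo]
      refine setIntegral_congr_fun measurableSet_Ioo fun y hy => ?_
      simp only [bern2, Int.fract_eq_self.2 ⟨hy.1.le, hy.2⟩]
    have hc (f : ℝ → ℝ) (hf : Continuous f) : IntervalIntegrable f volume 0 1 :=
      hf.intervalIntegrable _ _
    rw [this, intervalIntegral.integral_add (hc _ (by fun_prop)) (hc _ (by fun_prop)),
      intervalIntegral.integral_sub (hc _ (by fun_prop)) (hc _ (by fun_prop)),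
      integral_pow, integral_id]
    norm_num
  simp only [zsmul_eq_mul, mul_one, zero_add] at h1
  rw [h1, h2]
  simp

end ArcsinSum

namespace ArcsinSum

open MeasureTheory Set Filter Topology
open scoped Real

lemma lintegral_posSum_eq_ofReal {D : ℤ} (hD0 : 0 < D) (hD : D % 4 = 0 ∨ D % 4 = 1)
    (hs : Summable fun n : ℕ => (rho D n : ℝ) / (n : ℝ) ^ 2) :
    ∫⁻ x in Ioc 0 1, posSum (negForms D) x =
      ENNReal.ofReal (√D ^ 3 / 6 * ∑' n : ℕ, (rho D n : ℝ) / (n : ℝ) ^ 2) := by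
  rw [lintegral_posSum_negForms hD0 hD, ← tsum_mul_left,
    ENNReal.ofReal_tsum_of_nonneg (fun n => by positivity) (hs.mul_left _)]

lemma integral_oscPart {D : ℤ} (hD0 : 0 < D) : ∫ x in (0 : ℝ)..1, oscPart D x = 0 := by
  by_cases h : IsSquare D
  · obtain ⟨k, hk, -, hk'⟩ := exists_sqrt_eq hD0 h
    simp only [oscPart, if_pos h, hk']
    rw [intervalIntegral.integral_const_mul, integral_bern2 k hk, mul_zero]
  · simp [oscPart, h]

lemma meanVal_eq_tsum {D : ℤ} (hD0 : 0 < D) (hD : D % 4 = 0 ∨ D % 4 = 1)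
    (hs : Summable fun n : ℕ => (rho D n : ℝ) / (n : ℝ) ^ 2) :
    meanVal D = √D ^ 3 / 6 * ∑' n : ℕ, (rho D n : ℝ) / (n : ℝ) ^ 2 := by
  have h1 := lintegral_posSum_eq_ofReal hD0 hD hs
  have hae := ae_posSum_eq hD0 (h1 ▸ ENNReal.ofReal_ne_top)
  have hosc : IntervalIntegrable (oscPart D) volume 0 1 := by
    refine (intervalIntegrable_const (c := (1 : ℝ))).mono_fun
      (measurable_oscPart D).aestronglyMeasurable (ae_of_all _ fun y => ?_)
    have := abs_oscPart_le D y
    simp only [Real.norm_eq_abs, abs_one]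
    linarith
  have hint : ∫ x in (0 : ℝ)..1, (meanVal D + oscPart D x) = meanVal D := by
    rw [intervalIntegral.integral_add intervalIntegrable_const hosc, integral_oscPart hD0]
    simp
  have hnn : 0 ≤ᵐ[volume.restrict (Ioc (0 : ℝ) 1)] fun x => meanVal D + oscPart D x :=
    ae_restrict_of_ae (hae.mono fun x hx => hx.2)
  have hnn' : 0 ≤ meanVal D := by
    rw [← hint, intervalIntegral.integral_of_le zero_le_one]
    exact integral_nonneg_of_ae hnn
  have h2 : ∫⁻ x in Ioc 0 1, posSum (negForms D) x = ENNReal.ofReal (meanVal D) := by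
    rw [lintegral_congr_ae (ae_restrict_of_ae (hae.mono fun x hx => hx.1)),
      ← ofReal_integral_eq_lintegral_ofReal _ hnn, ← intervalIntegral.integral_of_le zero_le_one,
      hint]
    exact ((intervalIntegrable_const.add hosc).1)
  rw [h2] at h1
  exact (ENNReal.ofReal_eq_ofReal_iff hnn'
    (mul_nonneg (by positivity) (tsum_nonneg fun n => by positivity))).1 h1

end ArcsinSum

namespace ArcsinSum

/-- The roots of `t² + b t + c` modulo `n`. -/
def quadRoots (b c : ℤ) (n : ℕ) : Set (ZMod n) := {t | t ^ 2 + b * t + c = 0}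

lemma card_quadRoots_mul (b c : ℤ) {m n : ℕ} (h : m.Coprime n) :
    Nat.card (quadRoots b c (m * n)) =
      Nat.card (quadRoots b c m) * Nat.card (quadRoots b c n) := by
  rw [← Nat.card_prod, ← Nat.card_congr (Equiv.Set.prod _ _)]
  refine Nat.card_congr ((ZMod.chineseRemainder h).toEquiv.subtypeEquiv fun t => ?_)
  change t ^ 2 + b * t + c = 0 ↔ _
  rw [← (ZMod.chineseRemainder h).map_eq_zero_iff]
  simp only [map_add, map_mul, map_pow, map_intCast, Prod.ext_iff, quadRoots]
  rfl

lemma rho_eq_card (D : ℤ) {n : ℕ} (hn : n ≠ 0) :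
    rho D n = Nat.card (quadRoots (D % 4) (-(D / 4)) n) := by
  have : NeZero n := ⟨hn⟩
  classical
  have key (t : ℕ) : (n : ℤ) ∣ (t : ℤ) ^ 2 + D % 4 * t - D / 4 ↔
      (t : ZMod n) ∈ quadRoots (D % 4) (-(D / 4)) n := by
    rw [← ZMod.intCast_zmod_eq_zero_iff_dvd, quadRoots]
    push_cast
    rw [sub_eq_add_neg]
    rfl
  rw [Nat.subtype_card (Finset.univ.filter (· ∈ quadRoots (D % 4) (-(D / 4)) n)) (by simp), rho]
  refine Finset.card_bij' (fun t _ => (t : ZMod n)) (fun z _ => z.val) ?_ ?_ ?_ ?_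
  · intro t ht
    simpa using (key t).1 (Finset.mem_filter.1 ht).2
  · intro z hz
    simp only [Finset.mem_filter, Finset.mem_range]
    refine ⟨z.val_lt, (key _).2 ?_⟩
    simpa using hz
  · intro t ht
    exact ZMod.val_cast_of_lt (Finset.mem_range.1 (Finset.mem_filter.1 ht).1)
  · intro z hz
    exact ZMod.natCast_zmod_val z

lemma rho_mul (D : ℤ) {m n : ℕ} (hm : m ≠ 0) (hn : n ≠ 0) (h : m.Coprime n) :
    rho D (m * n) = rho D m * rho D n := by
  rw [rho_eq_card D hm, rho_eq_card D hn, rho_eq_card D (mul_ne_zero hm hn),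
    card_quadRoots_mul _ _ h]

lemma rho_one (D : ℤ) : rho D 1 = 1 := by simp [rho]

end ArcsinSum

namespace ArcsinSum

lemma rho_eq_card_sq {D : ℤ} (hD : D % 4 = 0 ∨ D % 4 = 1) (n : ℕ) :
    rho D n = ((Finset.range (2 * n)).filter fun b : ℕ => 4 * (n : ℤ) ∣ (b : ℤ) ^ 2 - D).card := by
  have he : (D % 4) ^ 2 = D % 4 := by rcases hD with h | h <;> rw [h] <;> norm_num
  have key (t : ℤ) : (n : ℤ) ∣ t ^ 2 + D % 4 * t - D / 4 ↔
      4 * (n : ℤ) ∣ (2 * t + D % 4) ^ 2 - D := by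
    have : (2 * t + D % 4) ^ 2 - D = 4 * (t ^ 2 + D % 4 * t - D / 4) := by
      have := Int.mul_ediv_add_emod D 4
      nlinarith
    rw [this]
    exact (mul_dvd_mul_iff_left (by norm_num)).symm
  have hpar (b : ℕ) (h : 4 * (n : ℤ) ∣ (b : ℤ) ^ 2 - D) : (b : ℤ) = 2 * (b / 2 : ℕ) + D % 4 := by
    have h4 : (4 : ℤ) ∣ (b : ℤ) ^ 2 - D := (dvd_mul_right _ _).trans h
    rcases Nat.even_or_odd' b with ⟨c, rfl | rfl⟩
    · push_cast at h4
      have : ((2 * c : ℤ)) ^ 2 = 4 * c ^ 2 := by ring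
      push_cast
      omega
    · push_cast at h4
      have : ((2 * c + 1 : ℤ)) ^ 2 = 4 * (c ^ 2 + c) + 1 := by ring
      push_cast
      omega
  rw [rho]
  refine Finset.card_bij' (fun t _ => 2 * t + (D % 4).toNat) (fun b _ => b / 2) ?_ ?_ ?_ ?_
  · intro t ht
    simp only [Finset.mem_filter, Finset.mem_range] at ht ⊢
    refine ⟨by omega, ?_⟩
    have := (key t).1 ht.2
    push_cast
    rwa [Int.toNat_of_nonneg (by omega)]
  · intro b hb
    simp only [Finset.mem_filter, Finset.mem_range] at hb ⊢
    refine ⟨by omega, (key _).2 ?_⟩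
    rw [← hpar b hb.2]
    exact hb.2
  · intro t ht
    omega
  · intro b hb
    simp only [Finset.mem_filter, Finset.mem_range] at hb
    have := hpar b hb.2
    omega

/-- A function periodic modulo `n` is counted `p` times on `range (p * n)`. -/
lemma card_filter_range_mul (n p : ℕ) (P : ℕ → Prop) [DecidablePred P]
    (hP : ∀ k, P (k + n) ↔ P k) :
    ((Finset.range (p * n)).filter P).card = p * ((Finset.range n).filter P).card := by
  induction p with
  | zero => simp
  | succ p ih =>
    rw [add_mul, one_mul, add_mul, one_mul, ← ih, Finset.range_eq_Ico,
      ← Finset.Ico_union_Ico_eq_Ico (Nat.zero_le (p * n)) (Nat.le_add_right _ _),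
      Finset.filter_union, Finset.card_union_of_disjoint, Nat.filter_Ico_card_eq_of_periodic,
      Nat.count_eq_card_filter_range]
    · simp only [Finset.range_eq_Ico]
    · exact fun k => propext (hP k)
    · exact Finset.disjoint_filter_filter (Finset.Ico_disjoint_Ico_consecutive _ _ _)

lemma prime_dvd_of_four_mul_dvd {p : ℕ} (hp : p.Prime) {b D : ℤ}
    (h : 4 * (p : ℤ) ∣ b ^ 2 - (p : ℤ) ^ 2 * D) : (p : ℤ) ∣ b := by
  have h1 : (p : ℤ) ∣ b ^ 2 := by
    have h2 : (p : ℤ) ∣ b ^ 2 - (p : ℤ) ^ 2 * D := (dvd_mul_left _ _).trans h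
    exact (dvd_sub_left (Dvd.intro _ (by ring : (p : ℤ) * (p * D) = _))).1 h2
  exact (Nat.prime_iff_prime_int.1 hp).dvd_of_dvd_pow h1

lemma emod_four_sq_mul {D : ℤ} (hD : D % 4 = 0 ∨ D % 4 = 1) (p : ℤ) :
    (p ^ 2 * D) % 4 = 0 ∨ (p ^ 2 * D) % 4 = 1 := by
  have hp : p ^ 2 % 4 = 0 ∨ p ^ 2 % 4 = 1 := by
    rcases Int.even_or_odd' p with ⟨c, rfl | rfl⟩
    · left
      rw [show (2 * c) ^ 2 = 4 * c ^ 2 by ring]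
      omega
    · right
      rw [show (2 * c + 1) ^ 2 = 4 * (c ^ 2 + c) + 1 by ring]
      omega
  rw [Int.mul_emod]
  rcases hp with h | h <;> rcases hD with h' | h' <;> rw [h, h'] <;> norm_num

lemma rho_sq_mul_prime_pow {D : ℤ} (hD : D % 4 = 0 ∨ D % 4 = 1) {p : ℕ} (hp : p.Prime) (k : ℕ) :
    rho ((p : ℤ) ^ 2 * D) (p ^ (k + 2)) = p * rho D (p ^ k) := by
  rw [rho_eq_card_sq (emod_four_sq_mul hD p), rho_eq_card_sq hD, ← card_filter_range_mul]
  · have hp0 : (p : ℤ) ≠ 0 := by exact_mod_cast hp.ne_zero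
    have key (b : ℤ) : 4 * ((p ^ (k + 2) : ℕ) : ℤ) ∣ (p * b) ^ 2 - (p : ℤ) ^ 2 * D ↔
        4 * ((p ^ k : ℕ) : ℤ) ∣ b ^ 2 - D := by
      push_cast
      rw [show 4 * (p : ℤ) ^ (k + 2) = p ^ 2 * (4 * p ^ k) by ring,
        show ((p : ℤ) * b) ^ 2 - p ^ 2 * D = p ^ 2 * (b ^ 2 - D) by ring]
      exact mul_dvd_mul_iff_left (pow_ne_zero _ hp0)
    have hdiv (b : ℕ) (h : 4 * ((p ^ (k + 2) : ℕ) : ℤ) ∣ (b : ℤ) ^ 2 - (p : ℤ) ^ 2 * D) :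
        p * (b / p) = b := by
      refine Nat.mul_div_cancel' (Int.natCast_dvd_natCast.1 (prime_dvd_of_four_mul_dvd hp
        (D := D) (dvd_trans ?_ h)))
      push_cast
      exact mul_dvd_mul_left _ (dvd_pow_self _ (by omega))
    refine Finset.card_bij' (fun b _ => b / p) (fun b _ => p * b) ?_ ?_ ?_ ?_
    · intro b hb
      simp only [Finset.mem_filter, Finset.mem_range] at hb ⊢
      have h1 := hdiv b hb.2
      refine ⟨?_, (key _).1 ?_⟩
      · refine lt_of_mul_lt_mul_left (a := p) ?_ (Nat.zero_le p)
        rw [h1]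
        refine hb.1.trans_eq ?_
        ring
      · have h2 : (p : ℤ) * ((b / p : ℕ) : ℤ) = b := by exact_mod_cast h1
        rw [h2]
        exact hb.2
    · intro b hb
      simp only [Finset.mem_filter, Finset.mem_range] at hb ⊢
      refine ⟨?_, ?_⟩
      · calc p * b < p * (p * (2 * p ^ k)) := Nat.mul_lt_mul_of_pos_left hb.1 hp.pos
          _ = 2 * p ^ (k + 2) := by ring
      · rw [Nat.cast_mul]
        exact (key _).2 hb.2
    · intro b hb
      exact hdiv b (Finset.mem_filter.1 hb).2
    · intro b hb
      exact Nat.mul_div_cancel_left b hp.pos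
  · intro b
    have : ((b + 2 * p ^ k : ℕ) : ℤ) ^ 2 - D = (b ^ 2 - D) + 4 * ((p ^ k : ℕ) : ℤ) * (b + (p ^ k : ℕ)) := by
      push_cast
      ring
    rw [this]
    exact Int.dvd_add_left (dvd_mul_right _ _)

end ArcsinSum

namespace ArcsinSum

lemma sq_add_emod_four {D : ℤ} (hD : D % 4 = 0 ∨ D % 4 = 1) (t : ℤ) :
    (2 * t + D % 4) ^ 2 = 4 * (t ^ 2 + D % 4 * t - D / 4) + D := by
  have he : (D % 4) ^ 2 = D % 4 := by rcases hD with h | h <;> rw [h] <;> norm_num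
  have := Int.mul_ediv_add_emod D 4
  nlinarith

lemma rho_prime_pow_succ {D : ℤ} (hD : D % 4 = 0 ∨ D % 4 = 1) {p : ℕ} (hp : p.Prime)
    (hpD : ¬ (p : ℤ) ∣ D) {k : ℕ} (hk : k ≠ 0) : rho D (p ^ (k + 1)) = rho D (p ^ k) := by
  have hp' := Nat.prime_iff_prime_int.1 hp
  set f : ℤ → ℤ := fun t => t ^ 2 + D % 4 * t - D / 4 with hf
  have hunit (t : ℤ) (ht : (p : ℤ) ∣ f t) : ¬ (p : ℤ) ∣ 2 * t + D % 4 := by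
    intro h
    have h1 : (p : ℤ) ∣ 4 * f t + D := by
      rw [hf, ← sq_add_emod_four hD]
      exact dvd_pow h two_ne_zero
    exact hpD ((Int.dvd_add_right (ht.mul_left 4)).1 h1)
  have hshift (t u : ℤ) : f (t + u) = f t + u * (2 * t + D % 4) + u ^ 2 := by
    rw [hf]; ring
  have hpk : (p : ℤ) ∣ (p : ℤ) ^ k := dvd_pow_self _ hk
  have hmod (t : ℕ) : ∃ s : ℤ, ((t % p ^ k : ℕ) : ℤ) = t + (p : ℤ) ^ k * s := by
    refine ⟨-(t / p ^ k : ℕ), ?_⟩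
    have := Nat.mod_add_div t (p ^ k)
    zify at this ⊢
    linarith
  have hdvdk (t s : ℤ) (h : (p : ℤ) ^ k ∣ f t) : (p : ℤ) ^ k ∣ f (t + (p : ℤ) ^ k * s) := by
    rw [hshift]
    refine dvd_add (dvd_add h ?_) ?_
    · exact (dvd_mul_right _ _).mul_right _
    · exact (dvd_mul_right _ _).trans (dvd_pow_self _ two_ne_zero)
  have h2k : (p : ℤ) ^ (k + 1) ∣ ((p : ℤ) ^ k) ^ 2 := by
    rw [← pow_mul]
    exact pow_dvd_pow _ (by omega)
  rw [rho, rho]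
  push_cast
  refine Finset.card_bij (fun t _ => t % p ^ k) ?_ ?_ ?_
  · intro t ht
    simp only [Finset.mem_filter, Finset.mem_range] at ht ⊢
    refine ⟨Nat.mod_lt _ (pow_pos hp.pos _), ?_⟩
    obtain ⟨s, hs⟩ := hmod t
    rw [hs]
    exact hdvdk t s ((pow_dvd_pow _ (Nat.le_succ k)).trans ht.2)
  · intro t ht u hu htu
    simp only [Finset.mem_filter, Finset.mem_range] at ht hu
    have hs : (p : ℤ) ^ k ∣ (u : ℤ) - t := by
      have := (Nat.modEq_iff_dvd.1 (show t ≡ u [MOD p ^ k] from htu))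
      exact_mod_cast this
    obtain ⟨s, hs⟩ := hs
    have h1 : (p : ℤ) ^ (k + 1) ∣ ((u : ℤ) - t) * (2 * t + D % 4) := by
      have h2 : ((u : ℤ) - t) * (2 * t + D % 4) = f u - f t - (p ^ k) ^ 2 * s ^ 2 := by
        have := hshift t (u - t)
        rw [add_sub_cancel] at this
        rw [this, hs]
        ring
      rw [h2]
      exact dvd_sub (dvd_sub hu.2 ht.2) (h2k.mul_right _)
    have hpt : (p : ℤ) ∣ f t := (dvd_pow_self _ (Nat.succ_ne_zero k)).trans ht.2
    have h3 : (p : ℤ) ^ (k + 1) ∣ (u : ℤ) - t :=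
      (hp'.coprime_iff_not_dvd.2 (hunit t hpt)).pow_left.dvd_of_dvd_mul_right h1
    have h4 : t ≡ u [MOD p ^ (k + 1)] := by
      rw [Nat.modEq_iff_dvd]
      exact_mod_cast h3
    exact h4.eq_of_lt_of_lt ht.1 hu.1
  · intro r hr
    simp only [Finset.mem_filter, Finset.mem_range] at hr
    obtain ⟨q, hq⟩ := hr.2
    have hcop : IsCoprime (p : ℤ) (2 * r + D % 4) :=
      hp'.coprime_iff_not_dvd.2 (hunit r (hpk.trans hr.2))
    obtain ⟨x, y, hxy⟩ := hcop
    -- solve `q + s (2 r + ε) ≡ 0 mod p`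
    set s : ℕ := ((-q * y) % p).toNat with hs
    have hp0 : (0 : ℤ) < p := by exact_mod_cast hp.pos
    have hs' : (s : ℤ) = (-q * y) % p := Int.toNat_of_nonneg (Int.emod_nonneg _ hp0.ne')
    have hslt : s < p := by
      have := Int.emod_lt_of_pos (-q * y) hp0
      omega
    refine ⟨r + p ^ k * s, ?_, ?_⟩
    · simp only [Finset.mem_filter, Finset.mem_range]
      refine ⟨?_, ?_⟩
      · calc r + p ^ k * s < p ^ k + p ^ k * s := by omega
          _ = p ^ k * (s + 1) := by ring
          _ ≤ p ^ k * p := Nat.mul_le_mul_left _ hslt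
          _ = p ^ (k + 1) := by ring
      · push_cast
        change _ ∣ f (r + p ^ k * s)
        rw [hshift, mul_pow]
        refine dvd_add ?_ (h2k.mul_right _)
        have h5 : f r = p ^ k * q := hq
        rw [h5, mul_assoc, ← mul_add, pow_succ]
        refine mul_dvd_mul_left _ ?_
        have h6 : (-q * y) % p = -q * y - p * ((-q * y) / p) := by
          have := Int.emod_add_mul_ediv (-q * y) p
          linarith
        rw [hs', h6]
        refine ⟨q * x - ((-q * y) / p) * (2 * r + D % 4), ?_⟩
        linear_combination -q * hxy
    · simp only [Nat.add_mul_mod_self_left]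
      exact Nat.mod_eq_of_lt hr.1

lemma rho_prime_pow_of_not_dvd {D : ℤ} (hD : D % 4 = 0 ∨ D % 4 = 1) {p : ℕ} (hp : p.Prime)
    (hpD : ¬ (p : ℤ) ∣ D) (k : ℕ) : rho D (p ^ (k + 1)) = rho D p := by
  induction k with
  | zero => simp
  | succ k ih => rw [rho_prime_pow_succ hD hp hpD (Nat.succ_ne_zero k), ih]

lemma rho_prime {D : ℤ} (hD : D % 4 = 0 ∨ D % 4 = 1) {p : ℕ} (hp : p.Prime) :
    (rho D p : ℤ) = 1 + kroneckerSym D p := by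
  have hp0 := hp.ne_zero
  rcases hp.eq_two_or_odd' with rfl | hodd
  · have hk : kroneckerSym D 2 = if D % 2 = 0 then 0 else if D % 8 = 1 ∨ D % 8 = 7 then 1 else -1 := by
      have h2 : (Nat.factorization 2) 2 = 1 := Nat.prime_two.factorization_self
      rw [kroneckerSym, if_neg two_ne_zero, h2]
      simp
    have hr : rho D 2 = ((Finset.range 4).filter fun b : ℕ => (8 : ℤ) ∣ (b : ℤ) ^ 2 - D).card := by
      rw [rho_eq_card_sq hD]
      norm_num
    rw [hk, hr]
    have h8 : ∀ b : ℕ, (8 : ℤ) ∣ (b : ℤ) ^ 2 - D ↔ (b : ℤ) ^ 2 % 8 = D % 8 := by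
      intro b
      rw [← Int.emod_emod_of_dvd D (dvd_refl 8)]
      omega
    simp only [h8]
    have : D % 8 = 0 ∨ D % 8 = 1 ∨ D % 8 = 4 ∨ D % 8 = 5 := by omega
    rcases this with h | h | h | h
    · have h2 : D % 2 = 0 := by omega
      rw [h, if_pos h2]
      decide
    · have h2 : D % 2 ≠ 0 := by omega
      rw [h, if_neg h2]
      decide
    · have h2 : D % 2 = 0 := by omega
      rw [h, if_pos h2]
      decide
    · have h2 : D % 2 ≠ 0 := by omega
      rw [h, if_neg h2]
      decide
  · have := Fact.mk hp
    have hne2 : p ≠ 2 := by rintro rfl; exact absurd hodd (by decide)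
    have hk : kroneckerSym D p = legendreSym p D := by
      have h2 : p.factorization 2 = 0 := Nat.factorization_eq_zero_of_not_dvd
        fun h => absurd ((Nat.prime_dvd_prime_iff_eq Nat.prime_two hp).1 h).symm hne2
      rw [kroneckerSym, if_neg hp0, h2, pow_zero, pow_zero, Nat.div_one, one_mul,
        jacobiSym.legendreSym.to_jacobiSym]
    rw [hk, add_comm, ← legendreSym.card_sqrts p hne2 D, rho_eq_card D hp0]
    have h2 : (2 : ZMod p) ≠ 0 := by
      intro h
      have : ((2 : ℕ) : ZMod p) = 0 := by exact_mod_cast h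
      rw [ZMod.natCast_eq_zero_iff] at this
      exact hne2 ((Nat.prime_dvd_prime_iff_eq hp Nat.prime_two).1 this)
    norm_cast
    rw [Set.toFinset_card, ← Nat.card_eq_fintype_card]
    refine Nat.card_congr (((Equiv.mulLeft₀ 2 h2).trans (Equiv.addRight ((D % 4 : ℤ) : ZMod p))).subtypeEquiv
      fun t => ?_)
    change t ^ 2 + ((D % 4 : ℤ) : ZMod p) * t + ((-(D / 4) : ℤ) : ZMod p) = 0 ↔
      (2 * t + ((D % 4 : ℤ) : ZMod p)) ^ 2 = (D : ZMod p)
    have he : ((D % 4 : ℤ) : ZMod p) ^ 2 = ((D % 4 : ℤ) : ZMod p) := by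
      rcases hD with h | h <;> rw [h] <;> simp
    have h4 : (D : ZMod p) = 4 * ((D / 4 : ℤ) : ZMod p) + ((D % 4 : ℤ) : ZMod p) := by
      conv_lhs => rw [← Int.mul_ediv_add_emod D 4]
      push_cast
      rfl
    generalize ((D % 4 : ℤ) : ZMod p) = ε at *
    rw [h4]
    push_cast
    generalize ((D / 4 : ℤ) : ZMod p) = δ at *
    rw [← sub_eq_zero (b := 4 * δ + ε)]
    have : (2 * t + ε) ^ 2 - (4 * δ + ε) = 2 * 2 * (t ^ 2 + ε * t + -δ) := by
      linear_combination he
    rw [this]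
    simp [h2]

end ArcsinSum

namespace ArcsinSum

lemma kroneckerSym_of_odd (D : ℤ) {n : ℕ} (hn : Odd n) : kroneckerSym D n = jacobiSym D n := by
  have h2 : n.factorization 2 = 0 := Nat.factorization_eq_zero_of_not_dvd
    fun h => (Nat.not_even_iff_odd.2 hn) (even_iff_two_dvd.2 h)
  rw [kroneckerSym, if_neg hn.pos.ne', h2, pow_zero, pow_zero, Nat.div_one, one_mul]

lemma kroneckerSym_two (D : ℤ) : kroneckerSym D 2 =
    if D % 2 = 0 then 0 else if D % 8 = 1 ∨ D % 8 = 7 then 1 else -1 := by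
  have h2 : (Nat.factorization 2) 2 = 1 := Nat.prime_two.factorization_self
  rw [kroneckerSym, if_neg two_ne_zero, h2]
  simp

lemma gcd_prime_eq_one {D : ℤ} {p : ℕ} (hp : p.Prime) (h : ¬ (p : ℤ) ∣ D) : D.gcd p = 1 := by
  rw [Int.gcd_comm, ← Int.isCoprime_iff_gcd_eq_one]
  exact (Nat.prime_iff_prime_int.1 hp).coprime_iff_not_dvd.2 h

lemma kroneckerSym_prime_eq_one_or {D : ℤ} {p : ℕ} (hp : p.Prime)
    (hpD : ¬ (p : ℤ) ∣ D) : kroneckerSym D p = 1 ∨ kroneckerSym D p = -1 := by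
  rcases hp.eq_two_or_odd' with rfl | hodd
  · have hD2 : D % 2 ≠ 0 := by omega
    rw [kroneckerSym_two, if_neg hD2]
    split_ifs <;> simp
  · rw [kroneckerSym_of_odd D hodd]
    exact jacobiSym.eq_one_or_neg_one (gcd_prime_eq_one hp hpD)

lemma kroneckerSym_prime_of_dvd {D : ℤ} {p : ℕ} (hp : p.Prime)
    (hpD : (p : ℤ) ∣ D) : kroneckerSym D p = 0 := by
  rcases hp.eq_two_or_odd' with rfl | hodd
  · rw [kroneckerSym_two]
    exact if_pos (Int.emod_eq_zero_of_dvd hpD)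
  · rw [kroneckerSym_of_odd D hodd, jacobiSym.eq_zero_iff]
    refine ⟨hp.ne_zero, fun h => ?_⟩
    have h1 : p ∣ D.gcd p := Int.dvd_gcd hpD (dvd_refl _)
    rw [h] at h1
    exact hp.one_lt.ne' (Nat.dvd_one.1 h1)

lemma kroneckerSym_mul_sq (D : ℤ) {p : ℕ} (hp : p.Prime) {f : ℤ} (hf : ¬ (p : ℤ) ∣ f) :
    kroneckerSym (D * f ^ 2) p = kroneckerSym D p := by
  rcases hp.eq_two_or_odd' with rfl | hodd
  · obtain ⟨q, hq⟩ := Int.eight_dvd_sq_sub_one_of_odd (k := f)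
      (Int.not_even_iff_odd.1 fun h => hf (even_iff_two_dvd.1 h))
    have h8 : D * f ^ 2 = D + 8 * (D * q) := by
      rw [show f ^ 2 = 8 * q + 1 by omega]
      ring
    rw [kroneckerSym_two, kroneckerSym_two, h8, Int.add_mul_emod_self_left,
      show D + 8 * (D * q) = D + 2 * (4 * (D * q)) by ring, Int.add_mul_emod_self_left]
  · rw [kroneckerSym_of_odd _ hodd, kroneckerSym_of_odd _ hodd, jacobiSym.mul_left,
      jacobiSym.sq_one' (gcd_prime_eq_one hp hf), mul_one]

lemma rho_prime_pow_eq_zero {D₀ f : ℤ} (h : IsFundamentalDiscriminant D₀) {p : ℕ} (hp : p.Prime)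
    (hpD : (p : ℤ) ∣ D₀) (hpf : ¬ (p : ℤ) ∣ f) (k : ℕ) : rho (D₀ * f ^ 2) (p ^ (k + 2)) = 0 := by
  have hD0 : D₀ % 4 = 0 ∨ D₀ % 4 = 1 := by
    rcases h with h | h
    · exact Or.inr h.1
    · exact Or.inl h.1
  have hD : (D₀ * f ^ 2) % 4 = 0 ∨ (D₀ * f ^ 2) % 4 = 1 := by
    rw [mul_comm]; exact emod_four_sq_mul hD0 f
  rw [rho_eq_card_sq hD, Finset.card_eq_zero, Finset.filter_eq_empty_iff]
  intro b _ hb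
  have hp' := Nat.prime_iff_prime_int.1 hp
  have h4 : 4 * (p : ℤ) ^ 2 ∣ (b : ℤ) ^ 2 - D₀ * f ^ 2 := by
    refine dvd_trans ?_ hb
    push_cast
    exact mul_dvd_mul_left _ (pow_dvd_pow _ (by omega))
  have hpb : (p : ℤ) ∣ b := by
    refine hp'.dvd_of_dvd_pow (n := 2) ?_
    have h1 : (p : ℤ) ∣ (b : ℤ) ^ 2 - D₀ * f ^ 2 :=
      ((dvd_pow_self _ two_ne_zero).mul_left _).trans h4
    exact (dvd_sub_left (hpD.mul_right _)).1 h1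
  obtain ⟨b', hb'⟩ := hpb
  rw [hb'] at h4
  rcases hp.eq_two_or_odd' with rfl | hodd
  · push_cast at h4
    have hD4 : D₀ % 4 = 0 := by
      rcases hD0 with h0 | h0
      · exact h0
      · push_cast at hpD; omega
    rcases h with h | ⟨-, -, h⟩
    · omega
    · have hf1 : f % 2 = 1 := by
        have : ¬ (2 : ℤ) ∣ f := by exact_mod_cast hpf
        omega
      obtain ⟨g, hg⟩ : ∃ g, f = 2 * g + 1 := ⟨f / 2, by omega⟩
      obtain ⟨m, hm⟩ : ∃ m, D₀ = 4 * m := ⟨D₀ / 4, by omega⟩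
      have hm' : D₀ / 4 = m := by omega
      rw [hm'] at h
      obtain ⟨q, hq⟩ := h4
      have h5 : b' ^ 2 - m * f ^ 2 = 4 * q := by
        rw [hm] at hq
        linarith
      have h6 : f ^ 2 = 4 * (g ^ 2 + g) + 1 := by rw [hg]; ring
      have h7 : b' ^ 2 = 4 * (q + m * (g ^ 2 + g)) + m := by rw [h6] at h5; linarith
      rcases Int.even_or_odd' b' with ⟨c, rfl | rfl⟩
      · have : (2 * c) ^ 2 = 4 * c ^ 2 := by ring
        omega
      · have : (2 * c + 1) ^ 2 = 4 * (c ^ 2 + c) + 1 := by ring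
        omega
  · have h1 : (p : ℤ) ^ 2 ∣ D₀ * f ^ 2 := by
      have h2 : (p : ℤ) ^ 2 ∣ (p * b') ^ 2 - D₀ * f ^ 2 := (dvd_mul_left _ _).trans h4
      exact (dvd_sub_right (by rw [mul_pow]; exact dvd_mul_right _ _)).1 h2
    have h2 : (p : ℤ) ^ 2 ∣ D₀ :=
      ((hp'.coprime_iff_not_dvd.2 hpf).pow (m := 2) (n := 2)).dvd_of_dvd_mul_right h1
    have hu : ¬ IsUnit (p : ℤ) := hp'.not_isUnit
    rcases h with ⟨-, h⟩ | ⟨h0, h, -⟩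
    · exact hu (h _ (by rw [← sq]; exact h2))
    · have h3 : D₀ = 4 * (D₀ / 4) := by omega
      rw [h3] at h2
      have h4 : IsCoprime ((p : ℤ) ^ 2) 4 := by
        have : IsCoprime (p : ℤ) 2 := by
          rw [hp'.coprime_iff_not_dvd]
          intro h
          have h' : p ∣ 2 := by exact_mod_cast h
          have := (Nat.prime_dvd_prime_iff_eq hp Nat.prime_two).1 h'
          subst this
          exact absurd hodd (by decide)
        have h' := this.pow (m := 2) (n := 2)
        norm_num at h'
        exact h'
      exact hu (h _ (by rw [← sq]; exact h4.dvd_of_dvd_mul_left h2))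

end ArcsinSum

namespace ArcsinSum

/-- The correction of the local factor at `p` when `p ^ v` exactly divides the conductor. -/
noncomputable def localCorr (c : ℝ) (p v : ℕ) : ℝ :=
  (((p : ℝ) ^ v) ^ 3)⁻¹ * (∑ i ∈ Finset.range (v + 1), ((p : ℝ) ^ i) ^ 3 -
    if v = 0 then 0 else c * p * ∑ i ∈ Finset.range v, ((p : ℝ) ^ i) ^ 3)

lemma localCorr_zero (c : ℝ) (p : ℕ) : localCorr c p 0 = 1 := by simp [localCorr]

lemma localCorr_succ (c : ℝ) {p : ℕ} (hp : p ≠ 0) (v : ℕ) :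
    localCorr c p (v + 1) = (1 - c * ((p : ℝ) ^ 2)⁻¹) + ((p : ℝ) ^ 3)⁻¹ * localCorr c p v := by
  have hp' : (p : ℝ) ≠ 0 := by exact_mod_cast hp
  rcases Nat.eq_zero_or_pos v with rfl | hv
  · simp only [localCorr, Finset.sum_range_succ, Finset.sum_range_zero]
    norm_num
    field_simp
    ring
  · obtain ⟨w, rfl⟩ : ∃ w, v = w + 1 := ⟨v - 1, by omega⟩
    simp only [localCorr, if_neg (Nat.succ_ne_zero _)]
    rw [Finset.sum_range_succ _ (w + 1 + 1), Finset.sum_range_succ _ (w + 1)]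
    generalize ∑ i ∈ Finset.range (w + 1), ((p : ℝ) ^ i) ^ 3 = s
    field_simp
    ring

/-- The local factor of the Dirichlet series counting roots. -/
noncomputable def localFactor (c : ℝ) (p v : ℕ) : ℝ :=
  (1 + ((p : ℝ) ^ 2)⁻¹) * (1 - c * ((p : ℝ) ^ 2)⁻¹)⁻¹ * localCorr c p v

lemma hasSum_congr_val {f : ℕ → ℝ} {a b : ℝ} (h : HasSum f a) (hab : b = a) : HasSum f b :=
  hab ▸ h

lemma hasSum_rho_of_not_dvd {D : ℤ} (hD : D % 4 = 0 ∨ D % 4 = 1) {p : ℕ} (hp : p.Prime)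
    (hpD : ¬ (p : ℤ) ∣ D) :
    HasSum (fun k : ℕ => (rho D (p ^ k) : ℝ) / ((p ^ k : ℕ) : ℝ) ^ 2)
      ((1 + ((p : ℝ) ^ 2)⁻¹) * (1 - (kroneckerSym D p : ℝ) * ((p : ℝ) ^ 2)⁻¹)⁻¹) := by
  have hp1 : (1 : ℝ) < p := by exact_mod_cast hp.one_lt
  have hx0 : (0 : ℝ) < ((p : ℝ) ^ 2)⁻¹ := by positivity
  have hx1 : ((p : ℝ) ^ 2)⁻¹ < 1 := inv_lt_one_of_one_lt₀ (one_lt_pow₀ hp1 two_ne_zero)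
  have hr : (rho D p : ℝ) = 1 + (kroneckerSym D p : ℝ) := by exact_mod_cast rho_prime hD hp
  rw [← hasSum_nat_add_iff' 1]
  have hterm : (fun k : ℕ => (rho D (p ^ (k + 1)) : ℝ) / ((p ^ (k + 1) : ℕ) : ℝ) ^ 2) =
      fun k => (1 + (kroneckerSym D p : ℝ)) * ((p : ℝ) ^ 2)⁻¹ * (((p : ℝ) ^ 2)⁻¹) ^ k := by
    funext k
    rw [rho_prime_pow_of_not_dvd hD hp hpD, hr]
    push_cast
    rw [← pow_mul, mul_comm (k + 1) 2, pow_mul, mul_assoc, ← pow_succ', inv_pow, div_eq_mul_inv]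
  rw [hterm]
  refine hasSum_congr_val ((hasSum_geometric_of_lt_one hx0.le hx1).mul_left _) ?_
  simp only [Finset.range_one, Finset.sum_singleton, pow_zero, rho_one]
  generalize ((p : ℝ) ^ 2)⁻¹ = x at *
  have h1 : (1 : ℝ) - x ≠ 0 := by linarith
  rcases kroneckerSym_prime_eq_one_or hp hpD with h | h <;> rw [h] <;> push_cast
  · rw [one_mul]
    field_simp
    ring
  · have h2 : (1 : ℝ) + x ≠ 0 := by linarith
    rw [neg_one_mul, sub_neg_eq_add]
    field_simp
    ring

lemma hasSum_rho_of_dvd {D₀ f : ℤ} (h : IsFundamentalDiscriminant D₀) {p : ℕ} (hp : p.Prime)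
    (hpD : (p : ℤ) ∣ D₀) (hpf : ¬ (p : ℤ) ∣ f) (hD : (D₀ * f ^ 2) % 4 = 0 ∨ (D₀ * f ^ 2) % 4 = 1) :
    HasSum (fun k : ℕ => (rho (D₀ * f ^ 2) (p ^ k) : ℝ) / ((p ^ k : ℕ) : ℝ) ^ 2)
      (1 + ((p : ℝ) ^ 2)⁻¹) := by
  have hr : (rho (D₀ * f ^ 2) p : ℝ) = 1 := by
    have := rho_prime hD hp
    rw [kroneckerSym_prime_of_dvd hp (hpD.mul_right _), add_zero] at this
    exact_mod_cast this
  rw [← hasSum_nat_add_iff' 2]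
  simp only [rho_prime_pow_eq_zero h hp hpD hpf]
  convert hasSum_zero using 1
  · simp
  · simp [Finset.sum_range_succ, rho_one, hr]

lemma hasSum_rho_sq_mul {D : ℤ} (hD : D % 4 = 0 ∨ D % 4 = 1) {p : ℕ} (hp : p.Prime) {R : ℝ}
    (hR : HasSum (fun k : ℕ => (rho D (p ^ k) : ℝ) / ((p ^ k : ℕ) : ℝ) ^ 2) R) :
    HasSum (fun k : ℕ => (rho ((p : ℤ) ^ 2 * D) (p ^ k) : ℝ) / ((p ^ k : ℕ) : ℝ) ^ 2)
      (1 + ((p : ℝ) ^ 2)⁻¹ + ((p : ℝ) ^ 3)⁻¹ * R) := by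
  have hp0 : (p : ℝ) ≠ 0 := by exact_mod_cast hp.ne_zero
  have hr : (rho ((p : ℤ) ^ 2 * D) p : ℝ) = 1 := by
    have := rho_prime (emod_four_sq_mul hD p) hp
    rw [kroneckerSym_prime_of_dvd hp (Dvd.dvd.mul_right (dvd_pow_self _ two_ne_zero) _),
      add_zero] at this
    exact_mod_cast this
  rw [← hasSum_nat_add_iff' 2]
  have hterm : (fun k : ℕ => (rho ((p : ℤ) ^ 2 * D) (p ^ (k + 2)) : ℝ) / ((p ^ (k + 2) : ℕ) : ℝ) ^ 2)
      = fun k => ((p : ℝ) ^ 3)⁻¹ * ((rho D (p ^ k) : ℝ) / ((p ^ k : ℕ) : ℝ) ^ 2) := by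
    funext k
    rw [rho_sq_mul_prime_pow hD hp]
    push_cast
    field_simp
    ring
  rw [hterm]
  refine hasSum_congr_val (hR.mul_left _) ?_
  simp [Finset.sum_range_succ, rho_one, hr]

lemma hasSum_rho {D₀ : ℤ} (h : IsFundamentalDiscriminant D₀) {p : ℕ} (hp : p.Prime) {g : ℤ}
    (hpg : ¬ (p : ℤ) ∣ g) (v : ℕ) :
    HasSum (fun k : ℕ => (rho (D₀ * (p ^ v * g) ^ 2) (p ^ k) : ℝ) / ((p ^ k : ℕ) : ℝ) ^ 2)
      (localFactor (kroneckerSym D₀ p) p v) := by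
  have hD0 : D₀ % 4 = 0 ∨ D₀ % 4 = 1 := by
    rcases h with h | h
    · exact Or.inr h.1
    · exact Or.inl h.1
  have hD (f : ℤ) : (D₀ * f ^ 2) % 4 = 0 ∨ (D₀ * f ^ 2) % 4 = 1 := by
    rw [mul_comm]; exact emod_four_sq_mul hD0 f
  have hp' := Nat.prime_iff_prime_int.1 hp
  induction v with
  | zero =>
    rw [localFactor, localCorr_zero, pow_zero, one_mul, mul_one]
    by_cases hpD : (p : ℤ) ∣ D₀
    · rw [kroneckerSym_prime_of_dvd hp hpD]
      simpa using hasSum_rho_of_dvd h hp hpD hpg (hD g)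
    · have := hasSum_rho_of_not_dvd (hD g) hp fun hd => (hp'.dvd_or_dvd hd).elim hpD
        fun h' => hpg (hp'.dvd_of_dvd_pow h')
      rwa [kroneckerSym_mul_sq D₀ hp hpg] at this
  | succ v ih =>
    have h1 := hasSum_rho_sq_mul (hD _) hp ih
    have h2 : D₀ * ((p : ℤ) ^ (v + 1) * g) ^ 2 = (p : ℤ) ^ 2 * (D₀ * (p ^ v * g) ^ 2) := by ring
    rw [h2]
    refine hasSum_congr_val h1 ?_
    rw [localFactor, localCorr_succ _ hp.ne_zero, localFactor]
    have hp1 : (1 : ℝ) < p := by exact_mod_cast hp.one_lt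
    have hx0 : (0 : ℝ) < ((p : ℝ) ^ 2)⁻¹ := by positivity
    have hx1 : ((p : ℝ) ^ 2)⁻¹ < 1 := inv_lt_one_of_one_lt₀ (one_lt_pow₀ hp1 two_ne_zero)
    have hc : (kroneckerSym D₀ p : ℝ) ≤ 1 := by
      by_cases hpD : (p : ℤ) ∣ D₀
      · rw [kroneckerSym_prime_of_dvd hp hpD]; simp
      · rcases kroneckerSym_prime_eq_one_or hp hpD with h | h <;> rw [h] <;> simp
    have hne : 1 - (kroneckerSym D₀ p : ℝ) * ((p : ℝ) ^ 2)⁻¹ ≠ 0 := by nlinarith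
    generalize ((p : ℝ) ^ 2)⁻¹ = x at *
    generalize ((p : ℝ) ^ 3)⁻¹ = y at *
    linear_combination (1 + x) * inv_mul_cancel₀ hne

end ArcsinSum

namespace ArcsinSum

open Filter Topology
open scoped Real

/-- The divisor sum `∑_{d ∣ f} μ(d) χ(d) d σ₃(f / d)`. -/
noncomputable def divisorCorr {N : ℕ} (χ : DirichletCharacter ℂ N) (f : ℕ) : ℂ :=
  ∑ d ∈ f.divisors, (ArithmeticFunction.moebius d : ℂ) * χ (d : ZMod N) * (d : ℂ) *
    ∑ e ∈ (f / d).divisors, (e : ℂ) ^ 3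

/-- A Dirichlet character as an arithmetic function. -/
noncomputable def charArith {N : ℕ} (χ : DirichletCharacter ℂ N) : ArithmeticFunction ℂ :=
  ⟨fun n => if n = 0 then 0 else χ (n : ZMod N), if_pos rfl⟩

lemma charArith_apply {N : ℕ} (χ : DirichletCharacter ℂ N) {n : ℕ} (hn : n ≠ 0) :
    charArith χ n = χ (n : ZMod N) := if_neg hn

lemma isMultiplicative_charArith {N : ℕ} (χ : DirichletCharacter ℂ N) :
    (charArith χ).IsMultiplicative := by
  rw [ArithmeticFunction.IsMultiplicative.iff_ne_zero]
  refine ⟨by simp [charArith_apply], fun {m n} hm hn _ => ?_⟩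
  rw [charArith_apply χ hm, charArith_apply χ hn, charArith_apply χ (mul_ne_zero hm hn)]
  simp

/-- `divisorCorr` as a Dirichlet convolution. -/
noncomputable def divisorCorrArith {N : ℕ} (χ : DirichletCharacter ℂ N) : ArithmeticFunction ℂ :=
  (((ArithmeticFunction.moebius : ArithmeticFunction ℂ).pmul (charArith χ)).pmul
    (ArithmeticFunction.id : ArithmeticFunction ℂ)) * (ArithmeticFunction.sigma 3 : ArithmeticFunction ℂ)

lemma divisorCorrArith_apply {N : ℕ} (χ : DirichletCharacter ℂ N) (f : ℕ) :
    divisorCorrArith χ f = divisorCorr χ f := by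
  rw [divisorCorrArith, ArithmeticFunction.mul_apply, divisorCorr,
    Nat.sum_divisorsAntidiagonal (f := fun d e =>
      (((ArithmeticFunction.moebius : ArithmeticFunction ℂ).pmul (charArith χ)).pmul
        (ArithmeticFunction.id : ArithmeticFunction ℂ)) d *
        (ArithmeticFunction.sigma 3 : ArithmeticFunction ℂ) e)]
  refine Finset.sum_congr rfl fun d hd => ?_
  have hd0 : d ≠ 0 := (Nat.pos_of_mem_divisors hd).ne'
  simp [ArithmeticFunction.pmul_apply, charArith_apply χ hd0, ArithmeticFunction.sigma_apply]

lemma isMultiplicative_divisorCorrArith {N : ℕ} (χ : DirichletCharacter ℂ N) :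
    (divisorCorrArith χ).IsMultiplicative :=
  ((ArithmeticFunction.isMultiplicative_moebius.intCast.pmul (isMultiplicative_charArith χ)).pmul
    ArithmeticFunction.isMultiplicative_id.natCast).mul
      ArithmeticFunction.isMultiplicative_sigma.natCast

lemma divisorCorr_prime_pow {N : ℕ} (χ : DirichletCharacter ℂ N) {p : ℕ} (hp : p.Prime) {c : ℝ}
    (hc : χ (p : ZMod N) = c) (v : ℕ) :
    divisorCorr χ (p ^ v) = (((p : ℂ) ^ v) ^ 3) * (localCorr c p v : ℂ) := by
  have hp0 : (p : ℂ) ≠ 0 := by exact_mod_cast hp.ne_zero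
  rw [divisorCorr, Nat.sum_divisors_prime_pow hp, localCorr]
  push_cast
  rw [mul_inv_cancel_left₀ (by positivity)]
  rcases Nat.eq_zero_or_pos v with rfl | hv
  · simp
  · obtain ⟨w, rfl⟩ : ∃ w, v = w + 1 := ⟨v - 1, by omega⟩
    rw [if_neg (Nat.succ_ne_zero w), Finset.sum_range_succ', Finset.sum_range_succ',
      Finset.sum_eq_zero]
    · have h1 : p ^ (w + 1) / p = p ^ w := by
        rw [pow_succ, Nat.mul_div_cancel _ hp.pos]
      simp only [zero_add, pow_one, pow_zero, Nat.div_one, h1, Nat.sum_divisors_prime_pow hp,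
        ArithmeticFunction.moebius_apply_prime hp, hc]
      simp
      ring
    · intro k _
      rw [ArithmeticFunction.moebius_apply_prime_pow hp (by omega), if_neg (by omega)]
      simp

lemma divisorCorr_eq_prod {N : ℕ} (χ : DirichletCharacter ℂ N) {c : ℕ → ℝ}
    (hc : ∀ p : ℕ, p.Prime → χ (p : ZMod N) = c p) {f : ℕ} (hf : f ≠ 0) :
    divisorCorr χ f = (f : ℂ) ^ 3 *
      ∏ p ∈ f.primeFactors, (localCorr (c p) p (f.factorization p) : ℂ) := by
  rw [← divisorCorrArith_apply,
    (isMultiplicative_divisorCorrArith χ).multiplicative_factorization _ hf, Finsupp.prod]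
  have hf' : (f : ℂ) = ∏ p ∈ f.primeFactors, (p : ℂ) ^ f.factorization p := by
    conv_lhs => rw [← Nat.prod_factorization_pow_eq_self hf, Finsupp.prod, Nat.support_factorization]
    push_cast
    rfl
  rw [hf', Nat.support_factorization, ← Finset.prod_pow, ← Finset.prod_mul_distrib]
  refine Finset.prod_congr rfl fun p hp => ?_
  have hp' := Nat.prime_of_mem_primeFactors hp
  rw [divisorCorrArith_apply, divisorCorr_prime_pow χ hp' (hc p hp')]

end ArcsinSum

namespace ArcsinSum

open Filter Topology
open scoped Real

lemma hasProd_localCorr (c : ℕ → ℝ) (f : ℕ) :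
    HasProd (fun p : Nat.Primes => (localCorr (c p) p (f.factorization p) : ℂ))
      (∏ p ∈ f.primeFactors, (localCorr (c p) p (f.factorization p) : ℂ)) := by
  classical
  rw [← Finset.prod_subtype_of_mem (p := Nat.Prime)
    (fun p : ℕ => (localCorr (c p) p (f.factorization p) : ℂ))
    fun p hp => Nat.prime_of_mem_primeFactors hp]
  refine hasProd_prod_of_ne_finset_one fun p hp => ?_
  have h : f.factorization p = 0 := by
    rw [← Finsupp.notMem_support_iff, Nat.support_factorization]
    intro h
    exact hp (Finset.mem_subtype.2 h)
  rw [h, localCorr_zero, Complex.ofReal_one]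

lemma hasProd_localFactor {N : ℕ} (χ : DirichletCharacter ℂ N) {c : ℕ → ℝ}
    (hc : ∀ p : ℕ, p.Prime → χ (p : ZMod N) = c p) (f : ℕ) :
    HasProd (fun p : Nat.Primes => (localFactor (c p) p (f.factorization p) : ℂ))
      (riemannZeta 2 / riemannZeta 4 * LSeries (fun n => χ (n : ZMod N)) 2 *
        ∏ p ∈ f.primeFactors, (localCorr (c p) p (f.factorization p) : ℂ)) := by
  have h2 := riemannZeta_eulerProduct_hasProd (s := 2) (by norm_num)
  have h4 := riemannZeta_eulerProduct_hasProd (s := 4) (by norm_num)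
  have hL := DirichletCharacter.LSeries_eulerProduct_hasProd (s := 2) χ (by norm_num)
  have hne : riemannZeta 4 ≠ 0 := by
    rw [riemannZeta_four]
    exact div_ne_zero (pow_ne_zero _ (by exact_mod_cast Real.pi_ne_zero)) (by norm_num)
  refine (((h2.div₀ h4 hne).mul hL).mul (hasProd_localCorr c f)).congr_fun fun p => ?_
  have hp0 : (p : ℂ) ≠ 0 := by exact_mod_cast p.2.ne_zero
  have e2 : ((p : ℕ) : ℂ) ^ (-2 : ℂ) = (((p : ℕ) : ℂ) ^ 2)⁻¹ := by
    rw [Complex.cpow_neg]; norm_cast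
  have e4 : ((p : ℕ) : ℂ) ^ (-4 : ℂ) = ((((p : ℕ) : ℂ) ^ 2)⁻¹) ^ 2 := by
    rw [Complex.cpow_neg, inv_pow, ← pow_mul]; norm_cast
  rw [localFactor, e2, e4, hc p p.2]
  push_cast
  congr 2
  have hp1 : (1 : ℝ) < (p : ℕ) := by exact_mod_cast p.2.one_lt
  have hx1 : (((p : ℕ) : ℝ) ^ 2)⁻¹ < 1 := inv_lt_one_of_one_lt₀ (one_lt_pow₀ hp1 two_ne_zero)
  have hx0 : 0 < (((p : ℕ) : ℝ) ^ 2)⁻¹ := by positivity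
  have hxc : (((p : ℕ) : ℂ) ^ 2)⁻¹ = ((((p : ℕ) : ℝ) ^ 2)⁻¹ : ℝ) := by push_cast; rfl
  have hx : (1 : ℂ) - (((p : ℕ) : ℂ) ^ 2)⁻¹ ≠ 0 := by
    have : (1 : ℝ) - (((p : ℕ) : ℝ) ^ 2)⁻¹ ≠ 0 := by linarith
    rw [hxc, ← Complex.ofReal_one, ← Complex.ofReal_sub]
    exact Complex.ofReal_ne_zero.2 this
  have hx' : (1 : ℂ) + (((p : ℕ) : ℂ) ^ 2)⁻¹ ≠ 0 := by
    have : (1 : ℝ) + (((p : ℕ) : ℝ) ^ 2)⁻¹ ≠ 0 := by linarith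
    rw [hxc, ← Complex.ofReal_one, ← Complex.ofReal_add]
    exact Complex.ofReal_ne_zero.2 this
  generalize (((p : ℕ) : ℂ) ^ 2)⁻¹ = x at *
  rw [show 1 - x ^ 2 = (1 - x) * (1 + x) by ring]
  field_simp

variable {D₀ : ℤ} {f : ℕ}

/-- The summand of the Dirichlet series at `2` counting roots. -/
noncomputable def rhoTerm (D : ℤ) (n : ℕ) : ℝ := (rho D n : ℝ) / (n : ℝ) ^ 2

lemma rhoTerm_one (D : ℤ) : rhoTerm D 1 = 1 := by simp [rhoTerm, rho_one]

lemma rhoTerm_zero (D : ℤ) : rhoTerm D 0 = 0 := by simp [rhoTerm]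

lemma rhoTerm_nonneg (D : ℤ) (n : ℕ) : 0 ≤ rhoTerm D n := by unfold rhoTerm; positivity

lemma rhoTerm_mul (D : ℤ) {m n : ℕ} (h : m.Coprime n) :
    rhoTerm D (m * n) = rhoTerm D m * rhoTerm D n := by
  rcases eq_or_ne m 0 with rfl | hm
  · rw [zero_mul, rhoTerm_zero, zero_mul]
  rcases eq_or_ne n 0 with rfl | hn
  · rw [mul_zero, rhoTerm_zero, mul_zero]
  rw [rhoTerm, rho_mul D hm hn h]
  simp only [rhoTerm]
  push_cast
  rw [mul_pow, mul_div_mul_comm]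

lemma hasSum_rhoTerm_prime_pow (h : IsFundamentalDiscriminant D₀) (hf : f ≠ 0) {p : ℕ}
    (hp : p.Prime) : HasSum (fun k => rhoTerm (D₀ * (f : ℤ) ^ 2) (p ^ k))
      (localFactor (kroneckerSym D₀ p) p (f.factorization p)) := by
  have hg : ¬ (p : ℤ) ∣ ((f / p ^ f.factorization p : ℕ) : ℤ) := by
    exact_mod_cast Nat.not_dvd_ordCompl hp hf
  have := hasSum_rho h hp hg (f.factorization p)
  have hfp : (p : ℤ) ^ f.factorization p * ((f / p ^ f.factorization p : ℕ) : ℤ) = f := by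
    exact_mod_cast Nat.ordProj_mul_ordCompl_eq_self f p
  rwa [hfp] at this

lemma prod_localFactor_le {N : ℕ} (h : IsFundamentalDiscriminant D₀) (hf : f ≠ 0)
    (χ : DirichletCharacter ℂ N) (hc : ∀ p : ℕ, p.Prime → χ (p : ZMod N) = (kroneckerSym D₀ p : ℝ)) :
    ∃ C : ℝ, ∀ s : Finset ℕ, ∏ p ∈ s with p.Prime,
      localFactor (kroneckerSym D₀ p) p (f.factorization p) ≤ C := by
  classical
  have hP := hasProd_localFactor χ hc f
  set P := (riemannZeta 2 / riemannZeta 4 * LSeries (fun n => χ (n : ZMod N)) 2 *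
        ∏ p ∈ f.primeFactors, (localCorr ((kroneckerSym D₀ p : ℤ) : ℝ) p (f.factorization p) : ℂ))
  have h1 (p : ℕ) (hp : p.Prime) : 1 ≤ localFactor (kroneckerSym D₀ p) p (f.factorization p) := by
    have := hasSum_rhoTerm_prime_pow h hf hp
    have h0 := le_hasSum this 0 fun j _ => rhoTerm_nonneg _ _
    rwa [pow_zero, rhoTerm_one] at h0
  have hev : ∀ᶠ s : Finset Nat.Primes in atTop,
      ‖∏ p ∈ s, (localFactor (kroneckerSym D₀ p) p (f.factorization p) : ℂ)‖ < ‖P‖ + 1 := by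
    have : Tendsto (fun s : Finset Nat.Primes =>
      ∏ p ∈ s, (localFactor (kroneckerSym D₀ p) p (f.factorization p) : ℂ)) atTop (𝓝 P) := by
      simpa [HasProd] using hP
    exact this.norm.eventually_lt_const (lt_add_one _)
  obtain ⟨s₀, hs₀⟩ := eventually_atTop.1 hev
  refine ⟨‖P‖ + 1, fun s => ?_⟩
  have h2 := hs₀ (s₀ ∪ s.subtype Nat.Prime) Finset.subset_union_left
  have h3 : ∏ p ∈ s.subtype Nat.Prime, localFactor (kroneckerSym D₀ p) p (f.factorization p) ≤
      ∏ p ∈ s₀ ∪ s.subtype Nat.Prime, localFactor (kroneckerSym D₀ p) p (f.factorization p) :=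
    Finset.prod_le_prod_of_subset_of_one_le Finset.subset_union_right
      (fun p _ => zero_le_one.trans (h1 p p.2)) fun p _ _ => h1 p p.2
  rw [← Finset.prod_subtype_eq_prod_filter]
  refine h3.trans (le_trans ?_ h2.le)
  rw [← Complex.ofReal_prod, Complex.norm_real]
  exact le_abs_self _

lemma summable_of_prod_prime_le {g F : ℕ → ℝ} (h0 : g 0 = 0) (h1 : g 1 = 1) (hnn : ∀ n, 0 ≤ g n)
    (hmul : ∀ {m n : ℕ}, m.Coprime n → g (m * n) = g m * g n)
    (hp : ∀ p : ℕ, p.Prime → HasSum (fun k => g (p ^ k)) (F p)) {C : ℝ}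
    (hC : ∀ s : Finset ℕ, ∏ p ∈ s with p.Prime, F p ≤ C) : Summable g := by
  refine summable_of_sum_le (c := C) hnn fun u => ?_
  set s := Finset.range (u.sup id + 1)
  obtain ⟨-, hs⟩ := EulerProduct.summable_and_hasSum_factoredNumbers_prod_filter_prime_tsum
    h1 hmul (fun {p} hp' => (hp p hp').summable.norm) s
  have e : ∏ p ∈ s with p.Prime, ∑' n : ℕ, g (p ^ n) = ∏ p ∈ s with p.Prime, F p :=
    Finset.prod_congr rfl fun p hp' => (hp p (Finset.mem_filter.1 hp').2).tsum_eq
  rw [e] at hs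
  refine le_trans ?_ (hC s)
  replace hs := hasSum_subtype_iff_indicator.1 hs
  have hi (n : ℕ) : 0 ≤ (Nat.factoredNumbers s).indicator g n :=
    Set.indicator_nonneg (fun n _ => hnn n) n
  refine le_trans (Finset.sum_le_sum fun n hn => ?_) (sum_le_hasSum u (fun n _ => hi n) hs)
  rcases eq_or_ne n 0 with rfl | hn0
  · rw [h0]
    exact hi 0
  rw [Set.indicator_of_mem]
  rw [Nat.mem_factoredNumbers]
  refine ⟨hn0, fun p hpn => Finset.mem_range.2 (Nat.lt_succ_of_le ?_)⟩
  exact (Nat.le_of_mem_primeFactorsList hpn).trans (Finset.le_sup (f := id) hn)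

lemma summable_rhoTerm {N : ℕ} (h : IsFundamentalDiscriminant D₀) (hf : f ≠ 0)
    (χ : DirichletCharacter ℂ N)
    (hc : ∀ p : ℕ, p.Prime → χ (p : ZMod N) = (kroneckerSym D₀ p : ℝ)) :
    Summable (rhoTerm (D₀ * (f : ℤ) ^ 2)) := by
  obtain ⟨C, hC⟩ := prod_localFactor_le h hf χ hc
  exact summable_of_prod_prime_le (rhoTerm_zero _) (rhoTerm_one _) (rhoTerm_nonneg _)
    (rhoTerm_mul _) (fun p hp => hasSum_rhoTerm_prime_pow h hf hp) hC

lemma tsum_rhoTerm {N : ℕ} (h : IsFundamentalDiscriminant D₀) (hf : f ≠ 0)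
    (χ : DirichletCharacter ℂ N)
    (hc : ∀ p : ℕ, p.Prime → χ (p : ZMod N) = (kroneckerSym D₀ p : ℝ)) :
    ((∑' n, rhoTerm (D₀ * (f : ℤ) ^ 2) n : ℝ) : ℂ) =
      15 / (π : ℂ) ^ 2 * LSeries (fun n => χ (n : ZMod N)) 2 * divisorCorr χ f / (f : ℂ) ^ 3 := by
  have h1 := EulerProduct.eulerProduct_hasProd (rhoTerm_one (D₀ * (f : ℤ) ^ 2))
    (fun {m n} hmn => rhoTerm_mul _ hmn) (summable_rhoTerm h hf χ hc).norm (rhoTerm_zero _)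
  have h2 : HasProd (fun p : Nat.Primes => localFactor (kroneckerSym D₀ p) p (f.factorization p))
      (∑' n, rhoTerm (D₀ * (f : ℤ) ^ 2) n) :=
    h1.congr_fun fun p => ((hasSum_rhoTerm_prime_pow h hf p.2).tsum_eq).symm
  have h3 := (h2.map Complex.ofRealHom Complex.continuous_ofReal).unique
    (hasProd_localFactor χ hc f)
  simp only [Complex.ofRealHom_eq_coe] at h3
  have hf' : (f : ℂ) ≠ 0 := by exact_mod_cast hf
  have hπ : (π : ℂ) ≠ 0 := by exact_mod_cast Real.pi_ne_zero
  rw [h3, divisorCorr_eq_prod χ hc hf, riemannZeta_two, riemannZeta_four]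
  field_simp
  ring

end ArcsinSum

namespace ArcsinSum

open scoped Real

lemma meanVal_eq_LSeries {D₀ : ℤ} {f N : ℕ} (hD₀ : 0 < D₀) (h : IsFundamentalDiscriminant D₀)
    (hf : f ≠ 0) (hD : D₀ * (f : ℤ) ^ 2 % 4 = 0 ∨ D₀ * (f : ℤ) ^ 2 % 4 = 1)
    (χ : DirichletCharacter ℂ N)
    (hc : ∀ p : ℕ, p.Prime → χ (p : ZMod N) = (kroneckerSym D₀ p : ℝ)) :
    (meanVal (D₀ * (f : ℤ) ^ 2) : ℂ) = 5 / (2 * (π : ℂ) ^ 2) * (√(D₀ : ℝ) : ℂ) ^ 3 *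
      LSeries (fun n => χ (n : ZMod N)) 2 * divisorCorr χ f := by
  have hD0 : 0 < D₀ * (f : ℤ) ^ 2 := by positivity
  rw [meanVal_eq_tsum hD0 hD (summable_rhoTerm h hf χ hc)]
  have h1 := tsum_rhoTerm h hf χ hc
  simp only [rhoTerm] at h1
  have h2 : √((D₀ * (f : ℤ) ^ 2 : ℤ) : ℝ) = √(D₀ : ℝ) * f := by
    push_cast
    rw [Real.sqrt_mul (by positivity), Real.sqrt_sq (Nat.cast_nonneg f)]
  rw [h2, Complex.ofReal_mul, h1]
  have hf' : (f : ℂ) ≠ 0 := by exact_mod_cast hf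
  push_cast
  field_simp
  ring

section Fourier

variable {N : ℕ} [NeZero N]

open ZMod

lemma star_stdAddChar (j : ZMod N) : star (stdAddChar j : ℂ) = stdAddChar (-j) := by
  rw [AddChar.map_neg_eq_conj, starRingEnd_apply]

lemma star_dft {Φ : ZMod N → ℂ} (hr : ∀ k, star (Φ k) = Φ k) (k : ZMod N) :
    star (dft Φ k) = dft Φ (-k) := by
  simp only [dft_apply, star_sum, smul_eq_mul, star_mul', hr, star_stdAddChar, mul_neg]

lemma sum_mul_dft (Φ Ψ : ZMod N → ℂ) : ∑ j, Φ j * dft Ψ j = ∑ k, dft Φ k * Ψ k := by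
  simp only [dft_apply, smul_eq_mul, Finset.mul_sum, Finset.sum_mul]
  rw [Finset.sum_comm]
  refine Finset.sum_congr rfl fun j _ => Finset.sum_congr rfl fun k _ => ?_
  rw [mul_comm j k]
  ring

/-- Parseval's identity for real-valued functions. -/
lemma sum_norm_dft_sq {Φ : ZMod N → ℂ} (hr : ∀ k, star (Φ k) = Φ k) :
    ∑ k, ‖dft Φ k‖ ^ 2 = N * ∑ k, ‖Φ k‖ ^ 2 := by
  have h1 := sum_mul_dft (fun j => Φ (-j)) (dft Φ)
  rw [dft_dft, dft_comp_neg] at h1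
  have e (z : ℂ) : ((‖z‖ ^ 2 : ℝ) : ℂ) = star z * z := by
    rw [← starRingEnd_apply, Complex.conj_mul']; push_cast; rfl
  apply Complex.ofReal_injective
  simp only [Complex.ofReal_mul, Complex.ofReal_sum, e, Complex.ofReal_natCast, hr, star_dft hr]
  rw [← h1, Finset.mul_sum]
  refine Fintype.sum_equiv (Equiv.neg _) _ _ fun k => ?_
  simp only [Equiv.neg_apply, smul_eq_mul]
  ring

variable {χ : DirichletCharacter ℂ N}

lemma even_of_gaussSum (hr : ∀ k, star (χ k) = χ k) (hτ : gaussSum χ stdAddChar = (√(N : ℝ) : ℂ)) :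
    χ (-1) = 1 := by
  have h1 : star (gaussSum χ stdAddChar) = χ (-1) * gaussSum χ stdAddChar := by
    simp only [gaussSum, star_sum, star_mul', hr, star_stdAddChar, Finset.mul_sum]
    refine Fintype.sum_equiv (Equiv.neg _) _ _ fun k => ?_
    rw [Equiv.neg_apply, ← mul_assoc, ← map_mul, neg_one_mul, neg_neg]
  rw [hτ, ← starRingEnd_apply, Complex.conj_ofReal] at h1
  have h2 : (√(N : ℝ) : ℂ) ≠ 0 := by
    rw [Complex.ofReal_ne_zero]
    exact (Real.sqrt_pos.2 (Nat.cast_pos.2 (NeZero.pos N))).ne'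
  exact (mul_right_cancel₀ h2 (by rw [← h1, one_mul]))

lemma dft_eq_sqrt_mul (hr : ∀ k, star (χ k) = χ k)
    (hτ : gaussSum χ stdAddChar = (√(N : ℝ) : ℂ)) (k : ZMod N) :
    dft χ k = √(N : ℝ) * χ k := by
  have hN : (0 : ℝ) < N := Nat.cast_pos.2 (NeZero.pos N)
  have hev := even_of_gaussSum hr hτ
  have hnorm (k : ZMod N) (hk : IsUnit k) : ‖χ k‖ = 1 := DirichletCharacter.unit_norm_eq_one χ hk.unit
  have hunit (k : ZMod N) (hk : IsUnit k) : dft χ k = √(N : ℝ) * χ k := by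
    rw [DirichletCharacter.fourierTransform_eq_gaussSum_mulShift]
    have h1 := gaussSum_mulShift χ stdAddChar (-hk.unit)
    rw [hτ, Units.val_neg, IsUnit.unit_spec, neg_eq_neg_one_mul, map_mul, hev, one_mul,
      ← neg_eq_neg_one_mul] at h1
    have h2 : χ k * χ k = 1 := by
      nth_rw 1 [← hr k]
      rw [← starRingEnd_apply, Complex.conj_mul', hnorm k hk]
      norm_num
    rw [← h1, mul_right_comm, h2, one_mul]
  by_cases hk : IsUnit k
  · exact hunit k hk
  have hle (k : ZMod N) : ‖√(N : ℝ) * χ k‖ ^ 2 ≤ ‖dft χ k‖ ^ 2 := by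
    by_cases hk : IsUnit k
    · rw [hunit k hk]
    · rw [χ.map_nonunit hk, mul_zero, norm_zero, zero_pow two_ne_zero]
      positivity
  have hsum : ∑ k, ‖√(N : ℝ) * χ k‖ ^ 2 = ∑ k, ‖dft χ k‖ ^ 2 := by
    rw [sum_norm_dft_sq hr, Finset.mul_sum]
    refine Finset.sum_congr rfl fun k _ => ?_
    rw [norm_mul, mul_pow, Complex.norm_real, Real.norm_eq_abs, sq_abs, Real.sq_sqrt hN.le]
  have := (Finset.sum_eq_sum_iff_of_le fun k _ => hle k).1 hsum k (Finset.mem_univ k)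
  rw [χ.map_nonunit hk, mul_zero] at this ⊢
  rw [norm_zero, zero_pow two_ne_zero, eq_comm, sq_eq_zero_iff, norm_eq_zero] at this
  exact this

lemma LFunction_neg_one (hr : ∀ k, star (χ k) = χ k)
    (hτ : gaussSum χ stdAddChar = (√(N : ℝ) : ℂ)) :
    DirichletCharacter.LFunction χ (-1) =
      -(√(N : ℝ) : ℂ) ^ 3 / (2 * (π : ℂ) ^ 2) * LSeries (fun n => χ (n : ZMod N)) 2 := by
  have hN : (N : ℂ) ≠ 0 := Nat.cast_ne_zero.2 (NeZero.ne N)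
  have h1 := ZMod.LFunction_one_sub (χ : ZMod N → ℂ) (s := 2) (fun n h => by
    have := congrArg Complex.re h
    simp only [Complex.re_ofNat, Complex.neg_re, Complex.natCast_re] at this
    have h0 : (0 : ℝ) ≤ n := Nat.cast_nonneg n
    linarith) (Or.inr (by norm_num))
  have h2 : (fun x => χ (-x)) = χ := by
    funext x
    rw [← neg_one_mul, map_mul, even_of_gaussSum hr hτ, one_mul]
  have h3 : ZMod.LFunction (dft χ) 2 =
      √(N : ℝ) * LSeries (fun n => χ (n : ZMod N)) 2 := by
    rw [show dft χ = fun k => √(N : ℝ) * χ k from funext (dft_eq_sqrt_mul hr hτ),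
      ← ZMod.LFunction_eq_LSeries χ (s := 2) (by norm_num)]
    simp only [ZMod.LFunction, mul_assoc, ← Finset.mul_sum]
    ring
  rw [h2, h3] at h1
  rw [DirichletCharacter.LFunction, show (-1 : ℂ) = 1 - 2 by norm_num, h1]
  have e1 : (N : ℂ) ^ ((2 : ℂ) - 1) = (√(N : ℝ) : ℂ) ^ 2 := by
    rw [show (2 : ℂ) - 1 = 1 by norm_num, Complex.cpow_one, ← Complex.ofReal_pow,
      Real.sq_sqrt (Nat.cast_nonneg N), Complex.ofReal_natCast]
  have e2 : (2 * (π : ℂ)) ^ (-2 : ℂ) = ((2 * (π : ℂ)) ^ 2)⁻¹ := by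
    rw [Complex.cpow_neg]; norm_cast
  have e3 : Complex.Gamma 2 = 1 := by
    rw [show (2 : ℂ) = (1 : ℕ) + 1 by norm_num, Complex.Gamma_nat_eq_factorial]
    simp
  have e4 : Complex.exp (π * Complex.I * 2 / 2) = -1 := by
    rw [mul_div_cancel_right₀ _ two_ne_zero, Complex.exp_pi_mul_I]
  have e5 : Complex.exp (-π * Complex.I * 2 / 2) = -1 := by
    rw [mul_div_cancel_right₀ _ two_ne_zero, neg_mul, Complex.exp_neg, Complex.exp_pi_mul_I]
    norm_num
  rw [e1, e2, e3, e4, e5]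
  have hπ : (π : ℂ) ≠ 0 := by exact_mod_cast Real.pi_ne_zero
  field_simp
  ring

end Fourier

end ArcsinSum

namespace ArcsinSum

open Filter Topology Complex
open scoped Real

lemma summable_exp_neg_mul_sq {c : ℝ} (hc : 0 < c) :
    Summable fun n : ℤ => Real.exp (-π * c * (n : ℝ) ^ 2) := by
  have := (HurwitzZeta.hasSum_int_evenKernel 0 hc).summable
  refine this.congr fun n => ?_
  congr 1
  ring

lemma norm_exp_neg_mul_sq (η : ℂ) (n : ℤ) :
    ‖cexp (-π * η * (n : ℂ) ^ 2)‖ = Real.exp (-π * η.re * (n : ℝ) ^ 2) := by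
  rw [Complex.norm_exp]
  congr 1
  have : -(π : ℂ) * η * (n : ℂ) ^ 2 = ((-π * (n : ℝ) ^ 2 : ℝ) : ℂ) * η := by push_cast; ring
  rw [this, Complex.re_ofReal_mul]
  ring

lemma tendsto_tsum_exp {ι : Type*} {l : Filter ι} {w : ι → ℂ}
    (hw : Tendsto (fun x => (w x).re) l atTop) (t : ℝ) :
    Tendsto (fun x => ∑' n : ℤ, cexp (-π * w x * (n : ℂ) ^ 2) * cexp (2 * π * t * n * I)) l
      (𝓝 1) := by
  have hone : ∑' n : ℤ, (if n = 0 then (1 : ℂ) else 0) = 1 := tsum_ite_eq 0 _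
  rw [← hone]
  have hn (x : ι) (n : ℤ) : ‖cexp (-π * w x * (n : ℂ) ^ 2) * cexp (2 * π * t * n * I)‖ =
      Real.exp (-π * (w x).re * (n : ℝ) ^ 2) := by
    rw [norm_mul, norm_exp_neg_mul_sq]
    have : cexp (2 * π * t * n * I) = cexp (((2 * π * t * n : ℝ) : ℂ) * I) := by
      push_cast; rfl
    rw [this, Complex.norm_exp_ofReal_mul_I, mul_one]
  refine tendsto_tsum_of_dominated_convergence (summable_exp_neg_mul_sq one_pos) (fun n => ?_) ?_
  · split_ifs with h
    · subst h
      simpa using tendsto_const_nhds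
    · rw [tendsto_zero_iff_norm_tendsto_zero]
      simp only [hn]
      refine Real.tendsto_exp_atBot.comp ?_
      have h0 : (0 : ℝ) < π * (n : ℝ) ^ 2 := by positivity
      refine (tendsto_neg_atTop_atBot.comp (hw.const_mul_atTop h0)).congr fun x => ?_
      simp only [Function.comp_apply]
      ring
  · filter_upwards [hw.eventually_ge_atTop 1] with x hx n
    rw [hn]
    refine Real.exp_le_exp.2 ?_
    have := mul_le_mul_of_nonneg_left hx (by positivity : 0 ≤ π * (n : ℝ) ^ 2)
    linarith

lemma tsum_exp_residue {η : ℂ} (hη : 0 < η.re) {M : ℕ} (hM : M ≠ 0) (r : ℕ) :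
    (η * (M : ℂ) ^ 2) ^ (1 / 2 : ℂ) * ∑' n : ℤ, cexp (-π * η * ((r + M * n : ℤ) : ℂ) ^ 2) =
      ∑' n : ℤ, cexp (-π * (1 / η * (1 / (M : ℂ) ^ 2)) * (n : ℂ) ^ 2) *
        cexp (2 * π * ((r / M : ℝ) : ℂ) * n * I) := by
  have hη0 : η ≠ 0 := by rintro rfl; simp at hη
  have hM0 : (M : ℂ) ≠ 0 := Nat.cast_ne_zero.2 hM
  have ha : 0 < (η * (M : ℂ) ^ 2).re := by
    rw [← Complex.ofReal_natCast, ← Complex.ofReal_pow, mul_comm, Complex.re_ofReal_mul]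
    positivity
  have ha0 : η * (M : ℂ) ^ 2 ≠ 0 := mul_ne_zero hη0 (pow_ne_zero 2 hM0)
  have h := Complex.tsum_exp_neg_quadratic ha (-η * r * M)
  have h1 : ∑' n : ℤ, cexp (-π * η * ((r + M * n : ℤ) : ℂ) ^ 2) = cexp (-π * η * (r : ℂ) ^ 2) *
      ∑' n : ℤ, cexp (-π * (η * (M : ℂ) ^ 2) * (n : ℂ) ^ 2 + 2 * π * (-η * r * M) * n) := by
    rw [← tsum_mul_left]
    refine tsum_congr fun n => ?_
    rw [← Complex.exp_add]
    congr 1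
    push_cast
    ring
  have hp : (η * (M : ℂ) ^ 2) ^ (1 / 2 : ℂ) ≠ 0 := by
    rw [Ne, Complex.cpow_eq_zero_iff]
    exact fun h => ha0 h.1
  rw [h1, h, mul_left_comm, ← mul_assoc (_ ^ (1 / 2 : ℂ)), mul_one_div_cancel hp, one_mul,
    ← tsum_mul_left]
  refine tsum_congr fun n => ?_
  rw [← Complex.exp_add, ← Complex.exp_add]
  congr 1
  push_cast
  field_simp
  linear_combination (-(r:ℂ) ^ 2 * η ^ 2 * (M:ℂ) ^ 2) * Complex.I_sq

lemma tendsto_theta {ι : Type*} {l : Filter ι} {η : ι → ℂ} (hη : ∀ᶠ x in l, 0 < (η x).re)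
    (hw : Tendsto (fun x => (1 / η x).re) l atTop) {M : ℕ} (hM : M ≠ 0) {g : ℤ → ℂ}
    (hg1 : ∀ n, ‖g n‖ ≤ 1) (hg : ∀ n q : ℤ, g (n + M * q) = g n) :
    Tendsto (fun x => (η x * (M : ℂ) ^ 2) ^ (1 / 2 : ℂ) *
      ∑' n : ℤ, g n * cexp (-π * η x * (n : ℂ) ^ 2)) l (𝓝 (∑ r ∈ Finset.range M, g r)) := by
  have : NeZero M := ⟨hM⟩
  have hlim (r : ℕ) : Tendsto (fun x => g r * ((η x * (M : ℂ) ^ 2) ^ (1 / 2 : ℂ) *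
      ∑' n : ℤ, cexp (-π * η x * ((r + M * n : ℤ) : ℂ) ^ 2))) l (𝓝 (g r)) := by
    have hw' : Tendsto (fun x => (1 / η x * (1 / (M : ℂ) ^ 2)).re) l atTop := by
      have e (x : ι) : (1 / η x * (1 / (M : ℂ) ^ 2)).re = (1 / (M : ℝ) ^ 2) * (1 / η x).re := by
        rw [mul_comm, ← Complex.re_ofReal_mul]
        push_cast
        rfl
      simp only [e]
      exact hw.const_mul_atTop (by positivity)
    have h1 := (tendsto_tsum_exp hw' (r / M)).const_mul (g r)
    rw [mul_one] at h1
    refine h1.congr' ?_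
    filter_upwards [hη] with x hx
    rw [tsum_exp_residue hx hM r]
  rw [← Fin.sum_univ_eq_sum_range (fun r => g r) M]
  refine (tendsto_finsetSum Finset.univ fun (r : Fin M) _ => hlim r).congr' ?_
  filter_upwards [hη] with x hx
  have hs : Summable fun n : ℤ => g n * cexp (-π * η x * (n : ℂ) ^ 2) := by
    refine Summable.of_norm_bounded (summable_exp_neg_mul_sq hx) fun n => ?_
    rw [norm_mul, norm_exp_neg_mul_sq]
    exact mul_le_of_le_one_left (Real.exp_nonneg _) (hg1 n)
  have hs' := (Int.divModEquiv M).symm.summable_iff.2 hs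
  have hs2 := (Equiv.prodComm (Fin M) ℤ).summable_iff.2 hs'
  rw [← (Int.divModEquiv M).symm.tsum_eq, ← (Equiv.prodComm (Fin M) ℤ).tsum_eq]
  refine Eq.trans ?_ (congrArg _ (Summable.tsum_prod hs2).symm)
  rw [tsum_fintype, Finset.mul_sum]
  refine Finset.sum_congr rfl fun r _ => ?_
  simp only [Function.comp_apply, Equiv.prodComm_apply, Prod.swap_prod_mk, Int.divModEquiv_symm_apply]
  rw [mul_left_comm, ← tsum_mul_left]
  congr 2
  funext n
  have e : ((r : ℕ) : ℤ) + M * n = n * M + (r : ℕ) := by ring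
  rw [← hg r n, e]

end ArcsinSum

namespace ArcsinSum

open Filter Topology Complex
open scoped Real

/-- The quadratic Gauss sum modulo `N`. -/
noncomputable def quadGauss (N : ℕ) : ℂ :=
  ∑ r ∈ Finset.range N, cexp (2 * π * I * ((r : ℤ) : ℂ) ^ 2 / N)

lemma cpow_half_real_mul {c : ℝ} (hc : 0 < c) {v : ℂ} (hv : v ≠ 0) :
    ((c : ℂ) * v) ^ (1 / 2 : ℂ) = (c : ℂ) ^ (1 / 2 : ℂ) * v ^ (1 / 2 : ℂ) := by
  have hc' : (c : ℂ) ≠ 0 := Complex.ofReal_ne_zero.2 hc.ne'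
  rw [cpow_def_of_ne_zero (mul_ne_zero hc' hv), cpow_def_of_ne_zero hc', cpow_def_of_ne_zero hv,
    log_ofReal_mul hc hv, ← ofReal_log hc.le, add_mul, Complex.exp_add]

lemma cpow_half_neg_two_I_div {N : ℕ} (hN : N ≠ 0) :
    (-(2 * I / N)) ^ (1 / 2 : ℂ) = (1 - I) / (√(N : ℝ) : ℂ) := by
  have hs : 0 < √(N : ℝ) := Real.sqrt_pos.2 (by positivity)
  have hre : 0 < ((1 - I) / (√(N : ℝ) : ℂ)).re := by
    rw [Complex.div_ofReal_re]
    simpa using hs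
  have hs0 : (√(N : ℝ) : ℂ) ≠ 0 := Complex.ofReal_ne_zero.2 hs.ne'
  have hsq : ((1 - I) / (√(N : ℝ) : ℂ)) ^ 2 = -(2 * I / N) := by
    have : (√(N : ℝ) : ℂ) ^ 2 = N := by
      rw [← Complex.ofReal_pow, Real.sq_sqrt (Nat.cast_nonneg N), Complex.ofReal_natCast]
    rw [div_pow, this, sub_sq, Complex.I_sq]
    ring
  rw [← hsq, one_div, Complex.sq_cpow_two_inv hre]

lemma quadGauss_eq {N : ℕ} (hN : N ≠ 0) :
    quadGauss N = √(N : ℝ) * (1 + (-I) ^ N) / (1 - I) := by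
  have hN0 : (N : ℂ) ≠ 0 := Nat.cast_ne_zero.2 hN
  have hNr : (0 : ℝ) < N := by positivity
  set u : ℝ → ℂ := fun ε => 1 + I * N * ε / 2 with hu
  set η : ℝ → ℂ := fun ε => ((ε * N ^ 2 / 4 : ℝ) : ℂ) * (u ε)⁻¹ with hη
  have hure (ε : ℝ) : (u ε).re = 1 := by simp [hu]
  have hu0 (ε : ℝ) : u ε ≠ 0 := fun h => by
    have := hure ε
    rw [h] at this
    simp at this
  have hpos : ∀ᶠ ε : ℝ in 𝓝[>] 0, 0 < ε := eventually_mem_nhdsWithin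
  have h1 := tendsto_theta (l := 𝓝[>] (0 : ℝ)) (η := fun ε => (ε : ℂ)) (M := N)
    (g := fun n => cexp (2 * π * I * (n : ℂ) ^ 2 / N))
    (by filter_upwards [hpos] with ε hε; simpa using hε)
    (by
      refine (tendsto_inv_nhdsGT_zero (𝕜 := ℝ)).congr fun ε => ?_
      rw [one_div, ← Complex.ofReal_inv, Complex.ofReal_re]) hN
    (fun n => by
      have : cexp (2 * π * I * (n : ℂ) ^ 2 / N) = cexp (((2 * π * n ^ 2 / N : ℝ) : ℂ) * I) := by
        congr 1; push_cast; ring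
      rw [this, Complex.norm_exp_ofReal_mul_I])
    (fun n q => by
      rw [Complex.exp_eq_exp_iff_exists_int]
      refine ⟨2 * n * q + N * q ^ 2, ?_⟩
      push_cast
      field_simp
      ring)
  have h2 := tendsto_theta (l := 𝓝[>] (0 : ℝ)) (η := η) (M := 2)
    (g := fun n => cexp (-π * I * N * (n : ℂ) ^ 2 / 2))
    (by
      filter_upwards [hpos] with ε hε
      rw [hη, Complex.re_ofReal_mul, Complex.inv_re, hure]
      have := Complex.normSq_pos.2 (hu0 ε)
      positivity)
    (by
      have h0 : Tendsto (fun ε : ℝ => 4 / (N : ℝ) ^ 2 * ε⁻¹) (𝓝[>] 0) atTop :=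
        (tendsto_inv_nhdsGT_zero (𝕜 := ℝ)).const_mul_atTop (by positivity)
      refine h0.congr fun ε => ?_
      rw [hη]
      simp only
      rw [one_div, mul_inv, inv_inv, ← Complex.ofReal_inv, Complex.re_ofReal_mul, hure, mul_one,
        inv_div]
      ring) two_ne_zero
    (fun n => by
      have : cexp (-π * I * N * (n : ℂ) ^ 2 / 2) =
          cexp (((-π * N * n ^ 2 / 2 : ℝ) : ℂ) * I) := by
        congr 1; push_cast; ring
      rw [this, Complex.norm_exp_ofReal_mul_I])
    (fun n q => by
      rw [Complex.exp_eq_exp_iff_exists_int]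
      refine ⟨-(N * (n * q + q ^ 2)), ?_⟩
      push_cast
      ring)
  have hz : Tendsto (fun ε : ℝ => 1 / (ε + -(2 * I / N) : ℂ) ^ (1 / 2 : ℂ)) (𝓝[>] 0)
      (𝓝 (1 / ((1 - I) / (√(N : ℝ) : ℂ)))) := by
    rw [← cpow_half_neg_two_I_div hN]
    have hne : (-(2 * I / N) : ℂ).im ≠ 0 := by
      have : (-(2 * I / N) : ℂ) = ((-(2 / N) : ℝ) : ℂ) * I := by push_cast; ring
      rw [this, Complex.im_ofReal_mul, Complex.I_im, mul_one]
      exact neg_ne_zero.2 (by positivity)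
    have hslit : (-(2 * I / N) : ℂ) ∈ slitPlane := Or.inr hne
    have hlin : Tendsto (fun ε : ℝ => (ε + -(2 * I / N) : ℂ)) (𝓝[>] 0) (𝓝 (-(2 * I / N))) := by
      have : Continuous fun ε : ℝ => (ε + -(2 * I / N) : ℂ) := by fun_prop
      have := (this.tendsto 0).mono_left (nhdsWithin_le_nhds (s := Set.Ioi (0 : ℝ)))
      simpa using this
    have hpow := ((continuousAt_cpow_const (b := (1 / 2 : ℂ)) hslit).tendsto.comp hlin)
    refine tendsto_const_nhds.div hpow ?_
    rw [Ne, Complex.cpow_eq_zero_iff]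
    exact fun h => slitPlane_ne_zero hslit h.1
  have hv : Tendsto (fun ε : ℝ => 1 / ((u ε)⁻¹) ^ (1 / 2 : ℂ)) (𝓝[>] 0) (𝓝 1) := by
    have hlin : Tendsto (fun ε : ℝ => (u ε)⁻¹) (𝓝[>] 0) (𝓝 1) := by
      have hcu : Continuous u := by fun_prop
      have := ((hcu.inv₀ hu0).tendsto 0).mono_left (nhdsWithin_le_nhds (s := Set.Ioi (0 : ℝ)))
      rw [show u⁻¹ 0 = 1 by simp [hu]] at this
      exact this
    have hpow := (continuousAt_cpow_const (b := (1 / 2 : ℂ)) one_mem_slitPlane).tendsto.comp hlin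
    rw [Complex.one_cpow] at hpow
    have := (tendsto_const_nhds (x := (1 : ℂ))).div hpow one_ne_zero
    rwa [div_one] at this
  have h3 := (hv.mul hz).mul h2
  have h4 := tendsto_nhds_unique h1 (h3.congr' ?_)
  · rw [quadGauss, h4, Finset.sum_range_succ, Finset.sum_range_one]
    have e : cexp (-π * I * N * (((1 : ℕ) : ℤ) : ℂ) ^ 2 / 2) = (-I) ^ N := by
      rw [← Complex.exp_neg_pi_div_two_mul_I, ← Complex.exp_nat_mul]
      congr 1
      push_cast
      ring
    rw [e]
    have h1I : (1 - I : ℂ) ≠ 0 := fun h => by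
      have := congrArg Complex.re h
      simp at this
    have hs0 : (√(N : ℝ) : ℂ) ≠ 0 := Complex.ofReal_ne_zero.2 (Real.sqrt_pos.2 hNr).ne'
    simp only [Nat.cast_zero, Int.cast_zero, ne_eq, OfNat.ofNat_ne_zero, not_false_eq_true,
      zero_pow, mul_zero, zero_div, Complex.exp_zero]
    field_simp
  filter_upwards [hpos] with ε hε
  have hε0 : (ε : ℂ) ≠ 0 := Complex.ofReal_ne_zero.2 hε.ne'
  have hre : 0 < (ε + -(2 * I / N) : ℂ).re := by
    have : (ε + -(2 * I / N) : ℂ) = ε + ((-(2 / N) : ℝ) : ℂ) * I := by push_cast; ring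
    rw [this]
    simpa using hε
  have hz0 : (ε + -(2 * I / N) : ℂ) ≠ 0 := fun h => by rw [h] at hre; simp at hre
  have hzu : (ε + -(2 * I / N) : ℂ) = -(2 * I / N) * u ε := by
    simp only [hu]
    field_simp
    linear_combination (N * ε : ℂ) * Complex.I_sq
  have hinv : 1 / (ε + -(2 * I / N) : ℂ) = N * I / 2 + η ε := by
    rw [div_eq_iff hz0, hzu]
    simp only [hη]
    have := hu0 ε
    push_cast
    field_simp
    simp only [hu]
    linear_combination (4 + 2 * I * N * ε : ℂ) * Complex.I_sq
  have hl : ∑' n : ℤ, cexp (2 * π * I * (n : ℂ) ^ 2 / N) * cexp (-π * (ε : ℂ) * (n : ℂ) ^ 2) =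
      ∑' n : ℤ, cexp (-π * (ε + -(2 * I / N)) * (n : ℂ) ^ 2) := by
    refine tsum_congr fun n => ?_
    rw [← Complex.exp_add]
    congr 1
    ring
  have hr : ∑' n : ℤ, cexp (-π / (ε + -(2 * I / N)) * (n : ℂ) ^ 2) =
      ∑' n : ℤ, cexp (-π * I * N * (n : ℂ) ^ 2 / 2) * cexp (-π * η ε * (n : ℂ) ^ 2) := by
    refine tsum_congr fun n => ?_
    rw [← Complex.exp_add, div_eq_mul_one_div, hinv]
    congr 1
    ring
  rw [hl, Complex.tsum_exp_neg_mul_int_sq hre, hr]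
  have hc : 0 < ε * (N : ℝ) ^ 2 := by positivity
  have e1 : η ε * ((2 : ℕ) : ℂ) ^ 2 = ((ε * N ^ 2 : ℝ) : ℂ) * (u ε)⁻¹ := by
    simp only [hη]; push_cast; ring
  have e2 : (ε : ℂ) * (N : ℂ) ^ 2 = ((ε * N ^ 2 : ℝ) : ℂ) := by push_cast; rfl
  have hu1 : ((u ε)⁻¹) ^ (1 / 2 : ℂ) ≠ 0 := by
    rw [Ne, Complex.cpow_eq_zero_iff]
    exact fun h => inv_ne_zero (hu0 ε) h.1
  rw [e1, e2, cpow_half_real_mul hc (inv_ne_zero (hu0 ε))]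
  generalize ((u ε)⁻¹) ^ (1 / 2 : ℂ) = v at *
  generalize ∑' n : ℤ, cexp (-π * I * N * (n : ℂ) ^ 2 / 2) * cexp (-π * η ε * (n : ℂ) ^ 2) = S
  field_simp

end ArcsinSum

namespace ArcsinSum

open ZMod
open scoped Real

lemma stdAddChar_crt {a b : ℕ} [NeZero a] [NeZero b] (x y : ℕ) :
    (stdAddChar ((b * x + a * y : ℕ) : ZMod (a * b)) : ℂ) =
      stdAddChar (x : ZMod a) * stdAddChar (y : ZMod b) := by
  have ha : (a : ℂ) ≠ 0 := by simp [NeZero.ne a]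
  have hb : (b : ℂ) ≠ 0 := by simp [NeZero.ne b]
  have h := fun (N n : ℕ) [NeZero N] => ZMod.stdAddChar_coe (N := N) (n : ℤ)
  simp only [Int.cast_natCast] at h
  rw [h, h, h, ← Complex.exp_add]
  congr 1
  push_cast
  field_simp

/-- Chinese remainder theorem for sums weighted by the standard additive character. -/
lemma sum_mul_stdAddChar_crt {a b : ℕ} [NeZero a] [NeZero b] (hab : a.Coprime b)
    {F : ZMod (a * b) → ℂ} {G : ZMod a → ℂ} {H : ZMod b → ℂ} {c : ℂ}
    (h : ∀ x y : ℕ, F ((b * x + a * y : ℕ) : ZMod (a * b)) = c * G x * H y) :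
    ∑ n, F n * stdAddChar n =
      c * (∑ x, G x * (stdAddChar x : ℂ)) * ∑ y, H y * (stdAddChar y : ℂ) := by
  have hbij : Function.Bijective fun p : ZMod a × ZMod b =>
      ((b * p.1.val + a * p.2.val : ℕ) : ZMod (a * b)) := by
    rw [Fintype.bijective_iff_injective_and_card]
    refine ⟨fun ⟨x, y⟩ ⟨x', y'⟩ hxy => ?_, by simp [ZMod.card]⟩
    simp only [ZMod.natCast_eq_natCast_iff] at hxy
    have h1 := hxy.of_mul_right b
    have h2 := hxy.of_mul_left a
    rw [← ZMod.natCast_eq_natCast_iff] at h1 h2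
    simp only [Nat.cast_add, Nat.cast_mul, ZMod.natCast_self, zero_mul, add_zero, zero_add,
      ZMod.natCast_zmod_val] at h1 h2
    have ub : IsUnit (b : ZMod a) := (ZMod.isUnit_iff_coprime b a).mpr hab.symm
    have ua : IsUnit (a : ZMod b) := (ZMod.isUnit_iff_coprime a b).mpr hab
    rw [ub.mul_left_cancel h1, ua.mul_left_cancel h2]
  rw [← hbij.sum_comp, Fintype.sum_prod_type, mul_assoc, Finset.sum_mul_sum, Finset.mul_sum]
  refine Finset.sum_congr rfl fun x _ => ?_
  rw [Finset.mul_sum]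
  refine Finset.sum_congr rfl fun y _ => ?_
  rw [h, stdAddChar_crt, ZMod.natCast_zmod_val, ZMod.natCast_zmod_val]
  ring

/-- The Gauss sum of the Jacobi symbol modulo `m`. -/
noncomputable def jacobiGauss (m : ℕ) [NeZero m] : ℂ :=
  ∑ n : ZMod m, (jacobiSym (n.val : ℤ) m : ℂ) * stdAddChar n

lemma jacobiSym_val (m n : ℕ) : jacobiSym (((n : ZMod m).val : ℕ) : ℤ) m = jacobiSym n m := by
  rw [ZMod.val_natCast, Int.natCast_mod, ← jacobiSym.mod_left]

lemma jacobiGauss_mul {a b : ℕ} [NeZero a] [NeZero b] (hab : a.Coprime b) :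
    jacobiGauss (a * b) = jacobiSym b a * jacobiSym a b * jacobiGauss a * jacobiGauss b := by
  refine sum_mul_stdAddChar_crt hab fun x y => ?_
  rw [jacobiSym_val, jacobiSym_val, jacobiSym_val, jacobiSym.mul_right]
  have h1 : jacobiSym ((b * x + a * y : ℕ) : ℤ) a = jacobiSym b a * jacobiSym x a := by
    rw [← jacobiSym.mul_left]
    refine jacobiSym.mod_left' ?_
    push_cast
    simp
  have h2 : jacobiSym ((b * x + a * y : ℕ) : ℤ) b = jacobiSym a b * jacobiSym y b := by
    rw [← jacobiSym.mul_left]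
    refine jacobiSym.mod_left' ?_
    push_cast
    simp
  rw [h1, h2]
  push_cast
  ring

lemma jacobiGauss_prime {p : ℕ} [Fact p.Prime] (hp : p ≠ 2) : jacobiGauss p = quadGauss p := by
  have hp0 : p ≠ 0 := (Fact.out : p.Prime).ne_zero
  have h0 : ∑ n : ZMod p, (stdAddChar n : ℂ) = 0 :=
    AddChar.sum_eq_zero_of_ne_one
      (((ZMod.isPrimitive_stdAddChar p) (a := 1) one_ne_zero |> fun h => by simpa using h))
  have hsq : quadGauss p = ∑ x : ZMod p, (stdAddChar (x ^ 2) : ℂ) := by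
    refine Finset.sum_nbij' (fun r : ℕ => (r : ZMod p)) ZMod.val (fun _ _ => Finset.mem_univ _)
      (fun x _ => Finset.mem_range.2 x.val_lt)
      (fun r hr => ZMod.val_cast_of_lt (Finset.mem_range.1 hr))
      (fun x _ => ZMod.natCast_zmod_val x) fun r _ => ?_
    have := ZMod.stdAddChar_coe (N := p) ((r : ℤ) ^ 2)
    push_cast at this ⊢
    exact this.symm
  rw [hsq, ← Finset.sum_fiberwise (g := fun x : ZMod p => x ^ 2) (s := Finset.univ)]
  rw [jacobiGauss, ← add_zero (∑ n : ZMod p, _), ← h0, ← Finset.sum_add_distrib]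
  refine Finset.sum_congr rfl fun n _ => ?_
  rw [Finset.sum_congr rfl (g := fun _ => (stdAddChar n : ℂ))
    (fun x hx => by rw [(Finset.mem_filter.mp hx).2]), Finset.sum_const, nsmul_eq_mul]
  have := legendreSym.card_sqrts p hp (n.val : ℤ)
  rw [jacobiSym.legendreSym.to_jacobiSym] at this
  simp only [Int.cast_natCast, ZMod.natCast_zmod_val] at this
  have h2 : ({x : ZMod p | x ^ 2 = n}.toFinset.card : ℂ) = jacobiSym (n.val : ℤ) p + 1 := by
    exact_mod_cast this
  rw [← add_one_mul, ← h2]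
  congr 3
  ext; simp

lemma quadGauss_of_odd {m : ℕ} (ho : Odd m) :
    quadGauss m = if m % 4 = 1 then (√(m : ℝ) : ℂ) else Complex.I * (√(m : ℝ) : ℂ) := by
  have hI : (1 - Complex.I : ℂ) ≠ 0 := by
    intro h
    simpa using congrArg Complex.re h
  rw [quadGauss_eq ho.pos.ne', ← Nat.div_add_mod m 4, pow_add, pow_mul, neg_pow,
    Complex.I_pow_four]
  have := Nat.odd_mod_four_iff.mp (Nat.odd_iff.mp ho)
  rcases this with h | h <;> rw [h] <;> field_simp
  · norm_num
    ring
  · norm_num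
    linear_combination (√(4 * ((m / 4 : ℕ) : ℝ) + 3) : ℂ) * Complex.I_sq

lemma jacobiGauss_eq (m : ℕ) [NeZero m] (hm : Squarefree m) (ho : Odd m) :
    jacobiGauss m = if m % 4 = 1 then (√(m : ℝ) : ℂ) else Complex.I * (√(m : ℝ) : ℂ) := by
  rename_i h0
  revert h0
  induction m using induction_on_primes with
  | zero => intro h0; exact absurd rfl h0.out
  | one =>
    intro h0
    simpa [jacobiGauss] using
      (congrArg _ (Subsingleton.elim _ _)).trans (AddChar.map_zero_eq_one stdAddChar)
  | prime_mul p a hp ih =>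
    intro h0
    have : Fact p.Prime := ⟨hp⟩
    have ha : NeZero a := ⟨fun h => h0.out (by simp [h])⟩
    obtain ⟨hc, -, hsa⟩ := Nat.squarefree_mul_iff.mp hm
    obtain ⟨hop, hoa⟩ := Nat.odd_mul.mp ho
    have hp2 : p ≠ 2 := by rintro rfl; exact absurd hop (by decide)
    rw [jacobiGauss_mul hc, ih hsa hoa, jacobiGauss_prime hp2, quadGauss_of_odd hop,
      Nat.cast_mul, Real.sqrt_mul (Nat.cast_nonneg p), Nat.mul_mod,
      ← jacobiSym.quadratic_reciprocity_if (Nat.odd_iff.mp hop) (Nat.odd_iff.mp hoa)]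
    have hj : (jacobiSym a p : ℂ) * jacobiSym a p = 1 := by
      have := jacobiSym.sq_one (a := (a : ℤ)) (b := p) (by simpa using hc.symm)
      rw [← sq]; exact_mod_cast this
    rcases Nat.odd_mod_four_iff.mp (Nat.odd_iff.mp hop) with h | h <;>
      rcases Nat.odd_mod_four_iff.mp (Nat.odd_iff.mp hoa) with h' | h' <;>
      simp [h, h', -mul_eq_mul_right_iff, -mul_eq_mul_left_iff, -mul_eq_left₀, -mul_eq_right₀]
    · linear_combination (√(p : ℝ) : ℂ) * (√(a : ℝ) : ℂ) * hj
    · linear_combination Complex.I * (√(p : ℝ) : ℂ) * (√(a : ℝ) : ℂ) * hj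
    · linear_combination Complex.I * (√(p : ℝ) : ℂ) * (√(a : ℝ) : ℂ) * hj
    · linear_combination (√(p : ℝ) : ℂ) * (√(a : ℝ) : ℂ) * hj -
        (jacobiSym a p : ℂ) ^ 2 * (√(p : ℝ) : ℂ) * (√(a : ℝ) : ℂ) * Complex.I_sq

end ArcsinSum

namespace ArcsinSum

open ZMod
open scoped Real

lemma gaussSum_of_forall_eq {a k : ℕ} [NeZero a] [NeZero k] (hak : a.Coprime k)
    (χ : DirichletCharacter ℂ (a * k)) (A : MulChar (ZMod k) ℤ)
    (h : ∀ n : ℕ, χ (n : ZMod (a * k)) = A n * jacobiSym n a) :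
    gaussSum χ stdAddChar =
      A a * jacobiSym k a * jacobiGauss a * ∑ y : ZMod k, (A y : ℂ) * stdAddChar y := by
  refine sum_mul_stdAddChar_crt hak fun x y => ?_
  have h1 : jacobiSym ((k * x + a * y : ℕ) : ℤ) a = jacobiSym k a * jacobiSym x a := by
    rw [← jacobiSym.mul_left]
    refine jacobiSym.mod_left' ?_
    push_cast
    simp
  have h2 : A ((k * x + a * y : ℕ) : ZMod k) = A a * A y := by
    rw [← map_mul]
    simp
  rw [h, h1, h2, jacobiSym_val]
  push_cast
  ring

lemma sum_zmod_eq_sum_range {k : ℕ} [NeZero k] (F : ZMod k → ℂ) :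
    ∑ y, F y = ∑ r ∈ Finset.range k, F (r : ZMod k) :=
  (Finset.sum_nbij' (fun r : ℕ => (r : ZMod k)) ZMod.val (fun _ _ => Finset.mem_univ _)
    (fun x _ => Finset.mem_range.2 x.val_lt)
    (fun _ hr => ZMod.val_cast_of_lt (Finset.mem_range.1 hr))
    (fun x _ => ZMod.natCast_zmod_val x) fun _ _ => rfl).symm

lemma stdAddChar_natCast {k : ℕ} [NeZero k] (r : ℕ) :
    (stdAddChar (r : ZMod k) : ℂ) = Complex.exp (2 * π * Complex.I / k) ^ r := by
  have := ZMod.stdAddChar_coe (N := k) (r : ℤ)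
  rw [Int.cast_natCast] at this
  rw [this, ← Complex.exp_nat_mul]
  congr 1
  push_cast
  ring

lemma exp_quarter : Complex.exp (2 * π * Complex.I / (4 : ℕ)) = Complex.I := by
  have : 2 * π * Complex.I / (4 : ℕ) = π / 2 * Complex.I := by
    push_cast
    ring
  rw [this, Complex.exp_pi_div_two_mul_I]

lemma exp_eighth : Complex.exp (2 * π * Complex.I / (8 : ℕ)) = (√2 : ℂ) / 2 * (1 + Complex.I) := by
  have : 2 * π * Complex.I / (8 : ℕ) = ((π / 4 : ℝ) : ℂ) * Complex.I := by
    push_cast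
    ring
  rw [this, Complex.exp_mul_I, ← Complex.ofReal_cos, ← Complex.ofReal_sin, Real.cos_pi_div_four,
    Real.sin_pi_div_four]
  push_cast
  ring

lemma exp_eighth_sq : Complex.exp (2 * π * Complex.I / (8 : ℕ)) ^ 2 = Complex.I := by
  rw [← Complex.exp_nat_mul]
  refine Eq.trans (congrArg _ ?_) exp_quarter
  push_cast
  ring

lemma sum_χ₄ : ∑ y : ZMod 4, (χ₄ y : ℂ) * stdAddChar y = 2 * Complex.I := by
  rw [sum_zmod_eq_sum_range]
  simp only [stdAddChar_natCast, exp_quarter, Finset.sum_range_succ, Finset.sum_range_zero]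
  have h0 : χ₄ ((0 : ℕ) : ZMod 4) = 0 := by decide
  have h1 : χ₄ ((1 : ℕ) : ZMod 4) = 1 := by decide
  have h2 : χ₄ ((2 : ℕ) : ZMod 4) = 0 := by decide
  have h3 : χ₄ ((3 : ℕ) : ZMod 4) = -1 := by decide
  rw [h0, h1, h2, h3, Complex.I_pow_three]
  push_cast
  ring

lemma sum_χ₈ : ∑ y : ZMod 8, (χ₈ y : ℂ) * stdAddChar y = 2 * (√2 : ℂ) := by
  rw [sum_zmod_eq_sum_range]
  simp only [stdAddChar_natCast, Finset.sum_range_succ, Finset.sum_range_zero]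
  have h0 : χ₈ ((0 : ℕ) : ZMod 8) = 0 := by decide
  have h1 : χ₈ ((1 : ℕ) : ZMod 8) = 1 := by decide
  have h2 : χ₈ ((2 : ℕ) : ZMod 8) = 0 := by decide
  have h3 : χ₈ ((3 : ℕ) : ZMod 8) = -1 := by decide
  have h4 : χ₈ ((4 : ℕ) : ZMod 8) = 0 := by decide
  have h5 : χ₈ ((5 : ℕ) : ZMod 8) = -1 := by decide
  have h6 : χ₈ ((6 : ℕ) : ZMod 8) = 0 := by decide
  have h7 : χ₈ ((7 : ℕ) : ZMod 8) = 1 := by decide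
  rw [h0, h1, h2, h3, h4, h5, h6, h7]
  have h2 := exp_eighth_sq
  have he := exp_eighth
  generalize Complex.exp (2 * π * Complex.I / (8 : ℕ)) = w at h2 he
  push_cast
  linear_combination (-w - w * (w ^ 2 + Complex.I) +
    w * (w ^ 4 + w ^ 2 * Complex.I + Complex.I ^ 2)) * h2 +
    (-w + w * Complex.I - (√2 : ℂ)) * Complex.I_sq + 2 * (1 - Complex.I) * he

lemma sum_χ₈' : ∑ y : ZMod 8, (χ₈' y : ℂ) * stdAddChar y = 2 * (√2 : ℂ) * Complex.I := by
  rw [sum_zmod_eq_sum_range]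
  simp only [stdAddChar_natCast, Finset.sum_range_succ, Finset.sum_range_zero]
  have h0 : χ₈' ((0 : ℕ) : ZMod 8) = 0 := by decide
  have h1 : χ₈' ((1 : ℕ) : ZMod 8) = 1 := by decide
  have h2 : χ₈' ((2 : ℕ) : ZMod 8) = 0 := by decide
  have h3 : χ₈' ((3 : ℕ) : ZMod 8) = 1 := by decide
  have h4 : χ₈' ((4 : ℕ) : ZMod 8) = 0 := by decide
  have h5 : χ₈' ((5 : ℕ) : ZMod 8) = -1 := by decide
  have h6 : χ₈' ((6 : ℕ) : ZMod 8) = 0 := by decide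
  have h7 : χ₈' ((7 : ℕ) : ZMod 8) = -1 := by decide
  rw [h0, h1, h2, h3, h4, h5, h6, h7]
  have h2 := exp_eighth_sq
  have he := exp_eighth
  generalize Complex.exp (2 * π * Complex.I / (8 : ℕ)) = w at h2 he
  push_cast
  linear_combination (w - w * (w ^ 2 + Complex.I) -
    w * (w ^ 4 + w ^ 2 * Complex.I + Complex.I ^ 2)) * h2 +
    (-w - w * Complex.I + (√2 : ℂ)) * Complex.I_sq + 2 * (1 + Complex.I) * he

lemma kroneckerSym_even {D : ℤ} (hD : D % 2 = 0) {n : ℕ} (hn0 : n ≠ 0) (hn : Even n) :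
    kroneckerSym D n = 0 := by
  have : n.factorization 2 ≠ 0 :=
    (Nat.prime_two.factorization_pos_of_dvd hn0 hn.two_dvd).ne'
  rw [kroneckerSym, if_neg hn0, if_pos hD, zero_pow this, zero_mul]

lemma forall_eq_of_odd {N k a : ℕ} [NeZero N] (χ : DirichletCharacter ℂ N)
    (hχ : ∀ n : ℕ, χ n = kroneckerSym (N : ℤ) n) (hN : (N : ℤ) % 2 = 0) {A : MulChar (ZMod k) ℤ}
    (hA : ∀ x : ZMod k, x + x ≠ 1)
    (h : ∀ n : ℕ, Odd n → jacobiSym (N : ℤ) n = A n * jacobiSym n a) (n : ℕ) :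
    χ n = A n * jacobiSym n a := by
  rw [hχ]
  rcases Nat.even_or_odd n with hn | hn
  · have hA0 : A (n : ZMod k) = 0 := by
      refine A.map_nonunit fun hu => ?_
      obtain ⟨m, rfl⟩ := hn
      obtain ⟨u, hu⟩ := hu.exists_right_inv
      exact hA (m * u) (by rw [← add_mul, ← Nat.cast_add, hu])
    rw [hA0, Int.cast_zero, zero_mul, Int.cast_eq_zero]
    rcases eq_or_ne n 0 with rfl | h0
    · rw [kroneckerSym, if_pos rfl, if_neg (by omega)]
    · exact kroneckerSym_even hN h0 hn
  · rw [kroneckerSym_of_odd _ hn, h n hn, Int.cast_mul]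

lemma sqrt_natCast_mul (a b : ℕ) : (√((a * b : ℕ) : ℝ) : ℂ) = (√(a : ℝ) : ℂ) * (√(b : ℝ) : ℂ) := by
  rw [Nat.cast_mul, Real.sqrt_mul (Nat.cast_nonneg a), Complex.ofReal_mul]

lemma gaussSum_of_four_mul {a : ℕ} [NeZero a] (ha : Squarefree a) (h3 : a % 4 = 3)
    (χ : DirichletCharacter ℂ (a * 4)) (hχ : ∀ n : ℕ, χ n = kroneckerSym ((a * 4 : ℕ) : ℤ) n) :
    gaussSum χ stdAddChar = (√((a * 4 : ℕ) : ℝ) : ℂ) := by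
  have ho : Odd a := Nat.odd_iff.mpr (by omega)
  have h : ∀ n : ℕ, χ n = χ₄ n * jacobiSym n a := by
    refine forall_eq_of_odd χ hχ (by simp; omega) (by decide) fun n hn => ?_
    push_cast
    rw [jacobiSym.mul_left, jacobiSym.at_four hn, mul_one, χ₄_nat_eq_if_mod_four,
      ← jacobiSym.quadratic_reciprocity_if (Nat.odd_iff.mp ho) (Nat.odd_iff.mp hn)]
    rcases Nat.odd_mod_four_iff.mp (Nat.odd_iff.mp hn) with h' | h' <;>
      simp [h3, h', Nat.odd_iff.mp hn]
  have hc : a.Coprime 4 := (Nat.Coprime.pow_right 2 ho.coprime_two_right : a.Coprime (2 ^ 2))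
  rw [gaussSum_of_forall_eq hc χ χ₄ h, sum_χ₄, jacobiGauss_eq a ha ho, if_neg (by omega),
    sqrt_natCast_mul, χ₄_nat_three_mod_four h3]
  have h4 : jacobiSym ((4 : ℕ) : ℤ) a = 1 := jacobiSym.at_four ho
  have hs : √((4 : ℕ) : ℝ) = 2 := by
    rw [show ((4 : ℕ) : ℝ) = 2 ^ 2 by norm_num, Real.sqrt_sq (by norm_num)]
  rw [h4, hs]
  push_cast
  linear_combination (-2 * √(a : ℝ) : ℂ) * Complex.I_sq

lemma jacobiSym_eight {b : ℕ} (hb : Odd b) : jacobiSym ((8 : ℕ) : ℤ) b = χ₈ b := by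
  have : ((8 : ℕ) : ℤ) = 4 * 2 := by norm_num
  rw [this, jacobiSym.mul_left, jacobiSym.at_four hb, one_mul, jacobiSym.at_two hb]

lemma gaussSum_of_eight_mul {a : ℕ} [NeZero a] (ha : Squarefree a) (ho : Odd a)
    (χ : DirichletCharacter ℂ (a * 8)) (hχ : ∀ n : ℕ, χ n = kroneckerSym ((a * 8 : ℕ) : ℤ) n) :
    gaussSum χ stdAddChar = (√((a * 8 : ℕ) : ℝ) : ℂ) := by
  have hc : a.Coprime 8 := (Nat.Coprime.pow_right 3 ho.coprime_two_right : a.Coprime (2 ^ 3))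
  have hs : (√((8 : ℕ) : ℝ) : ℂ) = 2 * (√2 : ℂ) := by
    rw [show ((8 : ℕ) : ℝ) = 2 ^ 2 * 2 by norm_num, Real.sqrt_mul (by norm_num),
      Real.sqrt_sq (by norm_num)]
    push_cast
    rfl
  have h2 : jacobiSym 2 a * jacobiSym 2 a = 1 := by
    rw [← sq]
    exact jacobiSym.sq_one (by simpa [Int.gcd] using ho.coprime_two_left)
  rcases Nat.odd_mod_four_iff.mp (Nat.odd_iff.mp ho) with h1 | h3
  · have h : ∀ n : ℕ, χ n = χ₈ n * jacobiSym n a := by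
      refine forall_eq_of_odd χ hχ (by simp; omega) (by decide) fun n hn => ?_
      rw [Nat.cast_mul, jacobiSym.mul_left, jacobiSym_eight hn,
        jacobiSym.quadratic_reciprocity_one_mod_four h1 hn, mul_comm]
    rw [gaussSum_of_forall_eq hc χ χ₈ h, sum_χ₈, jacobiGauss_eq a ha ho, if_pos h1,
      sqrt_natCast_mul, hs, jacobiSym_eight ho, ← jacobiSym.at_two ho, ← Int.cast_mul, h2]
    push_cast
    ring
  · have h : ∀ n : ℕ, χ n = χ₈' n * jacobiSym n a := by
      refine forall_eq_of_odd χ hχ (by simp; omega) (by decide) fun n hn => ?_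
      rw [Nat.cast_mul, jacobiSym.mul_left, jacobiSym_eight hn, ← jacobiSym.at_neg_two hn,
        show (-2 : ℤ) = -1 * 2 by norm_num, jacobiSym.mul_left, jacobiSym.at_neg_one hn,
        χ₄_nat_eq_if_mod_four, jacobiSym.at_two hn,
        ← jacobiSym.quadratic_reciprocity_if (Nat.odd_iff.mp ho) (Nat.odd_iff.mp hn)]
      rcases Nat.odd_mod_four_iff.mp (Nat.odd_iff.mp hn) with h' | h' <;>
        simp [h3, h', Nat.odd_iff.mp hn, mul_comm]
    have h' : χ₈' (a : ZMod 8) * jacobiSym ((8 : ℕ) : ℤ) a = -1 := by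
      rw [jacobiSym_eight ho, ← jacobiSym.at_neg_two ho, ← jacobiSym.at_two ho,
        show (-2 : ℤ) = -1 * 2 by norm_num, jacobiSym.mul_left, jacobiSym.at_neg_one ho,
        χ₄_nat_three_mod_four h3, mul_assoc, h2, mul_one]
    rw [gaussSum_of_forall_eq hc χ χ₈' h, sum_χ₈', jacobiGauss_eq a ha ho, if_neg (by omega),
      sqrt_natCast_mul, hs, ← Int.cast_mul, h']
    push_cast
    linear_combination (-2 * √(a : ℝ) * √2 : ℂ) * Complex.I_sq

lemma gaussSum_of_odd {a : ℕ} [NeZero a] (ha : Squarefree a) (h1 : a % 4 = 1)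
    (χ : DirichletCharacter ℂ a) (hχ : ∀ n : ℕ, χ n = kroneckerSym (a : ℤ) n) :
    gaussSum χ stdAddChar = (√(a : ℝ) : ℂ) := by
  have ho : Odd a := Nat.odd_iff.mpr (by omega)
  have h : ∀ n : ℕ, χ n = jacobiSym n a := by
    have hodd : ∀ n : ℕ, Odd n → χ n = jacobiSym n a := fun n hn => by
      rw [hχ, kroneckerSym_of_odd _ hn, jacobiSym.quadratic_reciprocity_one_mod_four h1 hn]
    intro n
    rcases Nat.even_or_odd n with hn | hn
    · have := hodd (n + a) (hn.add_odd ho)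
      rw [Nat.cast_add, ZMod.natCast_self, add_zero] at this
      rw [this]
      congr 1
      exact jacobiSym.mod_left' (by simp)
    · exact hodd n hn
  have hg : gaussSum χ stdAddChar = jacobiGauss a :=
    Finset.sum_congr rfl fun x _ => by rw [← h, ZMod.natCast_zmod_val]
  rw [hg, jacobiGauss_eq a ha ho, if_pos h1]

lemma gaussSum_of_isFundamentalDiscriminant {N : ℕ} [NeZero N]
    (h : IsFundamentalDiscriminant (N : ℤ)) (χ : DirichletCharacter ℂ N)
    (hχ : ∀ n : ℕ, χ n = kroneckerSym (N : ℤ) n) :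
    gaussSum χ stdAddChar = (√(N : ℝ) : ℂ) := by
  rcases h with ⟨h1, hs⟩ | ⟨h0, hs, h23⟩
  · exact gaussSum_of_odd (Int.squarefree_natCast.mp hs) (by omega) χ hχ
  · have e : (N : ℤ) / 4 = ((N / 4 : ℕ) : ℤ) := by simp
    rw [e, Int.squarefree_natCast] at hs
    rcases h23 with h2 | h3
    · obtain ⟨a, ha⟩ : ∃ a, N = a * 8 := ⟨N / 8, by omega⟩
      subst ha
      have : a * 8 / 4 = 2 * a := by omega
      rw [this] at hs
      have : NeZero a := ⟨fun h => NeZero.ne (a * 8) (by simp [h])⟩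
      exact gaussSum_of_eight_mul (hs.squarefree_of_dvd (Dvd.intro_left 2 rfl))
        (Nat.odd_iff.mpr (by omega)) χ hχ
    · obtain ⟨a, ha⟩ : ∃ a, N = a * 4 := ⟨N / 4, by omega⟩
      subst ha
      have : NeZero a := ⟨fun h => NeZero.ne (a * 4) (by simp [h])⟩
      rw [Nat.mul_div_cancel _ (by norm_num)] at hs
      exact gaussSum_of_four_mul hs (by omega) χ hχ

end ArcsinSum

namespace ArcsinSum

open ENNReal
open scoped Real

/-- The summand of the arcsine series, written with the discriminant as a parameter. -/
lemma formTerm_eq {D : ℤ} {Q : ℤ × ℤ × ℤ} (hQ : disc Q = D) :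
    formTerm Q = √D - |(Q.1 : ℝ) + (Q.2.2 : ℝ)| *
      Real.arcsin (√D / √(((Q.1 : ℝ) - (Q.2.2 : ℝ)) ^ 2 + (Q.2.1 : ℝ) ^ 2)) := by
  rw [formTerm, arcsinTerm, disc_cast, hQ]

lemma hasSum_formTerm {D : ℤ} (hD0 : 0 < D) (hD : D % 4 = 0 ∨ D % 4 = 1)
    (hs : Summable fun n : ℕ => (rho D n : ℝ) / (n : ℝ) ^ 2) :
    HasSum (fun Q : {Q | disc Q = D} => formTerm Q)
      (4 * π * meanVal D - 2 * π *
        ∑ᶠ p ∈ {p : ℤ × ℤ | p.1 % 2 = D % 2}, hurwitzH (D - p.1 ^ 2 - p.2 ^ 2)) := by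
  obtain ⟨h1, h2⟩ := tsum_formTerm hD0
    (by rw [lintegral_posSum_eq_ofReal hD0 hD hs]; exact ENNReal.ofReal_ne_top)
  have hnn : ∀ Q : {Q | disc Q = D}, 0 ≤ formTerm Q := fun Q =>
    formTerm_nonneg (by rw [Q.2]; exact hD0)
  have hsum : Summable fun Q : {Q | disc Q = D} => formTerm Q := by
    simpa only [ENNReal.toReal_ofReal (hnn _)] using ENNReal.summable_toReal h1
  rw [finsum_hurwitz hD0 hD, ← h2, ENNReal.tsum_toReal_eq fun _ => ENNReal.ofReal_ne_top]
  simpa only [ENNReal.toReal_ofReal (hnn _)] using hsum.hasSum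

lemma meanVal_eq_LFunction {N f : ℕ} [NeZero N] (hf : f ≠ 0)
    (h : IsFundamentalDiscriminant (N : ℤ))
    (hD : (N : ℤ) * (f : ℤ) ^ 2 % 4 = 0 ∨ (N : ℤ) * (f : ℤ) ^ 2 % 4 = 1)
    (χ : DirichletCharacter ℂ N) (hχ : ∀ n : ℕ, χ n = kroneckerSym (N : ℤ) n) :
    (meanVal ((N : ℤ) * (f : ℤ) ^ 2) : ℂ) =
      -5 * (DirichletCharacter.LFunction χ (-1) * divisorCorr χ f) := by
  have hr : ∀ k, star (χ k) = χ k := fun k => by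
    rw [← ZMod.natCast_zmod_val k, hχ]
    exact star_intCast _
  have hN : (0 : ℤ) < N := Int.natCast_pos.2 (NeZero.pos N)
  rw [meanVal_eq_LSeries hN h hf hD χ fun p _ => by rw [hχ]; norm_cast,
    LFunction_neg_one hr (gaussSum_of_isFundamentalDiscriminant h χ hχ), Int.cast_natCast]
  ring

end ArcsinSum

theorem statement2
    (D : ℤ) (hD : 0 < D) (hDmod : D % 4 = 0 ∨ D % 4 = 1)
    -- the decomposition D = D₀·f² with D₀ a fundamental discriminant
    (D₀ : ℤ) (f : ℕ) (hf : 0 < f)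
    (hfund : IsFundamentalDiscriminant D₀) (hdec : D = D₀ * (f : ℤ) ^ 2) [NeZero D₀.natAbs]
    -- χ is the Kronecker symbol (D₀/·) as a Dirichlet character modulo |D₀|
    (χ : DirichletCharacter ℂ D₀.natAbs)
    (hχ : ∀ n : ℕ, χ (n : ZMod D₀.natAbs) = kroneckerSym D₀ n)
    -- L_D(−1) = L_{D₀}(−1)·∑_{d∣f} μ(d)·χ_{D₀}(d)·d·σ₃(f/d)
    (LD : ℂ)
    (hLD : LD = DirichletCharacter.LFunction χ (-1) *
        ∑ d ∈ f.divisors, (ArithmeticFunction.moebius d : ℂ) * (kroneckerSym D₀ d : ℂ) * (d : ℂ) *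
          ∑ e ∈ (f / d).divisors, (e : ℂ) ^ 3) :
    -- T is the summand of the series on the left-hand side
    let T : ℤ × ℤ × ℤ → ℝ := fun p =>
      Real.sqrt D - |(p.1 : ℝ) + (p.2.2 : ℝ)| *
        Real.arcsin (Real.sqrt D / Real.sqrt (((p.1 : ℝ) - (p.2.2 : ℝ)) ^ 2 + (p.2.1 : ℝ) ^ 2))
    -- the series on the left converges absolutely
    Summable (fun p : {p : ℤ × ℤ × ℤ // p.2.1 ^ 2 - 4 * p.1 * p.2.2 = D} => |T p.1|) ∧
    -- the sum on the right has only finitely many nonzero terms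
    ({p : ℤ × ℤ | p.1 % 2 = D % 2 ∧ hurwitzH (D - p.1 ^ 2 - p.2 ^ 2) ≠ 0}).Finite ∧
    -- the identity (stated in ℂ, since L_D(−1) is a priori a complex number)
    ((4 * ∑' p : {p : ℤ × ℤ × ℤ // p.2.1 ^ 2 - 4 * p.1 * p.2.2 = D}, T p.1 : ℝ) : ℂ)
      = -80 * ((Real.pi : ℝ) : ℂ) * LD
        - 8 * ((Real.pi : ℝ) : ℂ) *
            ((∑ᶠ p ∈ {p : ℤ × ℤ | p.1 % 2 = D % 2}, hurwitzH (D - p.1 ^ 2 - p.2 ^ 2) : ℝ) : ℂ) := by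
  intro T
  obtain ⟨N, rfl⟩ : ∃ N : ℕ, D₀ = N := by
    refine ⟨D₀.toNat, (Int.toNat_of_nonneg ?_).symm⟩
    by_contra hneg
    have : D₀ * (f : ℤ) ^ 2 ≤ 0 := mul_nonpos_of_nonpos_of_nonneg (by omega) (by positivity)
    omega
  subst hdec
  change DirichletCharacter ℂ N at χ
  have hχ' : ∀ n : ℕ, χ (n : ZMod N) = kroneckerSym (N : ℤ) n := hχ
  have hN : NeZero N := ‹NeZero (N : ℤ).natAbs›
  have hs := ArcsinSum.summable_rhoTerm hfund hf.ne' χ fun p _ => by rw [hχ']; norm_cast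
  have hsum := ArcsinSum.hasSum_formTerm hD hDmod hs
  have hT : ∀ p : {p : ℤ × ℤ × ℤ // p.2.1 ^ 2 - 4 * p.1 * p.2.2 = N * (f : ℤ) ^ 2},
      T p.1 = ArcsinSum.formTerm p.1 := fun p => (ArcsinSum.formTerm_eq p.2).symm
  refine ⟨?_, ArcsinSum.hurwitz_support_finite _, ?_⟩
  · simp only [hT]
    exact hsum.summable.abs
  · have hcorr : LD = DirichletCharacter.LFunction χ (-1) * ArcsinSum.divisorCorr χ f := by
      rw [hLD, ArcsinSum.divisorCorr]
      simp only [hχ']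
    have htsum := hsum.tsum_eq
    rw [tsum_congr hT, show ∑' p : {p : ℤ × ℤ × ℤ // p.2.1 ^ 2 - 4 * p.1 * p.2.2 = N * (f : ℤ) ^ 2},
      ArcsinSum.formTerm p.1 = _ from htsum]
    have hm := ArcsinSum.meanVal_eq_LFunction hf.ne' hfund hDmod χ hχ'
    rw [← hcorr] at hm
    push_cast at hm ⊢
    rw [hm]
    ring
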